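/- Fix b with 0 < b ≤ 1 and define K_b(z) := (1/(2π)) ∫_{−1}^{1} (j_F(α)/cosh(bα)) e^{izα} dα with j_F(α) := max{1 − |α|, 0}. Assume that for all sufficiently large T, every nontrivial zero ρ = β + iγ of the Riemann zeta function with T < γ ≤ 2T satisfies |β − 1/2| < b/(2 log T). Then every term of the double sum Σ_{ρ,ρ' : T<γ,γ'≤2T} Re K_b(−i(ρ−ρ') log T) is positive, and as T → ∞ this sum equals (1/(2π)) ( 1 + 2 ∫_{0}^{1} α(1−α)/cosh(bα) dα + O(1/√(log T)) ) · (T/(2π)) log T, where the sum runs over pairs of nontrivial zeros ρ = β+iγ, ρ' = β'+iγ' with T < γ, γ' ≤ 2T, counted with multiplicity. -/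

import Mathlib

open Filter Topology MeasureTheory Set

/-- The multiplicity of `ρ` as a zero of the Riemann zeta function:
the least `n` such that the `n`-th iterated derivative of `ζ` is nonzero at `ρ`. -/
noncomputable def zetaMult (ρ : ℂ) : ℕ :=
  sInf {n : ℕ | iteratedDeriv n riemannZeta ρ ≠ 0}

/-- `ρ` is a nontrivial zero of the Riemann zeta function. -/
def IsNontrivialZero (ρ : ℂ) : Prop :=
  riemannZeta ρ = 0 ∧ 0 < ρ.re ∧ ρ.re < 1

/-- The set of nontrivial zeros `ρ = β + iγ` with `T < γ ≤ 2T`. -/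
def zeroBand (T : ℝ) : Set ℂ :=
  {ρ | IsNontrivialZero ρ ∧ T < ρ.im ∧ ρ.im ≤ 2 * T}

/-- Number of nontrivial zeros with `T < γ ≤ 2T`, counted with multiplicity. -/
noncomputable def Ntot (T : ℝ) : ℝ :=
  ∑ᶠ ρ ∈ zeroBand T, (zetaMult ρ : ℝ)

/-- Number of simple nontrivial zeros with `T < γ ≤ 2T`. -/
noncomputable def Nsimple (T : ℝ) : ℝ :=
  ∑ᶠ ρ ∈ {ρ ∈ zeroBand T | zetaMult ρ = 1}, (1 : ℝ)

/-- Number of nontrivial zeros with `T < γ ≤ 2T` on the critical line, with multiplicity. -/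
noncomputable def Nline (T : ℝ) : ℝ :=
  ∑ᶠ ρ ∈ {ρ ∈ zeroBand T | ρ.re = 1/2}, (zetaMult ρ : ℝ)

/-- Number of simple critical-line nontrivial zeros with `T < γ ≤ 2T`. -/
noncomputable def NlineSimple (T : ℝ) : ℝ :=
  ∑ᶠ ρ ∈ {ρ ∈ zeroBand T | ρ.re = 1/2 ∧ zetaMult ρ = 1}, (1 : ℝ)

/-- The Fejér kernel `j_F(α) = max{1 - |α|, 0}`. -/
noncomputable def jF (α : ℝ) : ℝ := max (1 - |α|) 0

/-- The Tsang kernel `K_b(z) = (1/(2π)) ∫_{-1}^{1} (j_F(α)/cosh(bα)) e^{izα} dα`. -/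
noncomputable def Kb (b : ℝ) (z : ℂ) : ℂ :=
  (1 / (2 * Real.pi)) * ∫ α in (-1 : ℝ)..1,
    ((jF α / Real.cosh (b * α) : ℝ) : ℂ) * Complex.exp (Complex.I * z * α)

section
open Filter Topology MeasureTheory Set
namespace KP
open Real (log exp sqrt cosh)
open Complex (I)
open scoped Real
noncomputable def xi (s : Complex) : Complex := s * (s - 1) * completedRiemannZeta₀ s + 1
lemma xi_diff : Differentiable Complex xi := by
  unfold xi
  have := differentiable_completedZeta₀
  fun_prop
lemma xi_one_sub (s : Complex) : xi (1 - s) = xi s := by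
  unfold xi; rw [completedRiemannZeta₀_one_sub]; ring
lemma xi_eq {s : Complex} (h0 : s ≠ 0) (h1 : s ≠ 1) : xi s = s * (s - 1) * completedRiemannZeta s := by
  rw [completedRiemannZeta_eq, xi]
  have : (1 - s) ≠ 0 := sub_ne_zero.2 h1.symm
  field_simp; ring
lemma xi_eq_zeta {s : Complex} (h0 : 0 < s.re) (h1 : s ≠ 1) :
    xi s = s * (s - 1) * s.Gammaℝ * riemannZeta s := by
  have h : s ≠ 0 := by rintro rfl; simp at h0
  rw [xi_eq h h1, riemannZeta_def_of_ne_zero h]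
  field_simp [Complex.Gammaℝ_ne_zero_of_re_pos h0]
lemma xi_zero_iff (s : Complex) : xi s = 0 ↔ IsNontrivialZero s := by
  have key : ∀ s : Complex, 1 ≤ s.re → xi s ≠ 0 := by
    intro s hs
    by_cases h : s = 1
    · simp [h, xi]
    · rw [xi_eq_zeta (by linarith) h]
      have h0 : s ≠ 0 := by rintro rfl; norm_num at hs
      exact mul_ne_zero (mul_ne_zero (mul_ne_zero h0 (sub_ne_zero.2 h))
        (Complex.Gammaℝ_ne_zero_of_re_pos (by linarith))) (riemannZeta_ne_zero_of_one_le_re hs)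
  constructor
  · intro h
    have h1 : s.re < 1 := by
      by_contra h'; exact key s (by linarith) h
    have h0 : 0 < s.re := by
      by_contra h'
      exact key (1 - s) (by simp; linarith) (by rw [xi_one_sub, h])
    have hs1 : s ≠ 1 := by rintro rfl; simp at h1
    have hs0 : s ≠ 0 := by rintro rfl; simp at h0
    rw [xi_eq_zeta h0 hs1] at h
    refine ⟨?_, h0, h1⟩
    simpa [hs0, sub_ne_zero.2 hs1, Complex.Gammaℝ_ne_zero_of_re_pos h0] using h
  · rintro ⟨h, h0, h1⟩
    have hs1 : s ≠ 1 := by rintro rfl; simp at h1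
    rw [xi_eq_zeta h0 hs1, h, mul_zero]
lemma xi_ana (s : Complex) : AnalyticAt Complex xi s := xi_diff.analyticAt s
lemma xi_order_ne_top (s : Complex) : analyticOrderAt xi s ≠ ⊤ := by
  refine AnalyticOnNhd.analyticOrderAt_ne_top_of_isPreconnected (U := univ) (x := 0)
    (fun z _ => xi_ana z) isPreconnected_univ trivial trivial ?_
  rw [(xi_ana 0).analyticOrderAt_eq_zero.2 (by simp [xi])]
  simp
/-- multiplicity -/
noncomputable def mu (s : Complex) : Nat := analyticOrderNatAt xi s
lemma zetaMult_eq {s : Complex} (hs : IsNontrivialZero s) : zetaMult s = mu s := by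
  obtain ⟨h, h0, h1⟩ := hs
  have hs1 : s ≠ 1 := by rintro rfl; simp at h1
  have hs0 : s ≠ 0 := by rintro rfl; simp at h0
  have hζ : AnalyticAt Complex riemannZeta s := by
    refine (DifferentiableOn.analyticAt (s := {1}ᶜ) (fun z hz => (differentiableAt_riemannZeta hz).differentiableWithinAt) ?_)
    exact isOpen_compl_singleton.mem_nhds hs1
  set G : Complex → Complex := fun s => s * (s - 1) * s.Gammaℝ with hG
  have hGa : AnalyticAt Complex G s := by
    have : AnalyticAt Complex (fun s : Complex => s.Gammaℝ) s := by
      have := (Complex.differentiable_Gammaℝ_inv.analyticAt s).inv (inv_ne_zero (Complex.Gammaℝ_ne_zero_of_re_pos h0))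
      exact this.congr (Eventually.of_forall fun z => by simp)
    fun_prop
  have hGn : G s ≠ 0 := mul_ne_zero (mul_ne_zero hs0 (sub_ne_zero.2 hs1)) (Complex.Gammaℝ_ne_zero_of_re_pos h0)
  have hev : xi =ᶠ[𝓝 s] G * riemannZeta := by
    filter_upwards [isOpen_compl_singleton.mem_nhds hs1,
      (isOpen_lt continuous_const Complex.continuous_re).mem_nhds h0] with z hz1 hz2
    exact xi_eq_zeta hz2 hz1
  have ho : analyticOrderAt xi s = analyticOrderAt riemannZeta s := by
    rw [analyticOrderAt_congr hev, analyticOrderAt_mul hGa hζ, hGa.analyticOrderAt_eq_zero.2 hGn, zero_add]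
  have h2 : analyticOrderAt riemannZeta s = (mu s : ℕ∞) := by
    rw [← ho, mu, Nat.cast_analyticOrderNatAt (xi_order_ne_top s)]
  rw [analyticOrderAt_eq_nat_iff_iteratedDeriv_eq_zero hζ] at h2
  unfold zetaMult
  apply le_antisymm
  · exact Nat.sInf_le h2.2
  · apply le_csInf ⟨_, h2.2⟩
    intro n hn
    by_contra hlt
    exact hn (h2.1 n (by omega))
lemma mu_spec (s : Complex) : ∃ g : Complex → Complex, AnalyticAt Complex g s ∧ g s ≠ 0 ∧
    ∀ᶠ z in 𝓝 s, xi z = (z - s) ^ (mu s) • g z :=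
  ((xi_ana s).analyticOrderNatAt_eq_iff (xi_order_ne_top s)).1 rfl
lemma mu_eq_of {s : Complex} {n : Nat} (h : ∃ g : Complex → Complex, AnalyticAt Complex g s ∧ g s ≠ 0 ∧
    ∀ᶠ z in 𝓝 s, xi z = (z - s) ^ n • g z) : mu s = n :=
  ((xi_ana s).analyticOrderNatAt_eq_iff (xi_order_ne_top s)).2 h
lemma mu_one_sub (s : Complex) : mu (1 - s) = mu s := by
  apply mu_eq_of
  obtain ⟨g, hg, hg0, hev⟩ := mu_spec s
  have ht : Tendsto (fun z : Complex => 1 - z) (𝓝 (1 - s)) (𝓝 s) := by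
    have : ContinuousAt (fun z : Complex => 1 - z) (1 - s) := by fun_prop
    simpa [ContinuousAt] using this
  refine ⟨fun z => (-1) ^ (mu s) * g (1 - z), ?_, ?_, ?_⟩
  · have : AnalyticAt Complex (fun z => g (1 - z)) (1 - s) :=
      AnalyticAt.fun_comp (g := g) (f := fun z => 1 - z) (by simpa using hg) (by fun_prop)
    exact analyticAt_const.mul this
  · simp [hg0]
  · filter_upwards [ht.eventually hev] with z hz
    rw [← xi_one_sub, hz]
    rw [show (1 - z - s) = (-1) * (z - (1 - s)) by ring, mul_pow]
    simp only [smul_eq_mul]; ring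
lemma Gammaℝ_conj (s : Complex) : (starRingEnd Complex s).Gammaℝ = starRingEnd Complex s.Gammaℝ := by
  rw [Complex.Gammaℝ_def, Complex.Gammaℝ_def, map_mul, ← Complex.Gamma_conj]
  congr 1
  · have := Complex.cpow_conj (π : Complex) (-s / 2) (by rw [Complex.arg_ofReal_of_nonneg Real.pi_pos.le]; exact Real.pi_pos.ne)
    simpa [Complex.conj_ofNat] using this
  · simp [Complex.conj_ofNat]
lemma xi_conj (s : Complex) : xi (starRingEnd Complex s) = starRingEnd Complex (xi s) := by
  have key : ∀ s : Complex, 0 < s.re → xi (starRingEnd Complex s) = starRingEnd Complex (xi s) := by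
    intro s hs
    by_cases h : s = 1
    · simp [h, xi]
    · have h' : starRingEnd Complex s ≠ 1 := by
        intro hh; apply h
        have := congrArg (starRingEnd Complex) hh
        simpa using this
      rw [xi_eq_zeta hs h, xi_eq_zeta (by simpa using hs) h', Gammaℝ_conj, riemannZeta_conj]
      simp
  by_cases hs : 0 < s.re
  · exact key s hs
  · have := key (1 - s) (by simp; linarith)
    rw [map_sub, map_one, xi_one_sub, xi_one_sub] at this
    exact this
lemma mu_conj (s : Complex) : mu (starRingEnd Complex s) = mu s := by
  apply mu_eq_of
  obtain ⟨g, hg, hg0, hev⟩ := mu_spec s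
  have ht : Tendsto (starRingEnd Complex) (𝓝 (starRingEnd Complex s)) (𝓝 s) := by
    have : ContinuousAt (starRingEnd Complex) (starRingEnd Complex s) := Complex.continuous_conj.continuousAt
    simpa [ContinuousAt] using this
  refine ⟨fun z => starRingEnd Complex (g (starRingEnd Complex z)), ?_, ?_, ?_⟩
  · rw [Complex.analyticAt_iff_eventually_differentiableAt] at hg ⊢
    filter_upwards [ht.eventually hg] with z hz
    have := hz.conj_conj
    simpa [Function.comp_def] using this
  · simp [hg0]
  · filter_upwards [ht.eventually hev] with z hz
    have := xi_conj (starRingEnd Complex z)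
    rw [hz] at this
    simpa using this
lemma mu_pos_iff (s : Complex) : 0 < mu s ↔ xi s = 0 := by
  have := (xi_ana s).analyticOrderAt_ne_zero
  rw [← this, ← Nat.cast_analyticOrderNatAt (xi_order_ne_top s)]
  simp [mu, Nat.pos_iff_ne_zero]
lemma zeros_finite (R : Real) : {s : Complex | xi s = 0 ∧ ‖s - 1/2‖ < R}.Finite := by
  have hcl : IsCompact (Metric.closedBall (1/2 : Complex) R) := isCompact_closedBall _ _
  refine (hcl.inter_riemannZetaZeros_finite).subset ?_
  rintro s ⟨h, h2⟩
  refine ⟨by simpa [dist_eq_norm] using h2.le, ?_⟩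
  exact ((xi_zero_iff s).1 h).1
/-- zeros in a ball -/
noncomputable def Zn (R : Real) : Finset Complex := (zeros_finite R).toFinset
lemma mem_Zn {R : Real} {s : Complex} : s ∈ Zn R ↔ xi s = 0 ∧ ‖s - 1/2‖ < R := by
  simp [Zn]
lemma Zn_one_sub {R : Real} {s : Complex} (h : s ∈ Zn R) : 1 - s ∈ Zn R := by
  rw [mem_Zn] at *
  refine ⟨by rw [xi_one_sub, h.1], ?_⟩
  rw [show (1 - s - 1/2 : Complex) = -(s - 1/2) by ring, norm_neg]; exact h.2
lemma sum_Zn_one_sub {R : Real} (f : Complex → Complex) : ∑ s ∈ Zn R, f (1 - s) = ∑ s ∈ Zn R, f s := by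
  refine Finset.sum_nbij' (fun s => 1 - s) (fun s => 1 - s) (fun s h => Zn_one_sub h) (fun s h => Zn_one_sub h) ?_ ?_ ?_ <;> simp
lemma norm_Gamma_le {s : Complex} (hs : 0 < s.re) : ‖Complex.Gamma s‖ ≤ Real.Gamma s.re := by
  rw [Complex.Gamma_eq_integral hs, Real.Gamma_eq_integral hs, Complex.GammaIntegral]
  refine (norm_integral_le_integral_norm _).trans (le_of_eq ?_)
  refine setIntegral_congr_fun measurableSet_Ioi fun x hx => ?_
  simp only [norm_mul]
  rw [Complex.norm_cpow_eq_rpow_re_of_pos hx]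
  rw [Complex.norm_real, Real.norm_of_nonneg (Real.exp_pos _).le]; simp
lemma Gamma_le_exp {x : Real} (hx : 1 ≤ x) : Real.Gamma x ≤ exp (2 * (x + 1) ^ (3/2 : Real)) := by
  have h1 : Real.Gamma x ≤ Real.Gamma (x + 1) := by
    rw [Real.Gamma_add_one (by linarith)]
    nlinarith [Real.Gamma_pos_of_pos (show 0 < x by linarith)]
  set n := ⌈x⌉₊
  have hn : x ≤ n := Nat.le_ceil x
  have hn2 : (n : Real) < x + 1 := Nat.ceil_lt_add_one (by linarith)
  have h2 : Real.Gamma (x + 1) ≤ n.factorial := by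
    rw [← Real.Gamma_nat_eq_factorial]
    exact Real.Gamma_strictMonoOn_Ici.monotoneOn (by simp; linarith) (by simp; linarith) (by linarith)
  have h3 : (n.factorial : Real) ≤ (n : Real) ^ n := by exact_mod_cast Nat.factorial_le_pow n
  refine (h1.trans (h2.trans h3)).trans ?_
  rw [← Real.rpow_natCast, Real.rpow_def_of_pos (by linarith)]
  apply Real.exp_le_exp.2
  have h4 := Real.log_le_rpow_div (x := n) (ε := 1/2) (by linarith) (by norm_num)
  calc log n * n ≤ (n : Real) ^ (1/2 : Real) / (1/2) * n := by gcongr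
    _ = 2 * ((n : Real) ^ (1/2 : Real) * (n : Real) ^ (1 : Real)) := by rw [Real.rpow_one]; ring
    _ = 2 * (n : Real) ^ (3/2 : Real) := by rw [← Real.rpow_add (by linarith)]; norm_num
    _ ≤ _ := by gcongr
lemma zeta_bdd : ∃ C > 0, ∀ s : Complex, 2 ≤ s.re → ‖riemannZeta s‖ ≤ C := by
  have hsum : Summable (fun n : Nat => 1 / ((n : Real) + 1) ^ 2) := by
    have := (summable_nat_add_iff 1).2 (Real.summable_one_div_nat_pow.2 (one_lt_two))
    simpa using this
  refine ⟨∑' n : Nat, 1 / ((n : Real) + 1) ^ 2, ?_, ?_⟩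
  · exact hsum.tsum_pos (fun n => by positivity) 0 (by norm_num)
  · intro s hs
    rw [zeta_eq_tsum_one_div_nat_add_one_cpow (by linarith)]
    refine tsum_of_norm_bounded hsum.hasSum fun n => ?_
    rw [norm_div, norm_one]
    have : ‖((n : Complex) + 1) ^ s‖ = ((n : Real) + 1) ^ s.re := by
      have := Complex.norm_cpow_eq_rpow_re_of_pos (x := (n : Real) + 1) (by positivity) s
      simpa using this
    rw [this]
    gcongr
    rw [← Real.rpow_natCast]
    exact Real.rpow_le_rpow_of_exponent_le (by linarith [Nat.cast_nonneg (α := Real) n]) (by simpa using hs)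
lemma strip_bdd : ∃ C > 0, ∀ s : Complex, 0 ≤ s.re → s.re ≤ 2 → ‖completedRiemannZeta₀ s‖ ≤ C := by
  set P := HurwitzZeta.hurwitzEvenFEPair 0
  have hM : ∀ s : Complex, MellinConvergent P.f_modif s := fun s =>
    (P.isStrongFEPair_toStrongFEPair.hasMellin s).1
  set B : Real := ∫ t in Ioi (0:Real), (‖(t : Complex) ^ ((0:Complex) - 1) • P.f_modif t‖ + ‖(t : Complex) ^ ((1:Complex) - 1) • P.f_modif t‖)
  have hB0 : 0 ≤ B := integral_nonneg fun t => by positivity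
  refine ⟨B + 1, by linarith, fun s h0 h2 => ?_⟩
  have : completedRiemannZeta₀ s = mellin P.f_modif (s / 2) / 2 := rfl
  rw [this, norm_div]
  have h : ‖mellin P.f_modif (s / 2)‖ ≤ B := by
    refine (norm_integral_le_integral_norm _).trans ?_
    refine setIntegral_mono_on (hM _).norm ((hM 0).norm.add (hM 1).norm) measurableSet_Ioi fun t ht => ?_
    have ht : 0 < t := ht
    simp only [norm_smul]
    rw [← add_mul]
    refine mul_le_mul_of_nonneg_right ?_ (norm_nonneg _)
    rw [Complex.norm_cpow_eq_rpow_re_of_pos ht, Complex.norm_cpow_eq_rpow_re_of_pos ht, Complex.norm_cpow_eq_rpow_re_of_pos ht]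
    have hre : (s / 2 - 1).re = s.re / 2 - 1 := by simp
    rw [hre]
    simp only [zero_sub, Complex.neg_re, Complex.one_re, sub_self, Complex.zero_re, Real.rpow_zero]
    rcases le_total t 1 with h | h
    · have := Real.rpow_le_rpow_of_exponent_ge ht h (show -1 ≤ s.re / 2 - 1 by linarith)
      linarith
    · have := Real.rpow_le_one_of_one_le_of_nonpos h (show s.re / 2 - 1 ≤ 0 by linarith)
      have := Real.rpow_pos_of_pos ht (-1)
      linarith
  have : ‖(2:Complex)‖ = 2 := by simp
  rw [this]; linarith
lemma xi_growth : ∃ C > 0, ∀ s : Complex, ‖xi s‖ ≤ exp (C * (1 + ‖s‖) ^ (3/2 : Real)) := by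
  obtain ⟨C1, hC1, h1⟩ := strip_bdd
  obtain ⟨C2, hC2, h2⟩ := zeta_bdd
  have key : ∀ s : Complex, 1/2 ≤ s.re → ‖xi s‖ ≤ exp ((C1 + C2 + 8) * (1 + ‖s‖) ^ (3/2 : Real)) := by
    intro s hs
    set x := 1 + ‖s‖ with hx
    have hx1 : 1 ≤ x := by linarith [norm_nonneg s]
    have hxx : x ≤ x ^ (3/2 : Real) := by
      conv_lhs => rw [← Real.rpow_one x]
      exact Real.rpow_le_rpow_of_exponent_le hx1 (by norm_num)
    have hs1 : ‖s‖ ≤ x := by linarith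
    have hs2 : ‖s - 1‖ ≤ x := by
      refine (norm_sub_le _ _).trans ?_; simp; linarith
    have hC : ∀ c : Real, c ≤ exp c := fun c => by linarith [Real.add_one_le_exp c]
    by_cases hs3 : s.re ≤ 2
    · have := h1 s (by linarith) hs3
      calc ‖xi s‖ ≤ ‖s‖ * ‖s - 1‖ * ‖completedRiemannZeta₀ s‖ + 1 := by
            unfold xi; refine (norm_add_le _ _).trans ?_; simp
        _ ≤ x * x * C1 + 1 := by gcongr
        _ ≤ x * x * (C1 + 1) := by nlinarith
        _ ≤ exp x * exp x * exp (C1 + 1) := by gcongr <;> exact hC _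
        _ = exp (x + x + (C1 + 1)) := by simp only [← Real.exp_add]
        _ ≤ _ := by
          apply Real.exp_le_exp.2
          nlinarith
    · push Not at hs3
      have hne : s ≠ 1 := by rintro rfl; norm_num at hs3
      have hG : ‖s.Gammaℝ‖ ≤ exp (2 * x ^ (3/2 : Real)) := by
        rw [Complex.Gammaℝ_def, norm_mul, Complex.norm_cpow_eq_rpow_re_of_pos Real.pi_pos]
        have hre : (s / 2).re = s.re / 2 := by simp
        have e1 : π ^ (-s / 2).re ≤ 1 := by
          apply Real.rpow_le_one_of_one_le_of_nonpos
          · linarith [Real.pi_gt_three]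
          · simp; linarith
        have e2 : ‖Complex.Gamma (s / 2)‖ ≤ exp (2 * (s.re / 2 + 1) ^ (3/2 : Real)) := by
          have := norm_Gamma_le (s := s / 2) (by rw [hre]; linarith)
          rw [hre] at this
          exact this.trans (Gamma_le_exp (by linarith))
        have e3 : s.re / 2 + 1 ≤ x := by linarith [Complex.re_le_norm s]
        calc _ ≤ 1 * exp (2 * (s.re / 2 + 1) ^ (3/2 : Real)) := by gcongr
          _ ≤ _ := by rw [one_mul]; gcongr
      have := h2 s (by linarith)
      rw [xi_eq_zeta (by linarith) hne]
      calc ‖s * (s - 1) * s.Gammaℝ * riemannZeta s‖ = ‖s‖ * ‖s - 1‖ * ‖s.Gammaℝ‖ * ‖riemannZeta s‖ := by simp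
        _ ≤ x * x * exp (2 * x ^ (3/2 : Real)) * C2 := by gcongr
        _ ≤ exp x * exp x * exp (2 * x ^ (3/2 : Real)) * exp C2 := by gcongr <;> exact hC _
        _ = exp (x + x + 2 * x ^ (3/2 : Real) + C2) := by simp only [← Real.exp_add]
        _ ≤ _ := by apply Real.exp_le_exp.2; nlinarith
  refine ⟨(C1 + C2 + 8) * 2 ^ (3/2 : Real), by positivity, fun s => ?_⟩
  have hle : ∀ y : Real, 0 ≤ y → y ≤ 2 * (1 + ‖s‖) → exp ((C1 + C2 + 8) * y ^ (3/2 : Real)) ≤ exp ((C1 + C2 + 8) * 2 ^ (3/2 : Real) * (1 + ‖s‖) ^ (3/2 : Real)) := by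
    intro y hy hy2
    apply Real.exp_le_exp.2
    rw [mul_assoc, ← Real.mul_rpow (by norm_num) (by positivity)]
    gcongr
  rcases le_total (1/2) s.re with h | h
  · exact (key s h).trans (hle _ (by positivity) (by linarith [norm_nonneg s]))
  · rw [← xi_one_sub]
    refine (key (1 - s) (by simp; linarith)).trans (hle _ (by positivity) ?_)
    have := norm_sub_le (1 : Complex) s
    simp at this; linarith [norm_nonneg s]
lemma factor_one {f : Complex → Complex} (a : Complex) (n : Nat) : Differentiable Complex f → analyticOrderAt f a = n →
    ∃ F : Complex → Complex, Differentiable Complex F ∧ (∀ z, f z = (z - a) ^ n * F z) ∧ F a ≠ 0 := by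
  induction n generalizing f with
  | zero =>
    intro hf h
    exact ⟨f, hf, by simp, (hf.analyticAt a).analyticOrderAt_eq_zero.1 (by simpa using h)⟩
  | succ n ih =>
    intro hf h
    have h0 : f a = 0 := by
      apply apply_eq_zero_of_analyticOrderAt_ne_zero; rw [h]; simp
    have hg : Differentiable Complex (dslope f a) := by
      rw [← differentiableOn_univ, Complex.differentiableOn_dslope univ_mem]
      exact hf.differentiableOn
    have hfg : ∀ z, f z = (z - a) * dslope f a z := fun z => by
      have := sub_smul_dslope f a z
      simpa [h0] using this.symm
    obtain ⟨F, hF, hF2, hF3⟩ := ih hg (by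
      have e : f = (fun z => z - a) * dslope f a := funext hfg
      rw [e, analyticOrderAt_mul (by fun_prop) (hg.analyticAt a)] at h
      have e2 : analyticOrderAt (fun z : Complex => z - a) a = 1 := analyticOrderAt_id_sub_const_self
      rw [e2] at h
      push_cast at h
      rw [add_comm (1 : ℕ∞)] at h
      exact (ENat.add_left_injective_of_ne_top (by simp) h))
    exact ⟨F, hF, fun z => by rw [hfg, hF2]; ring, hF3⟩
lemma factor_xi (Z : Finset Complex) : ∃ F : Complex → Complex, Differentiable Complex F ∧
    (∀ z, xi z = (∏ a ∈ Z, (z - a) ^ mu a) * F z) ∧ ∀ a ∈ Z, F a ≠ 0 := by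
  induction Z using Finset.induction_on with
  | empty => exact ⟨xi, xi_diff, by simp, by simp⟩
  | insert a Z ha ih =>
    obtain ⟨F, hF, h1, h2⟩ := ih
    have ho : analyticOrderAt F a = mu a := by
      have e : xi = (fun z => ∏ a ∈ Z, (z - a) ^ mu a) * F := funext h1
      have hd : Differentiable Complex (fun z : Complex => ∏ a ∈ Z, (z - a) ^ mu a) := by fun_prop
      have e2 : analyticOrderAt xi a = analyticOrderAt F a := by
        rw [e, analyticOrderAt_mul (hd.analyticAt a) (hF.analyticAt a),
          (hd.analyticAt a).analyticOrderAt_eq_zero.2, zero_add]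
        refine Finset.prod_ne_zero_iff.2 fun c hc => pow_ne_zero _ (sub_ne_zero.2 ?_)
        rintro rfl; exact ha hc
      rw [← e2, mu, Nat.cast_analyticOrderNatAt (xi_order_ne_top a)]
    obtain ⟨G, hG, h3, h4⟩ := factor_one a (mu a) hF ho
    refine ⟨G, hG, fun z => ?_, fun c hc => ?_⟩
    · rw [h1, h3, Finset.prod_insert ha]; ring
    · rcases Finset.mem_insert.1 hc with rfl | hc
      · exact h4
      · intro h; exact h2 c hc (by rw [h3, h, mul_zero])
lemma logDeriv_lip {F : Complex → Complex} (hF : Differentiable Complex F) {r M : Real} (hr : 0 < r) (hM : 0 < M)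
    (hne : ∀ z, ‖z‖ < r → F z ≠ 0) (hb : ∀ z, ‖z‖ < r → ‖F z‖ ≤ ‖F 0‖ * exp M)
    {s t : Complex} (hs : ‖s‖ ≤ r / 5) (ht : ‖t‖ ≤ r / 5) :
    ‖logDeriv F s - logDeriv F t‖ ≤ 64 * M / r ^ 2 * ‖s - t‖ := by
  have hldiff : DifferentiableOn Complex (logDeriv F) (Metric.ball 0 r) := by
    intro z hz
    have h1 : Differentiable Complex (deriv F) := hF.deriv
    have := hne z (by simpa using hz)
    exact ((h1 z).div (hF z) this).differentiableWithinAt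
  obtain ⟨q, hq0, hq⟩ := hldiff.isExactOn_ball.with_val_at 0 0
  have hqd : DifferentiableOn Complex q (Metric.ball 0 r) := fun z hz => (hq z hz).differentiableAt.differentiableWithinAt
  have hexp : EqOn (logDeriv F) (logDeriv (fun z => Complex.exp (q z))) (Metric.ball 0 r) := by
    intro z hz
    have := (hq z hz).cexp.deriv
    rw [logDeriv_apply (fun z => Complex.exp (q z)), this]
    field_simp
  rw [logDeriv_eqOn_iff hF.differentiableOn hqd.cexp Metric.isOpen_ball (convex_ball 0 r).isPreconnected
    (fun z _ => Complex.exp_ne_zero _) (fun z hz => hne z (by simpa using hz))] at hexp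
  obtain ⟨c, hc0, hc⟩ := hexp
  have h0 : F 0 = c := by
    have := hc (Metric.mem_ball_self hr)
    simpa [hq0] using this
  have hre : MapsTo q (Metric.ball 0 r) {z | z.re ≤ M} := by
    intro z hz
    have h1 := hc hz
    have h2 := hb z (by simpa using hz)
    rw [h1, h0] at h2
    simp only [Pi.smul_apply, smul_eq_mul, norm_mul, Complex.norm_exp] at h2
    have := le_of_mul_le_mul_left h2 (norm_pos_iff.2 hc0)
    simpa using this
  have hbd : ∀ z : Complex, ‖z‖ ≤ r / 2 → ‖q z‖ ≤ 2 * M := by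
    intro z hz
    have := Complex.borelCaratheodory_zero hM hqd hre hr (z := z) (by simp; linarith) hq0
    refine this.trans ?_
    rw [div_le_iff₀ (by linarith)]
    nlinarith
  have h2 : ∀ z ∈ Metric.ball (0:Complex) (r/4), ‖deriv (logDeriv F) z‖ ≤ 64 * M / r ^ 2 := by
    intro z hz
    have hz' : ‖z‖ < r / 4 := by simpa using hz
    have hsub : Metric.closedBall z (r/4) ⊆ Metric.ball 0 r := by
      intro w hw
      simp only [Metric.mem_closedBall, dist_eq_norm] at hw
      have := norm_add_le (w - z) z
      simp only [sub_add_cancel] at this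
      simp; linarith
    have := Complex.norm_iteratedDeriv_le_of_forall_mem_sphere_norm_le (f := q) (c := z) (R := r/4) (C := 2 * M) 2
      (by linarith) (hqd.diffContOnCl_ball hsub) (by
        intro w hw
        apply hbd
        simp only [mem_sphere_iff_norm] at hw
        have := norm_add_le (w - z) z
        simp only [sub_add_cancel] at this
        linarith)
    rw [iteratedDeriv_succ, iteratedDeriv_one] at this
    have e : deriv q =ᶠ[𝓝 z] logDeriv F := by
      filter_upwards [Metric.isOpen_ball.mem_nhds (hsub (Metric.mem_closedBall_self (by linarith)))] with w hw
      exact (hq w hw).deriv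
    rw [e.deriv_eq] at this
    refine this.trans (le_of_eq ?_)
    simp only [Nat.factorial]; field_simp; norm_num
  rw [norm_sub_rev]
  rw [norm_sub_rev s]
  refine Convex.norm_image_sub_le_of_norm_deriv_le (s := Metric.ball (0:Complex) (r/4)) (f := logDeriv F) ?_ h2 (convex_ball _ _) ?_ ?_
  · intro z hz
    exact (hldiff z (Metric.ball_subset_ball (by linarith) hz)).differentiableAt (Metric.isOpen_ball.mem_nhds (Metric.ball_subset_ball (by linarith) hz))
  · simp; linarith
  · simp; linarith
lemma hadamard {s : Complex} (hs : xi s ≠ 0) :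
    Tendsto (fun n : Nat => ∑ a ∈ Zn n, (mu a : Complex) / (s - a)) atTop (𝓝 (logDeriv xi s)) := by
  obtain ⟨C, hC, hgrow⟩ := xi_growth
  rw [tendsto_iff_norm_sub_tendsto_zero]
  have hlim : Tendsto (fun n : Nat => 128 * C * (6:Real) ^ (3/2 : Real) * ‖s - (1 - s)‖ * (n : Real) ^ (-(1/2 : Real))) atTop (𝓝 0) := by
    have := (tendsto_rpow_neg_atTop (show (0:Real) < 1/2 by norm_num)).comp tendsto_natCast_atTop_atTop
    have := this.const_mul (128 * C * (6:Real) ^ (3/2 : Real) * ‖s - (1 - s)‖)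
    simpa using this
  refine squeeze_zero' (Eventually.of_forall fun _ => norm_nonneg _) ?_ hlim
  have hn1 := tendsto_natCast_atTop_atTop (R := Real) |>.eventually (eventually_ge_atTop (10 * (‖s‖ + 1)))
  filter_upwards [hn1] with n hn
  have hn10 : (10 : Real) ≤ n := by linarith [norm_nonneg s]
  obtain ⟨F, hF, h1, h2⟩ := factor_xi (Zn n)
  set r : Real := n / 2 + n / 4 with hr
  have hmem : ∀ z : Complex, ‖z‖ < r → xi z = 0 → z ∈ Zn n := fun z hz h => by
    refine mem_Zn.2 ⟨h, (norm_sub_le _ _).trans_lt ?_⟩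
    norm_num; linarith
  have hne : ∀ z, ‖z‖ < r → F z ≠ 0 := by
    intro z hz h
    exact h2 z (hmem z hz (by rw [h1, h, mul_zero])) h
  set M := C * (1 + 4 * n) ^ (3/2 : Real) with hM
  have hP : ∀ z : Complex, ‖z‖ = 4 * n → ‖∏ a ∈ Zn n, ((0:Complex) - a) ^ mu a‖ ≤ ‖∏ a ∈ Zn n, (z - a) ^ mu a‖ := by
    intro z hz
    rw [norm_prod, norm_prod]
    refine Finset.prod_le_prod (fun _ _ => norm_nonneg _) fun a ha => ?_
    rw [norm_pow, norm_pow]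
    refine pow_le_pow_left₀ (norm_nonneg _) ?_ _
    have ha := (mem_Zn.1 ha).2
    have e1 : ‖a‖ ≤ n + 1 := by
      have := norm_add_le (a - 1/2) (1/2)
      norm_num at this; norm_num at ha; linarith
    have e2 := norm_sub_norm_le z a
    rw [zero_sub, norm_neg]; linarith
  have hxi0 : xi 0 = 1 := by simp [xi]
  have hP0 : ‖∏ a ∈ Zn n, ((0:Complex) - a) ^ mu a‖ * ‖F 0‖ = 1 := by
    rw [← norm_mul, ← h1, hxi0, norm_one]
  have hP0' : 0 < ‖∏ a ∈ Zn n, ((0:Complex) - a) ^ mu a‖ := by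
    rcases (norm_nonneg (∏ a ∈ Zn n, ((0:Complex) - a) ^ mu a)).eq_or_lt with h | h
    · rw [← h] at hP0; simp at hP0
    · exact h
  have hb : ∀ z, ‖z‖ < r → ‖F z‖ ≤ ‖F 0‖ * exp M := by
    intro z hz
    refine Complex.norm_le_of_forall_mem_frontier_norm_le (U := Metric.ball 0 (4 * n)) Metric.isBounded_ball hF.diffContOnCl ?_ (subset_closure (by simp; linarith))
    intro w hw
    rw [frontier_ball _ (by positivity)] at hw
    have hw : ‖w‖ = 4 * n := by simpa using hw
    have e1 := hgrow w
    rw [h1, norm_mul, hw, ← hM] at e1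
    have e2 := hP w hw
    have e3 : ‖∏ a ∈ Zn n, ((0:Complex) - a) ^ mu a‖ * ‖F w‖ ≤ ‖∏ a ∈ Zn n, ((0:Complex) - a) ^ mu a‖ * (‖F 0‖ * exp M) := by
      rw [← mul_assoc, hP0, one_mul]
      exact (mul_le_mul_of_nonneg_right e2 (norm_nonneg _)).trans e1
    exact le_of_mul_le_mul_left e3 hP0'
  have hnn : (0:Real) < n := by linarith
  have hld : ∀ z : Complex, ‖z‖ < r → xi z ≠ 0 → logDeriv xi z = ∑ a ∈ Zn n, (mu a : Complex) / (z - a) + logDeriv F z := by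
    intro z hz hxz
    have hza : ∀ a ∈ Zn n, (z - a) ^ mu a ≠ 0 := fun a ha => pow_ne_zero _ (sub_ne_zero.2 (by
      rintro rfl; exact hxz (mem_Zn.1 ha).1))
    have e : xi = fun z => (∏ a ∈ Zn n, (z - a) ^ mu a) * F z := funext h1
    rw [e, logDeriv_mul z (Finset.prod_ne_zero_iff.2 hza) (hne z hz) (by fun_prop) (hF z)]
    congr 1
    have e3 := logDeriv_prod (s := Zn n) (f := fun (a : Complex) (z : Complex) => (z - a) ^ mu a) (x := z) hza (by intros; fun_prop)
    refine Eq.trans ?_ (e3.trans ?_)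
    · congr 1
    · refine Finset.sum_congr rfl fun a _ => ?_
      rw [logDeriv_fun_pow (by fun_prop)]
      simp [logDeriv_apply, div_eq_mul_inv]
  have hs1 : ‖1 - s‖ ≤ ‖s‖ + 1 := by
    have := norm_sub_le (1:Complex) s; simp at this; linarith
  have hs' : xi (1 - s) ≠ 0 := by rwa [xi_one_sub]
  have hodd : logDeriv xi (1 - s) = - logDeriv xi s := by
    rw [logDeriv_apply, logDeriv_apply, xi_one_sub]
    have : deriv xi s = - deriv xi (1 - s) := by
      have e := deriv_comp_const_sub (f := xi) 1 s
      have e2 : (fun x => xi (1 - x)) = xi := funext xi_one_sub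
      rw [e2] at e; exact e
    rw [this]; ring
  have hsumodd : ∑ a ∈ Zn n, (mu a : Complex) / ((1 - s) - a) = - ∑ a ∈ Zn n, (mu a : Complex) / (s - a) := by
    rw [← sum_Zn_one_sub, ← Finset.sum_neg_distrib]
    refine Finset.sum_congr rfl fun a _ => ?_
    rw [mu_one_sub, show (1 - s - (1 - a)) = -(s - a) by ring, div_neg]
  have hl := logDeriv_lip hF (show 0 < r by positivity) (show 0 < M by positivity) hne hb (s := s) (t := 1 - s)
    (by linarith) (by linarith)
  have g1 := hld s (by linarith) hs
  have g2 := hld (1 - s) (by linarith) hs'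
  rw [hodd, hsumodd] at g2
  have g3 : logDeriv F s - logDeriv F (1 - s) = 2 * (logDeriv xi s - ∑ a ∈ Zn n, (mu a : Complex) / (s - a)) := by
    linear_combination (-1 : Complex) * g1 + g2
  rw [g3, norm_mul] at hl
  rw [norm_sub_rev]
  have hMb : M ≤ C * ((6:Real) ^ (3/2 : Real) * (n : Real) ^ (3/2 : Real)) := by
    rw [hM, ← Real.mul_rpow (by norm_num) hnn.le]
    gcongr; linarith
  have hnp : (n : Real) ^ (3/2 : Real) = (n : Real) ^ (-(1/2 : Real)) * n ^ 2 := by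
    rw [← Real.rpow_natCast, ← Real.rpow_add hnn]; norm_num
  have h64 : 64 * M / r ^ 2 ≤ 128 * C * (6:Real) ^ (3/2 : Real) * (n : Real) ^ (-(1/2 : Real)) := by
    rw [div_le_iff₀ (by positivity)]
    rw [hnp] at hMb
    have hk : 0 ≤ C * (6:Real) ^ (3/2 : Real) * (n : Real) ^ (-(1/2 : Real)) * n ^ 2 := by positivity
    have : r ^ 2 = 9 / 16 * n ^ 2 := by rw [hr]; ring
    rw [this]
    nlinarith
  have h2' : ‖(2:Complex)‖ = 2 := by simp
  rw [h2'] at hl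
  have := mul_le_mul_of_nonneg_right h64 (norm_nonneg (s - (1 - s)))
  have h5 := norm_nonneg (logDeriv xi s - ∑ a ∈ Zn n, (mu a : Complex) / (s - a))
  nlinarith
lemma deriv_tendsto_of_bdd {f : Nat → Complex → Complex} {g : Complex → Complex} {c : Complex} {R B : Real} (hR : 0 < R)
    (hf : ∀ᶠ n in atTop, DifferentiableOn Complex (f n) (Metric.closedBall c R))
    (hg : DifferentiableOn Complex g (Metric.closedBall c R))
    (hB : ∀ᶠ n in atTop, ∀ z ∈ Metric.sphere c R, ‖f n z‖ ≤ B)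
    (hl : ∀ z ∈ Metric.sphere c R, Tendsto (fun n => f n z) atTop (𝓝 (g z))) :
    Tendsto (fun n => deriv (f n) c) atTop (𝓝 (deriv g c)) := by
  have h2 : (2 * π * I : Complex) ≠ 0 := by simp [Real.pi_ne_zero]
  have key : Tendsto (fun n => ∮ z in C(c, R), (1 / (z - c) ^ 2) • f n z) atTop
      (𝓝 (∮ z in C(c, R), (1 / (z - c) ^ 2) • g z)) := by
    unfold circleIntegral
    refine intervalIntegral.tendsto_integral_filter_of_dominated_convergence (fun _ => R * (1 / R ^ 2 * B)) ?_ ?_ ?_ ?_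
    · filter_upwards [hf] with n hn
      have hc : Continuous (fun θ => f n (circleMap c R θ)) :=
        hn.continuousOn.comp_continuous (continuous_circleMap c R) (fun θ => circleMap_mem_closedBall c hR.le θ)
      have hne : ∀ θ, (circleMap c R θ - c) ^ 2 ≠ 0 := fun θ => pow_ne_zero _ (sub_ne_zero.2 (circleMap_ne_center hR.ne'))
      apply Continuous.aestronglyMeasurable
      simp only [deriv_circleMap]
      have h1 := continuous_circleMap c R
      have h2 := continuous_circleMap 0 R
      exact (h2.mul continuous_const).smul ((continuous_const.div ((h1.sub continuous_const).pow 2) hne).smul hc)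
    · filter_upwards [hB] with n hn
      refine Eventually.of_forall fun θ _ => ?_
      have h := hn _ (circleMap_mem_sphere c hR.le θ)
      have e : ‖circleMap c R θ - c‖ = R := by
        have := circleMap_mem_sphere c hR.le θ; simpa [mem_sphere_iff_norm] using this
      rw [norm_smul, norm_smul, norm_div, norm_pow, e, deriv_circleMap]
      simp only [norm_mul, norm_circleMap_zero, Complex.norm_I, norm_one, mul_one, abs_of_pos hR]
      gcongr
    · exact _root_.intervalIntegrable_const
    · refine Eventually.of_forall fun θ _ => ?_
      have h := hl _ (circleMap_mem_sphere c hR.le θ)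
      exact (h.const_smul _).const_smul _
  have key2 := key.const_smul (2 * π * I : Complex)⁻¹
  rw [hg.deriv_eq_smul_circleIntegral hR, inv_smul_smul₀ h2] at key2
  refine key2.congr' ?_
  filter_upwards [hf] with n hn
  rw [hn.deriv_eq_smul_circleIntegral hR, inv_smul_smul₀ h2]
lemma norm_GammaSeq_le {s : Complex} (hs : 0 < s.re) {n : Nat} (hn : n ≠ 0) : ‖Complex.GammaSeq s n‖ ≤ Real.Gamma s.re := by
  rw [Complex.GammaSeq_eq_approx_Gamma_integral hs hn, Real.Gamma_eq_integral hs]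
  rw [intervalIntegral.integral_of_le (by positivity)]
  refine (norm_integral_le_integral_norm _).trans ?_
  have hint : IntegrableOn (fun x => exp (-x) * x ^ (s.re - 1)) (Ioi 0) := Real.GammaIntegral_convergent hs
  refine (integral_mono_of_nonneg (Eventually.of_forall fun _ => norm_nonneg _) (hint.mono_set Ioc_subset_Ioi_self) ?_).trans
    (setIntegral_mono_set hint ?_ (Eventually.of_forall Ioc_subset_Ioi_self))
  · rw [EventuallyLE, ae_restrict_iff' measurableSet_Ioc]
    refine Eventually.of_forall fun x hx => ?_
    rw [norm_mul, Complex.norm_of_nonneg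
          (pow_nonneg (sub_nonneg.mpr <| div_le_one_of_le₀ hx.2 <| by positivity) _),
          Complex.norm_cpow_eq_rpow_re_of_pos hx.1, Complex.sub_re, Complex.one_re]
    have := hx.1
    gcongr
    exact Real.one_sub_div_pow_le_exp_neg hx.2
  · rw [EventuallyLE, ae_restrict_iff' measurableSet_Ioi]
    refine Eventually.of_forall fun x hx => ?_
    have : 0 < x := hx
    simp only [Pi.zero_apply]; positivity
lemma ne_neg_nat {z : Complex} (hz : 0 < z.re) (m : Nat) : z + m ≠ 0 := by
  intro h
  have := congrArg Complex.re h
  simp at this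
  have : (0:Real) ≤ m := Nat.cast_nonneg m
  linarith
lemma Gamma_diffAt {z : Complex} (hz : 0 < z.re) : DifferentiableAt Complex Complex.Gamma z :=
  Complex.differentiableAt_Gamma _ fun m h => ne_neg_nat hz m (by rw [h]; ring)
lemma GammaSeq_hasDeriv {z : Complex} (hz : 0 < z.re) {n : Nat} (hn : n ≠ 0) :
    DifferentiableAt Complex (fun s => Complex.GammaSeq s n) z ∧
    logDeriv (fun s => Complex.GammaSeq s n) z = log n - ∑ j ∈ Finset.range (n + 1), 1 / (z + j) := by
  unfold Complex.GammaSeq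
  have hn' : (n : Complex) ≠ 0 := by exact_mod_cast hn
  have hp : ∀ j ∈ Finset.range (n+1), z + j ≠ 0 := fun j _ => ne_neg_nat hz j
  have hpp := Finset.prod_ne_zero_iff.2 hp
  have d1 : DifferentiableAt Complex (fun s : Complex => (n : Complex) ^ s * (n.factorial : Complex)) z := by
    refine DifferentiableAt.mul_const ?_ _
    exact (differentiableAt_id).const_cpow (Or.inl hn')
  have d2 : DifferentiableAt Complex (fun s : Complex => ∏ j ∈ Finset.range (n + 1), (s + j)) z := by fun_prop
  refine ⟨d1.div d2 hpp, ?_⟩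
  rw [logDeriv_div z (by simp [hn', Nat.factorial_ne_zero]) hpp d1 d2, logDeriv_mul_const _ _ (by exact_mod_cast Nat.factorial_ne_zero n)]
  congr 1
  · rw [logDeriv_apply]
    have := (hasDerivAt_id z).const_cpow (c := (n:Complex)) (Or.inl hn')
    simp only [id] at this
    rw [this.deriv]
    have : (n:Complex) ^ z ≠ 0 := by simp [hn']
    field_simp
    rw [Complex.natCast_log]
  · have e3 := logDeriv_prod (s := Finset.range (n+1)) (f := fun (j : Nat) (z : Complex) => z + j) (x := z) hp (by intros; fun_prop)
    rw [e3]
    refine Finset.sum_congr rfl fun a _ => ?_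
    simp [logDeriv_apply]
lemma digamma_lim {z : Complex} (hz : 0 < z.re) :
    Tendsto (fun n : Nat => (log n : Complex) - ∑ j ∈ Finset.range (n + 1), 1 / (z + j)) atTop (𝓝 (Complex.digamma z)) := by
  have hR : 0 < z.re / 2 := by linarith
  have hre : ∀ w ∈ Metric.closedBall z (z.re / 2), w.re ∈ Icc (z.re / 2) (z.re * 2) := by
    intro w hw
    have h1 := Complex.abs_re_le_norm (w - z)
    simp only [Metric.mem_closedBall, dist_eq_norm] at hw
    have := abs_le.1 (h1.trans hw)
    simp at this
    constructor <;> linarith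
  obtain ⟨B, hB⟩ := (isCompact_Icc (a := z.re / 2) (b := z.re * 2)).exists_bound_of_continuousOn (f := Real.Gamma) (by
    intro x hx
    refine (Real.differentiableAt_Gamma fun m => ?_).continuousAt.continuousWithinAt
    have : (0:Real) ≤ m := Nat.cast_nonneg m
    have := hx.1
    intro h; linarith)
  have h1 : Tendsto (fun n => deriv (fun s => Complex.GammaSeq s n) z) atTop (𝓝 (deriv Complex.Gamma z)) := by
    refine deriv_tendsto_of_bdd hR ?_ ?_ (B := B) ?_ ?_
    · filter_upwards [eventually_ne_atTop 0] with n hn w hw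
      exact (GammaSeq_hasDeriv (by linarith [(hre w hw).1]) hn).1.differentiableWithinAt
    · intro w hw
      exact (Gamma_diffAt (by linarith [(hre w hw).1])).differentiableWithinAt
    · filter_upwards [eventually_ne_atTop 0] with n hn w hw
      have hw' := hre w (Metric.sphere_subset_closedBall hw)
      exact (norm_GammaSeq_le (by linarith [hw'.1]) hn).trans ((le_abs_self _).trans (hB _ hw'))
    · intro w hw
      exact Complex.GammaSeq_tendsto_Gamma w
  have h2 := h1.div (Complex.GammaSeq_tendsto_Gamma z) (Complex.Gamma_ne_zero_of_re_pos hz)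
  refine Tendsto.congr' ?_ h2
  filter_upwards [eventually_ne_atTop 0] with n hn
  exact (GammaSeq_hasDeriv hz hn).2
lemma sum_inv_approx {z : Complex} (h0 : 0 < z.re) (h1 : z.re ≤ 1) {N n : Nat} (hN : 2 ≤ N) (hn : N ≤ n) :
    ‖∑ j ∈ Finset.Ico N n, 1 / (z + j) - (log n - log N : Real)‖ ≤
      (2 + |z.im|) * (1 / ((N:Real) - 1) - 1 / ((n : Real) - 1)) := by
  induction n, hn using Nat.le_induction with
  | base => simp
  | succ n hn ih =>
    rw [Finset.sum_Ico_succ_top hn]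
    have hn2 : (2:Real) ≤ n := by exact_mod_cast hN.trans hn
    have hnC : (n : Complex) ≠ 0 := by
      have : (n:Real) ≠ 0 := by linarith
      exact_mod_cast this
    have e1 : ‖1 / (z + n) - (log (n + 1) - log n : Real)‖ ≤ (2 + |z.im|) / (n : Real) ^ 2 := by
      have a1 : ‖1 / (z + n) - ((1 / n : Real) : Complex)‖ ≤ (1 + |z.im|) / (n : Real) ^ 2 := by
        have : 1 / (z + n) - ((1 / n : Real) : Complex) = - z / ((z + n) * n) := by
          have := ne_neg_nat h0 n
          push_cast; field_simp; ring
        rw [this, norm_div, norm_neg, norm_mul]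
        have b1 : ‖z‖ ≤ 1 + |z.im| := by
          refine (Complex.norm_le_abs_re_add_abs_im z).trans ?_
          rw [abs_of_pos h0]; linarith
        have b2 : (n : Real) ≤ ‖z + n‖ := by
          refine le_trans ?_ (Complex.re_le_norm _); simp; linarith
        have b3 : ‖(n : Complex)‖ = n := by simp
        rw [b3, sq]
        gcongr
      have a2 : |1 / (n : Real) - (log (n + 1) - log n)| ≤ 1 / (n : Real) ^ 2 := by
        rw [← Real.log_div (by linarith) (by linarith)]
        have hpos : 0 < ((n : Real) + 1) / n := by positivity
        have c1 := Real.log_le_sub_one_of_pos hpos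
        have c2 := Real.one_sub_inv_le_log_of_pos hpos
        have c3 : ((n : Real) + 1) / n - 1 = 1 / n := by field_simp; ring
        have c4 : 1 - (((n : Real) + 1) / n)⁻¹ = 1 / (n + 1) := by field_simp; ring
        have c5 : 1 / (n:Real) - 1 / (n + 1) ≤ 1 / (n : Real) ^ 2 := by
          rw [div_sub_div _ _ (by positivity) (by positivity), div_le_div_iff₀ (by positivity) (by positivity)]
          ring_nf; nlinarith
        rw [abs_le]; constructor
        · rw [c3] at c1; have : 0 ≤ 1 / (n : Real) ^ 2 := by positivity
          linarith
        · rw [c4] at c2; linarith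
      have : (1 / (z + n) - (log (n + 1) - log n : Real)) = (1 / (z + n) - ((1 / n : Real) : Complex)) + ((1 / (n : Real) - (log (n + 1) - log n) : Real) : Complex) := by
        push_cast; ring
      rw [this]
      refine (norm_add_le _ _).trans ?_
      rw [Complex.norm_real, Real.norm_eq_abs]
      have : (2 + |z.im|) / (n : Real) ^ 2 = (1 + |z.im|) / (n : Real) ^ 2 + 1 / (n : Real) ^ 2 := by ring
      linarith
    have e2 : 1 / (n : Real) ^ 2 ≤ 1 / ((n : Real) - 1) - 1 / n := by
      rw [div_sub_div _ _ (by linarith) (by linarith), div_le_div_iff₀ (by positivity) (by nlinarith)]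
      nlinarith
    have e3 : (∑ j ∈ Finset.Ico N n, 1 / (z + j) + 1 / (z + n) - (log ((n + 1 : Nat) : Real) - log N : Real)) =
      (∑ j ∈ Finset.Ico N n, 1 / (z + j) - (log n - log N : Real)) + (1 / (z + n) - (log (n + 1) - log n : Real)) := by
      push_cast; ring
    rw [e3]
    refine (norm_add_le _ _).trans ((add_le_add ih e1).trans ?_)
    have e4 : (((n + 1 : Nat) : Real) - 1) = n := by push_cast; ring
    rw [e4, div_eq_mul_one_div (2 + |z.im|), ← mul_add]
    refine mul_le_mul_of_nonneg_left ?_ (by positivity)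
    linarith
lemma digamma_bd {z : Complex} (h0 : 1/4 ≤ z.re) (h1 : z.re ≤ 1) :
    ‖Complex.digamma z - log (2 + |z.im|)‖ ≤ 12 := by
  have hz : 0 < z.re := by linarith
  set y := |z.im| with hy
  have hy0 : 0 ≤ y := abs_nonneg _
  set N : Nat := ⌈y⌉₊ + 2 with hN
  have hN1 : y + 2 ≤ N := by rw [hN]; push_cast; linarith [Nat.le_ceil y]
  have hN2 : (N : Real) ≤ y + 3 := by rw [hN]; push_cast; linarith [Nat.ceil_lt_add_one hy0]
  have hlim := (digamma_lim hz).sub_const ((log (2 + y) : Real) : Complex)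
  refine le_of_tendsto hlim.norm ?_
  filter_upwards [eventually_ge_atTop N] with n hn
  have hnN : (N : Real) ≤ n := by exact_mod_cast hn
  have hsplit : ∑ j ∈ Finset.range (n + 1), 1 / (z + j) = ∑ j ∈ Finset.range N, 1 / (z + j) + ∑ j ∈ Finset.Ico N (n + 1), 1 / (z + (j:Complex)) :=
    (Finset.sum_range_add_sum_Ico _ (by omega)).symm
  have hhead : ‖∑ j ∈ Finset.range N, 1 / (z + j)‖ ≤ 8 := by
    rw [show N = (⌈y⌉₊ + 1) + 1 by omega, Finset.sum_range_succ']
    refine (norm_add_le _ _).trans ?_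
    have b0 : ‖1 / (z + ((0 : Nat) : Complex))‖ ≤ 4 := by
      rw [norm_div, norm_one, Nat.cast_zero, add_zero, div_le_iff₀ (by
        have := Complex.re_le_norm z; linarith)]
      have := Complex.re_le_norm z; linarith
    have b1 : ‖∑ k ∈ Finset.range (⌈y⌉₊ + 1), 1 / (z + ((k + 1 : Nat) : Complex))‖ ≤ 4 := by
      refine (norm_sum_le _ _).trans ?_
      have : ∀ k ∈ Finset.range (⌈y⌉₊ + 1), ‖1 / (z + ((k + 1 : Nat) : Complex))‖ ≤ 2 / (1 + y) := by
        intro k _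
        have c1 := Complex.re_le_norm (z + ((k + 1 : Nat) : Complex))
        have c2 := Complex.abs_im_le_norm (z + ((k + 1 : Nat) : Complex))
        simp only [Complex.add_re, Complex.natCast_re, Complex.add_im, Complex.natCast_im, add_zero] at c1 c2
        push_cast at c1 c2 ⊢
        have : (0:Real) ≤ k := Nat.cast_nonneg k
        rw [norm_div, norm_one, div_le_div_iff₀ (by linarith) (by linarith)]
        linarith
      refine (Finset.sum_le_sum this).trans ?_
      rw [Finset.sum_const, Finset.card_range, nsmul_eq_mul, mul_div_assoc', div_le_iff₀ (by linarith)]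
      push_cast
      nlinarith [Nat.ceil_lt_add_one hy0]
    linarith
  have htail := sum_inv_approx hz h1 (N := N) (n := n + 1) (by omega) (by omega)
  have htail2 : (2 + |z.im|) * (1 / ((N:Real) - 1) - 1 / (((n + 1 : Nat) : Real) - 1)) ≤ 2 := by
    have : (0:Real) ≤ 1 / (((n + 1 : Nat) : Real) - 1) := by push_cast; rw [add_sub_cancel_right]; positivity
    have t1 : 1 / ((N:Real) - 1) ≤ 1 / (1 + y) := one_div_le_one_div_of_le (by linarith) (by linarith)
    calc _ ≤ (2 + y) * (1 / (1 + y)) := by gcongr; linarith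
      _ ≤ 2 := by rw [mul_one_div, div_le_iff₀ (by linarith)]; linarith
  have hl1 : |log n - log ((n + 1 : Nat) : Real)| ≤ 1 := by
    have hn0 : (2:Real) ≤ n := by linarith
    push_cast
    have c2 := Real.log_le_sub_one_of_pos (show 0 < ((n:Real) + 1) / n by positivity)
    rw [Real.log_div (by linarith) (by linarith)] at c2
    have c3 : ((n : Real) + 1) / n - 1 = 1 / n := by field_simp; ring
    have c4 : 1 / (n:Real) ≤ 1 := by rw [div_le_one (by linarith)]; linarith
    have c5 := Real.log_le_log (show (0:Real) < n by linarith) (show (n:Real) ≤ n + 1 by linarith)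
    rw [abs_le]; constructor <;> linarith
  have hl2 : |log N - log (2 + y)| ≤ 1 := by
    have c2 := Real.log_le_sub_one_of_pos (show 0 < (N:Real) / (2 + y) by positivity)
    rw [Real.log_div (by linarith) (by linarith)] at c2
    have c3 : (N:Real) / (2 + y) ≤ 2 := by rw [div_le_iff₀ (by linarith)]; linarith
    have c5 := Real.log_le_log (show (0:Real) < 2 + y by linarith) (show 2 + y ≤ N by linarith)
    rw [abs_le]; constructor <;> linarith
  have e : (log n : Complex) - ∑ j ∈ Finset.range (n + 1), 1 / (z + j) - (log (2 + y) : Real) =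
      ((log n - log ((n + 1 : Nat) : Real) : Real) : Complex) + ((log N - log (2 + y) : Real) : Complex)
      - ∑ j ∈ Finset.range N, 1 / (z + j)
      - (∑ j ∈ Finset.Ico N (n + 1), 1 / (z + j) - (log ((n + 1 : Nat) : Real) - log N : Real)) := by
    rw [hsplit]; push_cast; ring
  rw [e]
  refine (norm_sub_le _ _).trans ?_
  refine (add_le_add ((norm_sub_le _ _).trans (add_le_add (norm_add_le _ _) le_rfl)) le_rfl).trans ?_
  rw [Complex.norm_real, Complex.norm_real, Real.norm_eq_abs, Real.norm_eq_abs]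
  linarith
/-- von Mangoldt -/
noncomputable abbrev vL (n : Nat) : Real := ArithmeticFunction.vonMangoldt n
lemma vL_nonneg (n : Nat) : 0 ≤ vL n := ArithmeticFunction.vonMangoldt_nonneg
lemma summable_vL {σ : Real} (hσ : 1 < σ) : Summable (fun n : Nat => vL n * (n:Real) ^ (-σ)) := by
  have h := ArithmeticFunction.LSeriesSummable_vonMangoldt (s := (σ:Complex)) (by simpa using hσ)
  refine (h.norm).congr fun n => ?_
  rcases Nat.eq_zero_or_pos n with rfl | hn
  · simp [vL]
  · rw [LSeries.norm_term_eq]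
    simp only [hn.ne', if_false, Complex.ofReal_re]
    rw [Real.rpow_neg (by positivity), ← div_eq_mul_inv]
    simp [abs_of_nonneg (vL_nonneg n)]
lemma cpow_norm {n : Nat} (hn : 0 < n) (s : Complex) : ‖(n:Complex) ^ (-s)‖ = (n:Real) ^ (-s.re) := by
  have := Complex.norm_natCast_cpow_of_pos hn (-s)
  simpa using this
lemma zeta_ld {s : Complex} (hs : 1 < s.re) : HasSum (fun n : Nat => (vL n : Complex) * (n:Complex) ^ (-s)) (-logDeriv riemannZeta s) := by
  have h := ArithmeticFunction.LSeriesSummable_vonMangoldt hs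
  have h2 := h.LSeriesHasSum
  rw [ArithmeticFunction.LSeries_vonMangoldt_eq_deriv_riemannZeta_div hs, LSeriesHasSum] at h2
  have e : -deriv riemannZeta s / riemannZeta s = -logDeriv riemannZeta s := by rw [logDeriv_apply]; ring
  rw [e] at h2
  refine h2.congr_fun fun n => ?_
  rcases Nat.eq_zero_or_pos n with rfl | hn
  · simp [vL]
  · rw [LSeries.term_of_ne_zero hn.ne', Complex.cpow_neg]
    simp [vL, div_eq_mul_inv]
lemma xi_ne {s : Complex} (hs : 1 ≤ s.re) : xi s ≠ 0 := by
  rw [Ne, xi_zero_iff]; rintro ⟨-, -, h⟩; linarith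
lemma Gammaℝ_ld {s : Complex} (hs : 0 < s.re) : DifferentiableAt Complex Complex.Gammaℝ s ∧ logDeriv Complex.Gammaℝ s = -(log π / 2 : Real) + Complex.digamma (s / 2) / 2 := by
  have hs2 : 0 < (s/2).re := by simpa using hs
  have hpi : (π : Complex) ≠ 0 := by simp [Real.pi_ne_zero]
  have e : Complex.Gammaℝ = fun s => (π : Complex) ^ (-s / 2) * Complex.Gamma (s / 2) := by
    ext s; rw [Complex.Gammaℝ_def]
  have h1 : HasDerivAt (fun s : Complex => (π : Complex) ^ (-s / 2)) ((π : Complex) ^ (-s / 2) * Complex.log π * (-1 / 2)) s := by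
    have := ((hasDerivAt_id s).neg.div_const 2).const_cpow (c := (π : Complex)) (Or.inl hpi)
    simpa using this
  have h2 : HasDerivAt (fun s : Complex => Complex.Gamma (s / 2)) (deriv Complex.Gamma (s / 2) * (1 / 2)) s := by
    have := (Gamma_diffAt hs2).hasDerivAt.comp s ((hasDerivAt_id s).div_const 2)
    simpa [Function.comp_def] using this
  have hG := Complex.Gamma_ne_zero_of_re_pos hs2
  have hc : (π : Complex) ^ (-s / 2) ≠ 0 := by simp [hpi]
  rw [e]
  refine ⟨(h1.mul h2).differentiableAt, ?_⟩
  rw [logDeriv_mul s hc hG h1.differentiableAt h2.differentiableAt,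
    logDeriv_apply, logDeriv_apply, h1.deriv, h2.deriv, Complex.digamma_def, logDeriv_apply, ← Complex.ofReal_log Real.pi_pos.le]
  push_cast
  field_simp
lemma xi_ld {s : Complex} (hs : 1 < s.re) : logDeriv xi s = 1 / s + 1 / (s - 1) +
    (-(log π / 2 : Real) + Complex.digamma (s / 2) / 2) + logDeriv riemannZeta s := by
  have h0 : s ≠ 0 := by rintro rfl; norm_num at hs
  have h1 : s - 1 ≠ 0 := by intro h; rw [sub_eq_zero.1 h] at hs; norm_num at hs
  have hG := Complex.Gammaℝ_ne_zero_of_re_pos (show 0 < s.re by linarith)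
  have hζ := riemannZeta_ne_zero_of_one_le_re hs.le
  have dζ := differentiableAt_riemannZeta (sub_ne_zero.1 h1)
  obtain ⟨dG, lG⟩ := Gammaℝ_ld (show 0 < s.re by linarith)
  have hev : xi =ᶠ[𝓝 s] fun s => s * (s - 1) * s.Gammaℝ * riemannZeta s := by
    filter_upwards [(isOpen_lt continuous_const Complex.continuous_re).mem_nhds hs] with z hz
    have hz : 1 < z.re := hz
    exact xi_eq_zeta (by linarith) (by rintro rfl; norm_num at hz)
  rw [(logDeriv_congr_nhds hev).eq_of_nhds]
  rw [logDeriv_mul (f := fun s => s * (s - 1) * s.Gammaℝ) s (by simp [h0, h1, hG]) hζ (by fun_prop) dζ,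
    logDeriv_mul (f := fun s : Complex => s * (s - 1)) s (by simp [h0, h1]) hG (by fun_prop) dG, lG,
    logDeriv_mul (f := fun s : Complex => s) s h0 h1 (by fun_prop) (by fun_prop)]
  congr 3
  · simp
  · simp [logDeriv_apply]
lemma log2_pos (y : Real) : 1/2 ≤ log (2 + |y|) := by
  have h1 := Real.log_two_gt_d9
  have := Real.log_le_log (by norm_num) (show (2:Real) ≤ 2 + |y| by linarith [abs_nonneg y])
  linarith
lemma ld_zeta_bd : ∃ C > 0, ∀ s : Complex, s.re = 2 → ‖logDeriv riemannZeta s‖ ≤ C := by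
  have hs := summable_vL (σ := 2) (by norm_num)
  refine ⟨(∑' n : Nat, vL n * (n:Real) ^ (-(2:Real))) + 1, ?_, fun s h => ?_⟩
  · have : 0 ≤ ∑' n : Nat, vL n * (n:Real) ^ (-(2:Real)) := tsum_nonneg fun n => mul_nonneg (vL_nonneg n) (by positivity)
    linarith
  · have h2 := zeta_ld (s := s) (by rw [h]; norm_num)
    rw [← norm_neg, ← h2.tsum_eq]
    refine (tsum_of_norm_bounded hs.hasSum fun n => ?_).trans (by linarith)
    rcases Nat.eq_zero_or_pos n with rfl | hn
    · simp [vL]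
    · rw [norm_mul, cpow_norm hn, h, Complex.norm_real, Real.norm_of_nonneg (vL_nonneg n)]
lemma xi_ld_bd : ∃ C > 0, ∀ y : Real, ‖logDeriv xi (2 + y * I)‖ ≤ C * log (2 + |y|) := by
  obtain ⟨C, hC, h⟩ := ld_zeta_bd
  refine ⟨2 * (C + log π + 10) + 1, by have := Real.log_nonneg (show 1 ≤ π by linarith [Real.pi_gt_three]); linarith, fun y => ?_⟩
  set s : Complex := 2 + y * I with hs
  have hre : s.re = 2 := by simp [hs]
  have him : s.im = y := by simp [hs]
  rw [xi_ld (by rw [hre]; norm_num)]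
  have h1 : ‖1 / s‖ ≤ 1 := by
    rw [norm_div, norm_one, div_le_one (by linarith [Complex.re_le_norm s])]; linarith [Complex.re_le_norm s]
  have h2 : ‖1 / (s - 1)‖ ≤ 1 := by
    have := Complex.re_le_norm (s - 1)
    simp [hre] at this
    rw [norm_div, norm_one, div_le_one (by linarith)]; linarith
  have hlp := Real.log_nonneg (show 1 ≤ π by linarith [Real.pi_gt_three])
  have h3 : ‖(-(log π / 2 : Real) : Complex)‖ ≤ log π / 2 := by
    rw [norm_neg, Complex.norm_real, Real.norm_of_nonneg (by linarith)]
  have h4 : ‖Complex.digamma (s / 2) / 2‖ ≤ 6 + log (2 + |y|) / 2 := by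
    have d := digamma_bd (z := s / 2) (by simp [hre]; norm_num) (by simp [hre])
    have him2 : |(s/2).im| ≤ |y| := by
      simp [him, abs_div]
    have d2 := norm_add_le (Complex.digamma (s/2) - log (2 + |(s/2).im|)) (log (2 + |(s/2).im|) : Real)
    rw [sub_add_cancel, Complex.norm_real, Real.norm_of_nonneg (by linarith [log2_pos (s/2).im])] at d2
    have := Real.log_le_log (by positivity) (show 2 + |(s/2).im| ≤ 2 + |y| by linarith)
    rw [norm_div]
    have : ‖(2:Complex)‖ = 2 := by simp
    rw [this]; linarith
  have h5 := h s hre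
  have hl := log2_pos y
  refine (norm_add_le _ _).trans ((add_le_add ((norm_add_le _ _).trans (add_le_add (norm_add_le _ _) (norm_add_le _ _))) le_rfl).trans ?_)
  nlinarith
lemma norm_sq_ge {s ρ : Complex} (hs : s.re = 2) (hρ : xi ρ = 0) : 1 + (s.im - ρ.im) ^ 2 ≤ ‖s - ρ‖ ^ 2 := by
  obtain ⟨-, h0, h1⟩ := (xi_zero_iff ρ).1 hρ
  rw [← Complex.normSq_eq_norm_sq, Complex.normSq_apply]
  simp only [Complex.sub_re, Complex.sub_im, hs]
  nlinarith
/-- zero counting -/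
lemma cnt : ∃ C > 0, ∀ (t : Real) (Z : Finset Complex), (∀ ρ ∈ Z, xi ρ = 0) →
    ∑ ρ ∈ Z, (mu ρ : Real) / (1 + (t - ρ.im) ^ 2) ≤ C * log (2 + |t|) := by
  obtain ⟨C, hC, hb⟩ := xi_ld_bd
  refine ⟨4 * C, by positivity, fun t Z hZ => ?_⟩
  set s : Complex := 2 + t * I with hs
  have hre : s.re = 2 := by simp [hs]
  have him : s.im = t := by simp [hs]
  have hlim := hadamard (s := s) (xi_ne (by rw [hre]; norm_num))
  have hlim2 := (Complex.continuous_re.tendsto _).comp hlim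
  have hterm : ∀ ρ : Complex, xi ρ = 0 → (mu ρ : Real) / (1 + (t - ρ.im) ^ 2) ≤ 4 * ((mu ρ : Complex) / (s - ρ)).re := by
    intro ρ hρ
    obtain ⟨-, h0, h1⟩ := (xi_zero_iff ρ).1 hρ
    have e : ((mu ρ : Complex) / (s - ρ)).re = mu ρ * ((2 - ρ.re) / ((2 - ρ.re) ^ 2 + (t - ρ.im) ^ 2)) := by
      have : (mu ρ : Complex) = ((mu ρ : Real) : Complex) := by simp
      rw [div_eq_mul_inv, this, Complex.re_ofReal_mul, Complex.inv_re, Complex.normSq_apply]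
      simp only [Complex.sub_re, Complex.sub_im, hre, him, sq]
    rw [e, div_eq_mul_one_div, ← mul_assoc, mul_comm 4, mul_assoc]
    refine mul_le_mul_of_nonneg_left ?_ (Nat.cast_nonneg _)
    rw [mul_div_assoc', div_le_div_iff₀ (by positivity) (by nlinarith)]
    nlinarith [sq_nonneg (t - ρ.im)]
  have hpos : ∀ ρ : Complex, xi ρ = 0 → 0 ≤ 4 * ((mu ρ : Complex) / (s - ρ)).re := fun ρ h =>
    le_trans (by positivity) (hterm ρ h)
  have h1 : ∑ ρ ∈ Z, (mu ρ : Real) / (1 + (t - ρ.im) ^ 2) ≤ 4 * (logDeriv xi s).re := by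
    refine ge_of_tendsto (hlim2.const_mul 4) ?_
    obtain ⟨M, hM⟩ : ∃ M : Real, ∀ ρ ∈ Z, ‖ρ - 1/2‖ ≤ M :=
      ⟨∑ ρ ∈ Z, ‖ρ - 1/2‖, fun ρ h => Finset.single_le_sum (f := fun ρ : Complex => ‖ρ - 1/2‖) (fun _ _ => norm_nonneg _) h⟩
    filter_upwards [tendsto_natCast_atTop_atTop (R := Real) |>.eventually (eventually_gt_atTop M)] with n hn
    have hsub : Z ⊆ Zn n := fun ρ h => mem_Zn.2 ⟨hZ ρ h, (hM ρ h).trans_lt hn⟩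
    simp only [Function.comp_apply, Complex.re_sum, Finset.mul_sum]
    refine (Finset.sum_le_sum fun ρ h => hterm ρ (hZ ρ h)).trans ?_
    exact Finset.sum_le_sum_of_subset_of_nonneg hsub fun ρ h _ => hpos ρ (mem_Zn.1 h).1
  have h2 := (Complex.re_le_norm (logDeriv xi s)).trans (hb t)
  linarith
/-- uniform bound for the partial sums -/
lemma partial_bd : ∃ C > 0, ∀ (y : Real) (n : Nat), ‖∑ a ∈ Zn n, (mu a : Complex) / (2 + y * I - a)‖ ≤
    C * (1 + |y|) * log (2 + |y|) := by
  obtain ⟨C, hC, hb⟩ := cnt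
  refine ⟨3 * C, by positivity, fun y n => ?_⟩
  set s : Complex := 2 + y * I with hs
  have hre : s.re = 2 := by simp [hs]
  have him : s.im = y := by simp [hs]
  have hlog := log2_pos y
  have hsum : ∑ a ∈ Zn n, (mu a : Complex) / (s - a) = ∑ a ∈ Zn n, (2 * s - 1) / 2 * ((mu a : Complex) * (1 / (s - a) * (1 / (s - (1 - a))))) := by
    have e1 := sum_Zn_one_sub (R := n) (fun a => (mu a : Complex) / (s - a))
    have e2 : ∑ a ∈ Zn n, (mu a : Complex) / (s - a) = (∑ a ∈ Zn n, (mu a : Complex) / (s - a) + ∑ a ∈ Zn n, (mu (1 - a) : Complex) / (s - (1 - a))) / 2 := by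
      rw [e1]; ring
    rw [e2, ← Finset.sum_add_distrib, Finset.sum_div]
    refine Finset.sum_congr rfl fun a ha => ?_
    have n1 : s - a ≠ 0 := sub_ne_zero.2 (by rintro h; exact xi_ne (s := s) (by rw [hre]; norm_num) (h ▸ (mem_Zn.1 ha).1))
    have n2 : s - (1 - a) ≠ 0 := sub_ne_zero.2 (by rintro h; exact xi_ne (s := s) (by rw [hre]; norm_num) (h ▸ (mem_Zn.1 (Zn_one_sub ha)).1))
    rw [mu_one_sub]
    field_simp; ring
  rw [hsum, ← Finset.mul_sum, norm_mul]
  have h1 : ‖(2 * s - 1) / 2‖ ≤ 3 * (1 + |y|) := by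
    have : (2 * s - 1) / 2 = (3/2 : Complex) + y * I := by rw [hs]; ring
    rw [this]
    refine (norm_add_le _ _).trans ?_
    simp; linarith [abs_nonneg y]
  have h2 : ‖∑ a ∈ Zn n, (mu a : Complex) * (1 / (s - a) * (1 / (s - (1 - a))))‖ ≤ C * log (2 + |y|) := by
    have hb1 := hb y (Zn n) (fun ρ h => (mem_Zn.1 h).1)
    have hb2 : ∑ a ∈ Zn n, (mu a : Real) / (1 + (y - (1 - a).im) ^ 2) = ∑ a ∈ Zn n, (mu a : Real) / (1 + (y - a.im) ^ 2) := by
      refine Finset.sum_nbij' (fun s => 1 - s) (fun s => 1 - s) (fun s h => Zn_one_sub h) (fun s h => Zn_one_sub h) ?_ ?_ ?_ <;> simp [mu_one_sub]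
    refine (norm_sum_le _ _).trans ?_
    have : ∑ a ∈ Zn n, ‖(mu a : Complex) * (1 / (s - a) * (1 / (s - (1 - a))))‖ ≤ ∑ a ∈ Zn n, ((mu a : Real) / (1 + (y - a.im) ^ 2) / 2 + (mu a : Real) / (1 + (y - (1 - a).im) ^ 2) / 2) := by
      refine Finset.sum_le_sum fun a ha => ?_
      have hk : ∀ b : Complex, xi b = 0 → ‖1 / (s - b)‖ ^ 2 ≤ 1 / (1 + (y - b.im) ^ 2) := by
        intro b hb
        rw [norm_div, norm_one, div_pow, one_pow]
        have := norm_sq_ge hre hb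
        rw [him] at this
        exact one_div_le_one_div_of_le (by positivity) this
      have k1 := hk a (mem_Zn.1 ha).1
      have k2 := hk (1 - a) (mem_Zn.1 (Zn_one_sub ha)).1
      rw [norm_mul, norm_mul, Complex.norm_natCast]
      have k3 : ‖1 / (s - a)‖ * ‖1 / (s - (1 - a))‖ ≤ 1 / (1 + (y - a.im) ^ 2) / 2 + 1 / (1 + (y - (1 - a).im) ^ 2) / 2 := by
        nlinarith [sq_nonneg (‖1 / (s - a)‖ - ‖1 / (s - (1 - a))‖)]
      calc _ ≤ (mu a : Real) * (1 / (1 + (y - a.im) ^ 2) / 2 + 1 / (1 + (y - (1 - a).im) ^ 2) / 2) := by gcongr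
        _ = _ := by ring
    refine this.trans ?_
    rw [Finset.sum_add_distrib, ← Finset.sum_div, ← Finset.sum_div, hb2]
    linarith
  calc _ ≤ 3 * (1 + |y|) * (C * log (2 + |y|)) := by gcongr
    _ = _ := by ring
noncomputable def Gz (u : Real) (z : Complex) : Complex := Complex.exp (u * z + z ^ 2 / 2)
lemma Gz_norm (u c y : Real) : ‖Gz u (c + y * I)‖ = exp (u * c + c^2/2) * exp (-(1/2) * y^2) := by
  rw [Gz, Complex.norm_exp, ← Real.exp_add]
  congr 1
  simp [pow_two]
  ring
lemma gauss_int : Integrable (fun y : Real => exp (-(1/2) * y^2)) := integrable_exp_neg_mul_sq (by norm_num)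
lemma gauss_int1 : Integrable (fun y : Real => |y| * exp (-(1/2) * y^2)) := by
  have := (integrable_mul_exp_neg_mul_sq (b := 1/2) (by norm_num)).norm
  refine this.congr (Eventually.of_forall fun y => ?_)
  simp [Real.norm_eq_abs]
lemma Gz_cont (u : Real) : Continuous (Gz u) := by unfold Gz; fun_prop
lemma Gz_int (u c : Real) : Integrable (fun y : Real => Gz u (c + y * I)) := by
  refine (gauss_int.const_mul (exp (u * c + c^2/2))).mono' ?_ (Eventually.of_forall fun y => (Gz_norm u c y).le)
  exact ((Gz_cont u).comp (by fun_prop)).aestronglyMeasurable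
lemma sqrt2pi : ((π : Complex) / (1/2)) ^ (1/2 : Complex) = (sqrt (2 * π) : Real) := by
  rw [Real.sqrt_eq_rpow, Complex.ofReal_cpow (by positivity)]
  push_cast
  congr 1; ring
/-- full Gaussian integral with complex frequency -/
lemma gint (c : Real) (w : Complex) : ∫ y : Real, Complex.exp (w * (c + y * I) + (c + y * I)^2/2)
    = (sqrt (2 * π) : Real) * Complex.exp (-w^2/2) := by
  have h := integral_cexp_quadratic (b := -(1/2 : Complex)) (by norm_num) ((c + w) * I) (c^2/2 + w * c)
  rw [neg_neg, sqrt2pi] at h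
  rw [show Complex.exp (-w^2/2) = Complex.exp (c^2/2 + w * c - ((c + w) * I)^2/(4 * -(1/2))) by
    congr 1; rw [mul_pow, Complex.I_sq]; ring]
  rw [← h]
  congr 1; ext y; congr 1
  rw [add_sq (c:Complex), mul_pow, Complex.I_sq]; ring
lemma gint_real (u : Real) (z : Complex) : ∫ x : Real, Complex.exp (x * z - (u - x)^2/2)
    = (sqrt (2 * π) : Real) * Gz u z := by
  have h := integral_cexp_quadratic (b := -(1/2 : Complex)) (by norm_num) (z + u) (-u^2/2)
  rw [neg_neg, sqrt2pi] at h
  rw [Gz, show (u * z + z^2/2 : Complex) = -u^2/2 - (z + u)^2/(4 * -(1/2)) by ring, ← h]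
  congr 1; ext y; congr 1; ring
lemma gint_real_int (u : Real) (z : Complex) : Integrable (fun x : Real => Complex.exp (x * z - (u - x)^2/2)) := by
  have h := integrable_cexp_quadratic' (b := -(1/2 : Complex)) (by norm_num) (z + u) (-u^2/2)
  refine h.congr (Eventually.of_forall fun x => ?_)
  simp only
  congr 1; ring
lemma half (c u : Real) (z₀ : Complex) (h : z₀.re < c) :
    ∫ y : Real, Gz u (c + y * I) / (c + y * I - z₀)
      = (sqrt (2 * π) : Real) * ∫ x in Ioi (0:Real), Complex.exp (x * z₀ - (u - x)^2/2) := by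
  have h1 : ∀ y : Real, Gz u (c + y * I) / (c + y * I - z₀)
      = ∫ x in Ioi (0:Real), Gz u (c + y * I) * Complex.exp (-(c + y * I - z₀) * x) := by
    intro y
    rw [integral_const_mul, integral_exp_mul_complex_Ioi (by simp; exact h)]
    rw [Complex.ofReal_zero, mul_zero, Complex.exp_zero, neg_div_neg_eq, mul_one_div]
  simp_rw [h1]
  rw [integral_integral_swap, ← integral_const_mul]
  · refine setIntegral_congr_fun measurableSet_Ioi fun x _ => ?_
    have h2 := gint c (u - x)
    rw [show Complex.exp (x * z₀ - (u - x)^2/2) = Complex.exp (-((u:Complex) - x)^2/2) * Complex.exp (x * z₀) by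
      rw [← Complex.exp_add]; congr 1; ring, ← mul_assoc, ← h2, ← integral_mul_const]
    congr 1; ext y
    rw [Gz, ← Complex.exp_add, ← Complex.exp_add]
    congr 1; ring
  · have i1 : Integrable (fun x : Real => exp (-(c - z₀.re) * x)) (volume.restrict (Ioi 0)) :=
      exp_neg_integrableOn_Ioi 0 (by linarith)
    refine ((Gz_int u c).norm.mul_prod i1).mono' ?_ (Eventually.of_forall fun p => ?_)
    · refine Continuous.aestronglyMeasurable ?_
      exact ((Gz_cont u).comp (by fun_prop)).mul (by fun_prop)
    · simp only [Function.uncurry, norm_mul]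
      rw [Complex.norm_exp (-_ * _)]
      simp
lemma half_sum (c u : Real) (z₀ : Complex) (h : |z₀.re| < c) :
    (∫ y : Real, Gz u (c + y * I) / (c + y * I - z₀))
     + (∫ y : Real, Gz (-u) (c + y * I) / (c + y * I + z₀)) = 2 * π * Gz u z₀ := by
  have a := half c u z₀ (lt_of_abs_lt h)
  have b := half c (-u) (-z₀) (by have := neg_lt_of_abs_lt h; simp; linarith)
  simp only [sub_neg_eq_add] at b
  rw [a, b, ← mul_add]
  have e : ∫ x in Ioi (0:Real), Complex.exp (x * -z₀ - (((-u : Real):Complex) - x)^2/2) =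
      ∫ x in Iic (0:Real), Complex.exp (x * z₀ - (u - x)^2/2) := by
    have := integral_comp_neg_Ioi (0:Real) (fun x : Real => Complex.exp (x * z₀ - (u - x)^2/2))
    rw [neg_zero] at this
    rw [← this]
    congr 1; ext x; congr 1; push_cast; ring
  rw [e, add_comm, intervalIntegral.integral_Iic_add_Ioi (gint_real_int u z₀).integrableOn (gint_real_int u z₀).integrableOn,
    gint_real, ← mul_assoc, ← Complex.ofReal_mul, Real.mul_self_sqrt (by positivity)]
  push_cast; ring
noncomputable def Ph (t u : Real) (s : Complex) : Complex := Gz u (s - 1/2 - t * I)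
lemma Ph_line (t u c y : Real) : Ph t u (1/2 + c + y * I) = Gz u (c + ((y - t : Real):Complex) * I) := by
  rw [Ph]; congr 1; push_cast; ring
lemma Ph_line' (t u c y : Real) : Ph t u (1 - (1/2 + c + y * I)) = Gz (-u) (c + ((y + t : Real):Complex) * I) := by
  rw [Ph, Gz, Gz]; congr 1; push_cast; ring
lemma Ph_int (t u c : Real) : Integrable (fun y : Real => Ph t u (1/2 + c + y * I)) := by
  simp_rw [Ph_line]; exact (Gz_int u c).comp_sub_right t
lemma Ph_int' (t u c : Real) : Integrable (fun y : Real => Ph t u (1 - (1/2 + c + y * I))) := by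
  simp_rw [Ph_line']; exact (Gz_int (-u) c).comp_add_right t
lemma perzero (t u : Real) (ρ : Complex) (h0 : -1 < ρ.re) (h1 : ρ.re < 2) :
    (∫ y : Real, Ph t u (2 + y * I) / (2 + y * I - ρ))
     + (∫ y : Real, Ph t u (1 - (2 + y * I)) / (2 + y * I - (1 - ρ))) = 2 * π * Ph t u ρ := by
  have h := half_sum (3/2) u (ρ - 1/2 - t * I) (by
    rw [abs_lt]; simp; constructor <;> linarith)
  rw [← integral_sub_right_eq_self (μ := volume) (fun y : Real => Gz u _ / _) t,
    ← integral_add_right_eq_self (μ := volume) (fun y : Real => Gz (-u) _ / _) t] at h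
  rw [Ph, ← h]
  have e : (2:Complex) = 1/2 + (3/2 : Real) := by norm_num
  congr 2
  · ext y
    have := Ph_line t u (3/2) y
    rw [← e] at this
    rw [this]
    congr 1; push_cast; ring
  · ext y
    have := Ph_line' t u (3/2) y
    rw [← e] at this
    rw [this]
    congr 1; push_cast; ring
lemma gauss_int2 : Integrable (fun y : Real => (1 + |y|)^2 * exp (-(1/2) * y^2)) := by
  have h2 := integrable_rpow_mul_exp_neg_mul_sq (b := 1/2) (by norm_num) (s := 2) (by norm_num)
  refine ((gauss_int.add h2).const_mul 2).mono' (by fun_prop) (Eventually.of_forall fun y => ?_)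
  rw [Real.norm_of_nonneg (by positivity)]
  simp only [Pi.add_apply, Real.rpow_two]
  have : (1 + |y|)^2 ≤ 2 * (1 + y^2) := by nlinarith [sq_nonneg (1 - |y|), sq_abs y]
  calc _ ≤ 2 * (1 + y^2) * exp (-(1/2) * y^2) := by gcongr
    _ = _ := by ring
lemma polyg (t : Real) : Integrable (fun y : Real => (2 + |y|)^2 * exp (-(1/2) * (y - t)^2)) := by
  refine ((gauss_int2.comp_sub_right t).const_mul ((2 + |t|)^2)).mono' (by fun_prop) (Eventually.of_forall fun y => ?_)
  rw [Real.norm_of_nonneg (by positivity), ← mul_assoc, ← mul_pow]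
  have : 2 + |y| ≤ (2 + |t|) * (1 + |y - t|) := by
    have := abs_add_le (y - t) t
    rw [sub_add_cancel] at this
    nlinarith [abs_nonneg (y - t), abs_nonneg t, mul_nonneg (abs_nonneg (y - t)) (abs_nonneg t)]
  gcongr
lemma Ph_cont (t u : Real) : Continuous (Ph t u) := (Gz_cont u).comp (by fun_prop)
noncomputable def Psi (t u : Real) (s : Complex) : Complex := Ph t u s + Ph t u (1 - s)
lemma Psi_cont (t u : Real) : Continuous (Psi t u) := (Ph_cont t u).add ((Ph_cont t u).comp (by fun_prop))
lemma two_eq : (2:Complex) = 1/2 + (3/2 : Real) := by norm_num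
lemma Psi_norm (t u : Real) : ∀ c : Real, |c| ≤ 3/2 → ∀ y : Real, ‖Psi t u (1/2 + c + y * I)‖ ≤ exp (|u| * (3/2) + 9/8) *
    (exp (-(1/2) * (y - t)^2) + exp (-(1/2) * (y - -t)^2)) := by
  intro c hc y
  rw [Psi, Ph_line, Ph_line', mul_add]
  have hcc : c^2 ≤ 9/4 := by nlinarith [abs_le.1 hc]
  have h1 : |u * c| ≤ |u| * (3/2) := by rw [abs_mul]; gcongr
  refine (norm_add_le _ _).trans ?_
  rw [Gz_norm, Gz_norm, sub_neg_eq_add]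
  have := abs_le.1 h1
  refine add_le_add (mul_le_mul_of_nonneg_right (Real.exp_le_exp.2 ?_) (Real.exp_nonneg _))
    (mul_le_mul_of_nonneg_right (Real.exp_le_exp.2 ?_) (Real.exp_nonneg _)) <;> linarith
lemma polyPsi {t u : Real} {c : Real} (hc : |c| ≤ 3/2) : Integrable (fun y : Real => (2 + |y|)^2 * ‖Psi t u (1/2 + c + y * I)‖) := by
  refine (((polyg t).add (polyg (-t))).const_mul (exp (|u| * (3/2) + 9/8))).mono' ?_ (Eventually.of_forall fun y => ?_)
  · exact (Continuous.mul (by fun_prop) ((Psi_cont t u).comp (by fun_prop)).norm).aestronglyMeasurable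
  · rw [Real.norm_of_nonneg (by positivity)]
    have := Psi_norm t u c hc y
    simp only [Pi.add_apply]
    calc _ ≤ (2 + |y|)^2 * (exp (|u| * (3/2) + 9/8) *
          (exp (-(1/2) * (y - t)^2) + exp (-(1/2) * (y - -t)^2))) := by gcongr
      _ = _ := by ring
lemma log_le_lin (y : Real) : log (2 + |y|) ≤ 2 + |y| := by
  have := Real.log_le_sub_one_of_pos (show 0 < 2 + |y| by positivity); linarith
lemma int_div {F : Real → Complex} (hF : Integrable F) {a : Complex} (ha : xi a = 0 ∨ a.re ≤ 1) :
    Integrable (fun y : Real => F y / (2 + y * I - a)) := by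
  have har : a.re ≤ 1 := ha.elim (fun h => ((xi_zero_iff _).1 h).2.2.le) id
  refine hF.norm.mono' ?_ (Eventually.of_forall fun y => ?_)
  · simp_rw [div_eq_mul_inv]
    exact hF.aestronglyMeasurable.mul (by fun_prop : Measurable fun y : Real => (2 + y * I - a)⁻¹).aestronglyMeasurable
  · rw [norm_div]
    refine div_le_self (norm_nonneg _) ?_
    have := Complex.abs_re_le_norm (2 + y * I - a)
    have h2 := le_abs_self (2 + y * I - a).re
    simp at h2 this; linarith
lemma EFlim (t u : Real) : Tendsto (fun n : Nat => ∑ a ∈ Zn n, (mu a : Complex) * Ph t u a) atTop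
    (𝓝 (1 / (2 * π) * ∫ y : Real, Psi t u (2 + y * I) * logDeriv xi (2 + y * I))) := by
  obtain ⟨C, hC, hb⟩ := partial_bd
  have i1 := Ph_int t u (3/2)
  have i2 := Ph_int' t u (3/2)
  rw [← two_eq] at i1 i2
  have key : ∀ n : Nat, ∑ a ∈ Zn n, (mu a : Complex) * Ph t u a = 1 / (2 * π) *
      ∫ y : Real, Psi t u (2 + y * I) * ∑ a ∈ Zn n, (mu a : Complex) / (2 + y * I - a) := by
    intro n
    have h1 : ∀ a ∈ Zn n, (mu a : Complex) * Ph t u a = 1 / (2 * π) *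
      ((mu a : Complex) * (∫ y : Real, Ph t u (2 + y * I) / (2 + y * I - a)) +
      (mu a : Complex) * (∫ y : Real, Ph t u (1 - (2 + y * I)) / (2 + y * I - (1 - a)))) := by
      intro a ha
      have hz := (xi_zero_iff _).1 (mem_Zn.1 ha).1
      rw [← mul_add, perzero t u a (by linarith [hz.2.1]) (by linarith [hz.2.2])]
      have : (π : Complex) ≠ 0 := by exact_mod_cast Real.pi_ne_zero
      field_simp
    rw [Finset.sum_congr rfl h1, ← Finset.mul_sum, Finset.sum_add_distrib]
    have h2 := sum_Zn_one_sub (R := n) (fun a => (mu a : Complex) * (∫ y : Real, Ph t u (1 - (2 + y * I)) / (2 + y * I - a)))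
    simp only [mu_one_sub] at h2
    rw [h2]
    congr 1
    simp_rw [← integral_const_mul]
    rw [← integral_finsetSum, ← integral_finsetSum, ← integral_add]
    · congr 1; ext y
      rw [Psi, Finset.mul_sum, ← Finset.sum_add_distrib]
      refine Finset.sum_congr rfl fun a _ => ?_
      ring
    · exact integrable_finsetSum _ fun a ha => (int_div i1 (Or.inl (mem_Zn.1 ha).1)).const_mul _
    · exact integrable_finsetSum _ fun a ha => (int_div i2 (Or.inl (mem_Zn.1 ha).1)).const_mul _
    · exact fun a ha => (int_div i2 (Or.inl (mem_Zn.1 ha).1)).const_mul _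
    · exact fun a ha => (int_div i1 (Or.inl (mem_Zn.1 ha).1)).const_mul _
  simp_rw [key]
  refine Tendsto.const_mul _ ?_
  have hp := (polyPsi (t := t) (u := u) (c := 3/2) (by norm_num)).const_mul C
  rw [← two_eq] at hp
  refine tendsto_integral_of_dominated_convergence _ (fun n => ?_) hp (fun n => Eventually.of_forall fun y => ?_)
    (Eventually.of_forall fun y => ?_)
  · exact ((Psi_cont t u).comp (by fun_prop)).aestronglyMeasurable.mul (Finset.measurable_sum _ fun a _ => by fun_prop).aestronglyMeasurable
  · rw [norm_mul]
    have h3 := hb y n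
    have h4 := log_le_lin y
    calc _ ≤ ‖Psi t u (2 + y * I)‖ * (C * (1 + |y|) * log (2 + |y|)) := by gcongr
      _ ≤ ‖Psi t u (2 + y * I)‖ * (C * (2 + |y|) * (2 + |y|)) := by
        have := log2_pos y
        gcongr
        · linarith
      _ = _ := by ring
  · exact (hadamard (xi_ne (by simp))).const_mul _
lemma Psi_decay (t u : Real) : ∃ M > 0, ∀ c : Real, |c| ≤ 3/2 → ∀ y : Real,
    (2 + |y|)^2 * ‖Psi t u (1/2 + c + y * I)‖ ≤ M := by
  have h : ∀ t y : Real, (2 + |y|)^2 * exp (-(1/2) * (y - t)^2) ≤ (2 + |t|)^2 * exp 2 := by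
    intro t y
    have h1 : 2 + |y| ≤ (2 + |t|) * exp |y - t| := by
      have := abs_add_le (y - t) t
      rw [sub_add_cancel] at this
      have h2 := Real.add_one_le_exp |y - t|
      nlinarith [abs_nonneg (y - t), abs_nonneg t, mul_nonneg (abs_nonneg (y - t)) (abs_nonneg t)]
    calc _ ≤ ((2 + |t|) * exp |y - t|)^2 * exp (-(1/2) * (y - t)^2) := by gcongr
      _ = (2 + |t|)^2 * exp (2 * |y - t| - (1/2) * |y - t|^2) := by
        rw [mul_pow, ← Real.exp_nat_mul, mul_assoc, ← Real.exp_add, sq_abs]; congr 2; push_cast; ring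
      _ ≤ _ := by gcongr; nlinarith [sq_nonneg (|y - t| - 2)]
  refine ⟨exp (|u| * (3/2) + 9/8) * ((2 + |t|)^2 * exp 2 + (2 + |-t|)^2 * exp 2), by positivity, fun c hc y => ?_⟩
  calc _ ≤ (2 + |y|)^2 * (exp (|u| * (3/2) + 9/8) *
      (exp (-(1/2) * (y - t)^2) + exp (-(1/2) * (y - -t)^2))) := by
        gcongr; exact Psi_norm t u c hc y
    _ = exp (|u| * (3/2) + 9/8) * ((2 + |y|)^2 * exp (-(1/2) * (y - t)^2) +
      (2 + |y|)^2 * exp (-(1/2) * (y - -t)^2)) := by ring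
    _ ≤ _ := mul_le_mul_of_nonneg_left (add_le_add (h _ _) (h _ _)) (Real.exp_nonneg _)
lemma shift {F : Complex → Complex} {a b M : Real} (hF : ∀ z : Complex, a ≤ z.re → z.re ≤ b → DifferentiableAt Complex F z) (hab : a ≤ b)
    (hM : ∀ x y : Real, a ≤ x → x ≤ b → (2 + |y|) * ‖F (x + y * I)‖ ≤ M)
    (ia : Integrable fun y : Real => F (a + y * I)) (ib : Integrable fun y : Real => F (b + y * I)) :
    ∫ y : Real, F (b + y * I) = ∫ y : Real, F (a + y * I) := by
  have t1 := intervalIntegral_tendsto_integral (ib.sub ia) tendsto_neg_atTop_atBot tendsto_id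
  have t2 : Tendsto (fun R : Real => ∫ y in (-R)..R, ((fun y : Real => F (b + y * I)) - fun y : Real => F (a + y * I)) y)
      atTop (𝓝 0) := by
    rw [tendsto_zero_iff_norm_tendsto_zero]
    have t3 : Tendsto (fun R : Real => 2 * (b - a) * M / R) atTop (𝓝 0) := tendsto_const_nhds.div_atTop tendsto_id
    refine squeeze_zero' (Eventually.of_forall fun _ => norm_nonneg _) ?_ t3
    filter_upwards [eventually_gt_atTop 0] with R hR
    have h := Complex.integral_boundary_rect_eq_zero_of_differentiableOn F ⟨a, -R⟩ ⟨b, R⟩ (by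
      intro z hz
      have h1 := hz.1
      simp only [mem_preimage, uIcc_of_le hab] at h1
      exact (hF z h1.1 h1.2).differentiableWithinAt)
    simp only [Pi.sub_apply]
    rw [intervalIntegral.integral_sub ib.intervalIntegrable ia.intervalIntegrable]
    have hb : ∀ y : Real, |y| = R → ‖∫ x in a..b, F (x + y * I)‖ ≤ M / R * |b - a| := by
      intro y hy
      refine intervalIntegral.norm_integral_le_of_norm_le_const fun x hx => ?_
      rw [uIoc_of_le hab] at hx
      rw [le_div_iff₀ hR]
      have := hM x y hx.1.le hx.2
      rw [hy] at this
      nlinarith [norm_nonneg (F (x + y * I))]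
    simp only [smul_eq_mul] at h
    have e : I * ((∫ y in (-R)..R, F (b + y * I)) - ∫ y in (-R)..R, F (a + y * I))
       = (∫ x in a..b, F (x + (R:Real) * I)) - ∫ x in a..b, F (x + (-R:Real) * I) := by
      linear_combination h
    have e2 := congrArg norm e
    rw [norm_mul, Complex.norm_I, one_mul] at e2
    rw [e2]
    refine (norm_sub_le _ _).trans ((add_le_add (hb R (abs_of_pos hR)) (hb (-R) (by rw [abs_neg, abs_of_pos hR]))).trans ?_)
    rw [abs_of_nonneg (by linarith)]
    apply le_of_eq; ring
  have := tendsto_nhds_unique t1 t2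
  rw [integral_sub' ib ia] at this
  exact sub_eq_zero.1 this
lemma Ph_integral (t u c : Real) (w : Complex) : (∫ y : Real, Ph t u (1/2 + c + y * I) * Complex.exp (-w * (1/2 + c + y * I)))
    = (sqrt (2 * π) : Real) * Complex.exp (-(u-w)^2/2) * Complex.exp (-w * (1/2 + t * I)) := by
  rw [← gint c (u - w), ← integral_mul_const, ← integral_sub_right_eq_self (μ := volume) (fun x : Real => Complex.exp _ * _) t]
  congr 1; ext y
  rw [Ph_line, Gz, ← Complex.exp_add, ← Complex.exp_add]
  congr 1; push_cast; ring
lemma Ph_integral' (t u c : Real) (w : Complex) : (∫ y : Real, Ph t u (1 - (1/2 + c + y * I)) * Complex.exp (-w * (1/2 + c + y * I)))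
    = (sqrt (2 * π) : Real) * Complex.exp (-(u+w)^2/2) * Complex.exp (-w * (1/2 - t * I)) := by
  have := gint c (-u - w)
  rw [show -(-(u:Complex) - w)^2/2 = -(u+w)^2/2 by ring] at this
  rw [← this, ← integral_mul_const, ← integral_add_right_eq_self (μ := volume) (fun x : Real => Complex.exp _ * _) t]
  congr 1; ext y
  rw [Ph_line', Gz, ← Complex.exp_add, ← Complex.exp_add]
  congr 1; push_cast; ring
noncomputable def g (v : Real) : Real := exp (-v^2/2) / sqrt (2 * π)
lemma g_eq (v : Real) : sqrt (2 * π) * exp (-v^2/2) = 2 * π * g v := by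
  rw [g]
  have h := Real.mul_self_sqrt (show 0 ≤ 2 * π by positivity)
  have : sqrt (2 * π) ≠ 0 := by positivity
  field_simp
  rw [pow_two, h]
lemma Psi_nat (t u : Real) {n : Nat} (hn : 0 < n) : ∫ y : Real, Psi t u (2 + y * I) * (n:Complex) ^ (-(2 + y * I)) =
    2 * π * ((g (u - log n) : Complex) * (n:Complex) ^ (-(1/2 + t * I)) + (g (u + log n) : Complex) * (n:Complex) ^ (-(1/2 - t * I))) := by
  have hc : ∀ s : Complex, (n:Complex)^(-s) = Complex.exp (-(log n : Real) * s) := by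
    intro s
    rw [Complex.cpow_def_of_ne_zero (by exact_mod_cast hn.ne'), ← Complex.natCast_log]; congr 1; ring
  simp_rw [hc, Psi, add_mul]
  have i : ∀ F : Real → Complex, Integrable F → Integrable fun y : Real => F y * Complex.exp (-(log n : Real) * (2 + y * I)) := by
    intro F hF
    refine (hF.norm).mono' (hF.aestronglyMeasurable.mul (by fun_prop)) (Eventually.of_forall fun y => ?_)
    rw [norm_mul, Complex.norm_exp]
    refine mul_le_of_le_one_right (norm_nonneg _) (Real.exp_le_one_iff.2 ?_)
    have := Real.log_natCast_nonneg n
    rw [← Complex.ofReal_neg, Complex.re_ofReal_mul]; simp; linarith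
  have i1 := Ph_int t u (3/2)
  have i2 := Ph_int' t u (3/2)
  have j1 := Ph_integral t u (3/2) (log n)
  have j2 := Ph_integral' t u (3/2) (log n)
  rw [← two_eq] at i1 i2 j1 j2
  rw [integral_add (i _ i1) (i _ i2), j1, j2]
  have e1 := congrArg (fun x : Real => (x:Complex)) (g_eq (u - log n))
  have e2 := congrArg (fun x : Real => (x:Complex)) (g_eq (u + log n))
  push_cast at e1 e2 ⊢
  rw [e1, e2]; ring
lemma g_pos (v : Real) : 0 < g v := by unfold g; positivity
lemma g_le_exp (v : Real) : g v ≤ exp (2 - 2 * v) := by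
  unfold g
  have h1 : 1 ≤ sqrt (2 * π) := by
    rw [Real.one_le_sqrt]; linarith [Real.pi_gt_three]
  refine (div_le_self (Real.exp_nonneg _) h1).trans (Real.exp_le_exp.2 ?_)
  nlinarith [sq_nonneg (v - 2)]
lemma exp_log_pow {n : Nat} (hn : 0 < n) (u : Real) : exp (2 - 2 * (u + log n)) = exp (2 - 2 * u) * (n:Real) ^ (-(2:Real)) := by
  rw [Real.rpow_def_of_pos (by exact_mod_cast hn), ← Real.exp_add]; congr 1; ring
lemma half_cpow_norm {n : Nat} (hn : 0 < n) (t : Real) : ‖(n:Complex) ^ (-(1/2 + t * I))‖ = (n:Real)^(-(1/2:Real)) := by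
  rw [cpow_norm hn]; congr 2; simp
lemma rpow_half_le_one {n : Nat} (hn : 0 < n) : (n:Real)^(-(1/2:Real)) ≤ 1 :=
  Real.rpow_le_one_of_one_le_of_nonpos (by exact_mod_cast hn) (by norm_num)
lemma sum2_bd (t u : Real) (n : Nat) : ‖(vL n : Complex) * ((g (u + log n) : Complex) * (n:Complex) ^ (-(1/2 + t * I)))‖ ≤
    exp (2 - 2 * u) * (vL n * (n:Real) ^ (-(2:Real))) := by
  rcases Nat.eq_zero_or_pos n with rfl | hn
  · simp [vL]
  rw [norm_mul, norm_mul, half_cpow_norm hn, Complex.norm_real, Complex.norm_real, Real.norm_of_nonneg (vL_nonneg n),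
    Real.norm_of_nonneg (g_pos _).le]
  have h1 := g_le_exp (u + log n)
  rw [exp_log_pow hn] at h1
  calc _ ≤ vL n * ((exp (2 - 2 * u) * (n:Real) ^ (-(2:Real))) * 1) := by
        have := vL_nonneg n
        have := rpow_half_le_one hn
        gcongr
    _ = _ := by ring
/-- the infinite prime sum -/
noncomputable def Pterm (t u : Real) (n : Nat) : Complex := (vL n : Complex) * ((g (u - log n) : Complex) * (n:Complex) ^ (-(1/2 + t * I)))
lemma g_neg (v : Real) : g (-v) = g v := by simp [g]
lemma Pterm_summable (t u : Real) : Summable (fun n => ‖Pterm t u n‖) := by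
  refine Summable.of_nonneg_of_le (fun _ => norm_nonneg _) (fun n => ?_) ((summable_vL (σ := 2) (by norm_num)).mul_left (exp (2 - 2 * -u)))
  have := sum2_bd t (-u) n
  rwa [show -u + log n = -(u - log n) by ring, g_neg] at this
lemma Psi_int (t u c : Real) : Integrable fun y : Real => Psi t u (1/2 + c + y * I) := (Ph_int t u c).add (Ph_int' t u c)
lemma prime_part (t u : Real) : HasSum (fun n : Nat => 2 * π * (Pterm t u n + (vL n : Complex) * ((g (u + log n) : Complex) * (n:Complex) ^ (-(1/2 + (-t:Real) * I)))))
    (-∫ y : Real, Psi t u (2 + y * I) * logDeriv riemannZeta (2 + y * I)) := by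
  have i1 := Psi_int t u (3/2)
  rw [← two_eq] at i1
  have hn : ∀ (n : Nat) (y : Real), ‖Psi t u (2 + y * I) * ((vL n : Complex) * (n:Complex) ^ (-(2 + y * I)))‖
      = ‖Psi t u (2 + y * I)‖ * (vL n * (n:Real) ^ (-(2:Real))) := by
    intro n y
    rcases Nat.eq_zero_or_pos n with rfl | hn
    · simp [vL]
    rw [norm_mul, norm_mul, cpow_norm hn, Complex.norm_real, Real.norm_of_nonneg (vL_nonneg n)]
    simp
  have hm : ∀ n : Nat, AEStronglyMeasurable (fun y : Real => Psi t u (2 + y * I) * ((vL n : Complex) * (n:Complex) ^ (-(2 + y * I)))) := by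
    intro n
    rcases Nat.eq_zero_or_pos n with rfl | hn
    · simp [vL]; exact aestronglyMeasurable_const
    refine i1.aestronglyMeasurable.mul (Continuous.aestronglyMeasurable ?_)
    have : (n:Complex) ≠ 0 := by exact_mod_cast hn.ne'
    exact continuous_const.mul (Continuous.const_cpow (by fun_prop) (Or.inl this))
  have hi : ∀ n : Nat, Integrable (fun y : Real => Psi t u (2 + y * I) * ((vL n : Complex) * (n:Complex) ^ (-(2 + y * I)))) := by
    intro n
    exact (i1.norm.mul_const _).mono' (hm n) (Eventually.of_forall fun y => (hn n y).le)
  have h := hasSum_integral_of_summable_integral_norm hi (by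
    simp_rw [hn, integral_mul_const]
    exact (summable_vL (by norm_num)).mul_left _)
  have e : ∀ y : Real, ∑' n : Nat, Psi t u (2 + y * I) * ((vL n : Complex) * (n:Complex) ^ (-(2 + y * I))) =
      -(Psi t u (2 + y * I) * logDeriv riemannZeta (2 + y * I)) := by
    intro y
    rw [tsum_mul_left, (zeta_ld (s := 2 + y * I) (by simp)).tsum_eq, mul_neg]
  simp_rw [e] at h
  rw [integral_neg] at h
  refine h.congr_fun ?_ 
  intro n
  rcases Nat.eq_zero_or_pos n with rfl | hn
  · simp [vL, Pterm]
  have := Psi_nat t u hn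
  calc _ = ∫ y : Real, (vL n : Complex) * (Psi t u (2 + y * I) * (n:Complex) ^ (-(2 + y * I))) := by
        rw [integral_const_mul, this, Pterm]; push_cast; ring_nf
    _ = _ := by congr 1; ext y; ring
lemma polar_part (t u : Real) : ∫ y : Real, Psi t u (2 + y * I) * (1 / (2 + y * I) + 1 / (2 + y * I - 1))
    = 2 * π * (Ph t u 0 + Ph t u 1) := by
  have i1 := Ph_int t u (3/2)
  have i2 := Ph_int' t u (3/2)
  rw [← two_eq] at i1 i2
  rw [mul_add, ← perzero t u 0 (by simp) (by simp), ← perzero t u 1 (by simp) (by simp)]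
  have a1 := int_div i1 (a := 0) (by simp)
  have a2 := int_div i2 (a := 1 - 0) (by simp)
  have a3 := int_div i1 (a := 1) (by simp)
  have a4 := int_div i2 (a := 1 - 1) (by simp)
  rw [← integral_add a1 a2, ← integral_add a3 a4]
  have h := integral_add (a1.add a2) (a3.add a4)
  simp only [Pi.add_apply] at h
  rw [← h]
  congr 1; ext y
  simp only [Psi, sub_zero, sub_self]
  ring
lemma polar_bd {t u : Real} (ht : 1 ≤ t) (hu : 0 ≤ u) (hut : u ≤ t) : ‖Ph t u 0 + Ph t u 1‖ ≤ 4 := by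
  have e0 : Ph t u 0 = Gz u ((-(1/2) : Real) + (-t : Real) * I) := by rw [Ph]; congr 1; push_cast; ring
  have e1 : Ph t u 1 = Gz u ((1/2 : Real) + (-t : Real) * I) := by rw [Ph]; congr 1; push_cast; ring
  have h : ∀ c : Real, |c| = 1/2 → ‖Gz u (c + (-t : Real) * I)‖ ≤ 2 := by
    intro c hc
    rw [Gz_norm, ← Real.exp_add]
    have h1 : u * c ≤ t * (1/2) := by
      have := mul_le_mul_of_nonneg_left (le_abs_self c) hu
      rw [hc] at this; linarith
    have h2 : c^2 = 1/4 := by rw [← sq_abs, hc]; norm_num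
    have h3 : u * c + c^2/2 + -(1/2) * (-t)^2 ≤ 1/8 := by nlinarith
    refine (Real.exp_le_exp.2 (h3.trans (show (1/8:Real) ≤ 1/2 by norm_num))).trans ?_
    have := Real.exp_one_lt_d9
    have h4 : exp (1/2) * exp (1/2) = exp 1 := by rw [← Real.exp_add]; norm_num
    nlinarith [Real.exp_pos (1/2)]
  rw [e0, e1]
  have := norm_add_le (Gz u ((-(1/2) : Real) + (-t : Real) * I)) (Gz u ((1/2 : Real) + (-t : Real) * I))
  have b0 := h (-(1/2)) (by norm_num [abs_of_pos])
  have b1 := h (1/2) (by norm_num [abs_of_pos])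
  linarith
lemma digamma_diff {z : Complex} (hz : 0 < z.re) : DifferentiableAt Complex Complex.digamma z := by
  have ho : IsOpen {z : Complex | 0 < z.re} := isOpen_lt continuous_const Complex.continuous_re
  have h1 : DifferentiableOn Complex Complex.Gamma {z : Complex | 0 < z.re} := fun w hw => (Gamma_diffAt hw).differentiableWithinAt
  have h2 := (h1.deriv ho).differentiableAt (ho.mem_nhds hz)
  exact h2.div (Gamma_diffAt hz) (Complex.Gamma_ne_zero_of_re_pos hz)
lemma logdiff {t : Real} (ht : 1 ≤ t) (y : Real) : |log (2 + |y/2|) - log t| ≤ 2 + |(|y| - t)| := by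
  set d := |(|y| - t)| with hd
  have d0 : 0 ≤ d := abs_nonneg _
  have h1 : |y| - t ≤ d := le_abs_self _
  have h2 : -(|y| - t) ≤ d := neg_le_abs _
  have ey : |y/2| = |y|/2 := by rw [abs_div]; norm_num
  rw [ey]
  have hy := abs_nonneg y
  have ha : 0 < 2 + |y|/2 := by positivity
  have l1 := Real.log_le_log ha (show 2 + |y|/2 ≤ t * (3 + d) by nlinarith)
  have l2 := Real.log_le_log (by linarith) (show t ≤ (2 + |y|/2) * (2 + d) by nlinarith [mul_nonneg hy d0])
  rw [Real.log_mul (by linarith) (by linarith)] at l1 l2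
  have l3 := Real.log_le_sub_one_of_pos (show 0 < 3 + d by linarith)
  have l4 := Real.log_le_sub_one_of_pos (show 0 < 2 + d by linarith)
  rw [abs_le]; constructor <;> linarith
noncomputable def D0 (t : Real) (s : Complex) : Complex := (-(log π / 2 : Real) + Complex.digamma (s / 2) / 2) - (log t / 2 : Real)
lemma D0_bd {t : Real} (ht : 1 ≤ t) {x y : Real} (h0 : 1/2 ≤ x) (h1 : x ≤ 2) :
    ‖D0 t (x + y * I)‖ ≤ 8 + |(|y| - t)| := by
  have d := digamma_bd (z := (x + y * I) / 2) (by simp; linarith) (by simp; linarith)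
  have him : ((x + y * I : Complex) / 2).im = y / 2 := by simp
  rw [him] at d
  have l := logdiff ht y
  have e : D0 t (x + y * I) = (1/2 : Real) * ((Complex.digamma ((x + y * I) / 2) - log (2 + |y/2|)) +
      ((log (2 + |y/2|) - log t - log π : Real) : Complex)) := by
    rw [D0]; push_cast; ring
  rw [e, norm_mul, Complex.norm_real]
  have n := norm_add_le (Complex.digamma ((x + y * I) / 2) - log (2 + |y/2|))
      ((log (2 + |y/2|) - log t - log π : Real) : Complex)
  rw [Complex.norm_real _, Real.norm_eq_abs] at n
  have a := abs_sub (log (2 + |y/2|) - log t) (log π)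
  have lp : |log π| ≤ 2 := by
    have h0 := Real.log_nonneg (show 1 ≤ π by linarith [Real.pi_gt_three])
    have h1 := Real.log_le_log Real.pi_pos (show π ≤ 2 * 2 by linarith [Real.pi_le_four])
    rw [Real.log_mul (by norm_num) (by norm_num)] at h1
    rw [abs_of_nonneg h0]
    linarith [Real.log_two_lt_d9]
  have : ‖(1/2:Real)‖ = 1/2 := by norm_num
  rw [this]
  linarith [abs_nonneg (|y| - t)]
lemma half_c : ((1/2 : Real) : Complex) = 1/2 + (0:Real) := by norm_num
lemma Psi_total (t u : Real) : ∫ y : Real, Psi t u (2 + y * I) = 2 * (2 * π * g u) := by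
  have j1 := Ph_integral t u (3/2) 0
  have j2 := Ph_integral' t u (3/2) 0
  have i1 := Ph_int t u (3/2)
  have i2 := Ph_int' t u (3/2)
  rw [← two_eq] at j1 j2 i1 i2
  simp only [neg_zero, zero_mul, Complex.exp_zero, mul_one, sub_zero, add_zero] at j1 j2
  simp_rw [Psi]
  rw [integral_add i1 i2, j1, j2]
  have e1 := congrArg (fun x : Real => (x:Complex)) (g_eq u)
  push_cast at e1 ⊢
  rw [e1]; ring
lemma int_mul_poly {t u c M : Real} (hc : |c| ≤ 3/2) {D : Real → Complex} (hD : AEStronglyMeasurable D) (hb : ∀ y, ‖D y‖ ≤ M * (2 + |y|)) :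
    Integrable fun y : Real => Psi t u (1/2 + c + y * I) * D y := by
  have hM : 0 ≤ M := by have := (norm_nonneg _).trans (hb 0); simp at this; linarith
  refine ((polyPsi (t := t) (u := u) hc).const_mul M).mono' ((Psi_int t u c).aestronglyMeasurable.mul hD) (Eventually.of_forall fun y => ?_)
  rw [norm_mul]
  calc _ ≤ ‖Psi t u (1/2 + c + y * I)‖ * (M * (2 + |y|)) := by gcongr; exact hb y
    _ ≤ ‖Psi t u (1/2 + c + y * I)‖ * (M * (2 + |y|)^2) := by
        gcongr; nlinarith [abs_nonneg y]
    _ = _ := by ring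
lemma D0_meas (t : Real) {x : Real} (hx : 0 < x) : AEStronglyMeasurable (fun y : Real => D0 t (x + y * I)) := by
  refine Continuous.aestronglyMeasurable (continuous_iff_continuousAt.2 fun y => ?_)
  have h1 : ContinuousAt (D0 t) (x + y * I) := by
    have := (digamma_diff (z := (x + y * I) / 2) (by simp; linarith)).continuousAt
    unfold D0
    have h2 : ContinuousAt (fun s : Complex => Complex.digamma (s / 2)) (x + y * I) :=
      ContinuousAt.comp (f := fun s : Complex => s / 2) this (by fun_prop)
    fun_prop
  exact ContinuousAt.comp (f := fun y : Real => (x + y * I : Complex)) h1 (by fun_prop)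
lemma gamma_part : ∃ C > 0, ∀ t u : Real, 1 ≤ t → ‖∫ y : Real, Psi t u (2 + y * I) * D0 t (2 + y * I)‖ ≤ C := by
  have I0 := gauss_int
  have I1 := gauss_int1
  have IK : Integrable fun v : Real => (8 + |v|) * exp (-(1/2) * v^2) := by
    refine ((I0.const_mul 8).add I1).congr (Eventually.of_forall fun v => ?_); simp only [Pi.add_apply]; ring
  refine ⟨2 * (∫ v : Real, (8 + |v|) * exp (-(1/2) * v^2)) + 1, ?_, fun t u ht => ?_⟩
  · have : 0 ≤ ∫ v : Real, (8 + |v|) * exp (-(1/2) * v^2) := integral_nonneg fun v => by positivity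
    linarith
  have hb : ∀ x y : Real, 1/2 ≤ x → x ≤ 2 → ‖D0 t (x + y * I)‖ ≤ (8 + t) * (2 + |y|) := by
    intro x y h0 h1
    refine (D0_bd ht h0 h1).trans ?_
    have := abs_sub |y| t
    rw [abs_abs, abs_of_pos (by linarith : 0 < t)] at this
    nlinarith [abs_nonneg y]
  have i1 : Integrable fun y : Real => Psi t u (1/2 + (0:Real) + y * I) * D0 t (1/2 + (0:Real) + y * I) := by
    refine int_mul_poly (M := 8 + t) (by norm_num) ?_ ?_ <;> rw [← half_c]
    · exact D0_meas t (by norm_num)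
    · exact fun y => hb _ y le_rfl (by norm_num)
  have i2 : Integrable fun y : Real => Psi t u (1/2 + (3/2:Real) + y * I) * D0 t (1/2 + (3/2:Real) + y * I) := by
    have e : (1/2 + (3/2:Real) : Complex) = (2:Real) := by norm_num
    refine int_mul_poly (M := 8 + t) (by norm_num [abs_of_pos]) ?_ ?_ <;> rw [e]
    · exact D0_meas t (by norm_num)
    · exact fun y => hb _ y (by norm_num) le_rfl
  rw [← two_eq] at i2
  rw [← half_c] at i1
  obtain ⟨M, hM, hPM⟩ := Psi_decay t u
  have s := shift (F := fun s => Psi t u s * D0 t s) (a := 1/2) (b := 2) (M := (8 + t) * M) ?_ (by norm_num) ?_ i1 (by simpa using i2)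
  · rw [show ((2:Real):Complex) = 2 by norm_num] at s
    rw [s, half_c]
    refine (norm_integral_le_integral_norm _).trans ?_
    have h1 : ∀ y : Real, ‖Psi t u (1/2 + (0:Real) + y * I) * D0 t (1/2 + (0:Real) + y * I)‖ ≤
        (8 + |y - t|) * exp (-(1/2) * (y-t)^2) + (8 + |y + t|) * exp (-(1/2) * (y+t)^2) := by
      intro y
      have hD := D0_bd ht (x := 1/2) (y := y) le_rfl (by norm_num)
      rw [half_c] at hD
      have a1 : |(|y| - t)| ≤ |y - t| := by
        have := abs_abs_sub_abs_le_abs_sub y t; rwa [abs_of_pos (by linarith : 0 < t)] at this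
      have a2 : |(|y| - t)| ≤ |y + t| := by
        have := abs_abs_sub_abs_le_abs_sub y (-t); rwa [abs_neg, abs_of_pos (by linarith : 0 < t), sub_neg_eq_add] at this
      have hP : ‖Psi t u (1/2 + (0:Real) + y * I)‖ ≤ exp (-(1/2) * (y-t)^2) + exp (-(1/2) * (y+t)^2) := by
        rw [Psi, Ph_line, Ph_line']
        refine (norm_add_le _ _).trans (le_of_eq ?_)
        rw [Gz_norm, Gz_norm]; simp
      rw [norm_mul]
      calc _ ≤ (exp (-(1/2) * (y-t)^2) + exp (-(1/2) * (y+t)^2)) * (8 + |(|y| - t)|) := by gcongr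
        _ = (8 + |(|y| - t)|) * exp (-(1/2) * (y-t)^2) + (8 + |(|y| - t)|) * exp (-(1/2) * (y+t)^2) := by ring
        _ ≤ _ := by gcongr
    have h2 := integral_mono_of_nonneg (Eventually.of_forall fun y => norm_nonneg _)
      ((IK.comp_sub_right t).add (IK.comp_add_right t)) (Eventually.of_forall h1)
    refine h2.trans ?_
    simp only [Pi.add_apply]
    rw [integral_add (IK.comp_sub_right t) (IK.comp_add_right t), integral_sub_right_eq_self (fun v : Real => (8 + |v|) * exp (-(1/2) * v^2)) t,
      integral_add_right_eq_self (fun v : Real => (8 + |v|) * exp (-(1/2) * v^2)) t]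
    linarith
  · intro z h0 h1
    have hd : DifferentiableAt Complex (fun s : Complex => Complex.digamma (s / 2)) z :=
      DifferentiableAt.comp (f := fun s : Complex => s / 2) z (digamma_diff (z := z / 2) (by simp; linarith)) (by fun_prop)
    refine DifferentiableAt.mul ?_ ?_
    · unfold Psi Ph Gz; fun_prop
    · unfold D0; fun_prop
  · intro x y h0 h1
    have := hPM (x - 1/2) (by rw [abs_le]; constructor <;> linarith) y
    rw [show (1/2 + ((x - 1/2 : Real):Complex)) = x by push_cast; ring] at this
    simp only [norm_mul]
    calc _ ≤ (2 + |y|) * (‖Psi t u (x + y * I)‖ * ((8 + t) * (2 + |y|))) := by gcongr; exact hb x y h0 h1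
      _ = (8 + t) * ((2 + |y|)^2 * ‖Psi t u (x + y * I)‖) := by ring
      _ ≤ _ := by gcongr
lemma zeta_ld_meas : AEStronglyMeasurable (fun y : Real => logDeriv riemannZeta (2 + y * I)) := by
  refine Continuous.aestronglyMeasurable (continuous_iff_continuousAt.2 fun y => ?_)
  have ho : IsOpen ({1}ᶜ : Set Complex) := isOpen_compl_singleton
  have hne : (2 + y * I : Complex) ≠ 1 := fun h => by have := congrArg Complex.re h; simp at this
  have h1 : DifferentiableOn Complex riemannZeta ({1}ᶜ : Set Complex) := fun w hw => (differentiableAt_riemannZeta hw).differentiableWithinAt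
  have h2 := ((h1.deriv ho).differentiableAt (ho.mem_nhds hne)).div (differentiableAt_riemannZeta hne)
    (riemannZeta_ne_zero_of_one_le_re (by simp))
  exact ContinuousAt.comp (f := fun y : Real => (2 + y * I : Complex)) (g := logDeriv riemannZeta) h2.continuousAt (by fun_prop)
theorem EF : ∃ C > 0, ∀ t u : Real, 1 ≤ t → 0 ≤ u → u ≤ t → ∃ A : Complex,
    Tendsto (fun n : Nat => ∑ a ∈ Zn n, (mu a : Complex) * Ph t u a) atTop (𝓝 A) ∧
    ‖A - ((g u * log t : Real) - ∑' n, Pterm t u n)‖ ≤ C := by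
  obtain ⟨C1, hC1, hg⟩ := gamma_part
  obtain ⟨C2, hC2, hz⟩ := ld_zeta_bd
  have hS := summable_vL (σ := 2) (by norm_num)
  set S := ∑' n : Nat, vL n * (n:Real) ^ (-(2:Real)) with hSd
  have hS0 : 0 ≤ S := tsum_nonneg fun n => mul_nonneg (vL_nonneg n) (by positivity)
  refine ⟨4 + C1 + exp 2 * S, by positivity, fun t u ht hu hut => ⟨_, EFlim t u, ?_⟩⟩
  have pp : (π : Complex) ≠ 0 := by exact_mod_cast Real.pi_ne_zero
  have iP := Psi_int t u (3/2)
  rw [← two_eq] at iP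
  have i1 : Integrable fun y : Real => Psi t u (2 + y * I) * (1 / (2 + y * I) + 1 / (2 + y * I - 1)) := by
    refine ((int_div iP (a := 0) (by simp)).add (int_div iP (a := 1) (by simp))).congr (Eventually.of_forall fun y => ?_)
    simp only [Pi.add_apply, sub_zero]; ring
  have i2 : Integrable fun y : Real => Psi t u (2 + y * I) * D0 t (2 + y * I) := by
    have := int_mul_poly (t := t) (u := u) (c := 3/2) (M := 8 + t) (by norm_num [abs_of_pos]) (D0_meas t (x := 2) (by norm_num)) (fun y => by
      refine (D0_bd ht (by norm_num) le_rfl).trans ?_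
      have := abs_sub |y| t
      rw [abs_abs, abs_of_pos (by linarith : 0 < t)] at this
      nlinarith [abs_nonneg y])
    rw [← two_eq] at this
    simpa using this
  have i3 : Integrable fun y : Real => Psi t u (2 + y * I) * logDeriv riemannZeta (2 + y * I) := by
    refine iP.mul_bdd (c := C2) zeta_ld_meas (Eventually.of_forall fun y => hz _ (by simp))
  have i4 : Integrable fun y : Real => Psi t u (2 + y * I) * (log t / 2 : Real) := iP.mul_const _
  have hsplit : ∫ y : Real, Psi t u (2 + y * I) * logDeriv xi (2 + y * I) =
      2 * π * (Ph t u 0 + Ph t u 1) + (∫ y : Real, Psi t u (2 + y * I) * D0 t (2 + y * I)) +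
      2 * (2 * π * g u) * (log t / 2 : Real) + ∫ y : Real, Psi t u (2 + y * I) * logDeriv riemannZeta (2 + y * I) := by
    rw [← polar_part, ← Psi_total t u, ← integral_mul_const, ← integral_add i1 i2, ← integral_add (by exact i1.add i2) i4,
      ← integral_add (by exact (i1.add i2).add i4) i3]
    congr 1; ext y
    rw [xi_ld (by simp), D0]; ring
  have hpr := prime_part t u
  set X := ∫ y : Real, Psi t u (2 + y * I) * logDeriv riemannZeta (2 + y * I)
  set W := ∫ y : Real, Psi t u (2 + y * I) * D0 t (2 + y * I) with hW
  have hb2 := fun n => sum2_bd (-t) u n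
  have s2 : Summable fun n => ‖(vL n : Complex) * ((g (u + log n) : Complex) * (n:Complex) ^ (-(1/2 + (-t:Real) * I)))‖ :=
    Summable.of_nonneg_of_le (fun _ => norm_nonneg _) hb2 (hS.mul_left _)
  have hX : -X = 2 * π * (∑' n, Pterm t u n + ∑' n, (vL n : Complex) * ((g (u + log n) : Complex) * (n:Complex) ^ (-(1/2 + (-t:Real) * I)))) := by
    rw [← hpr.tsum_eq, tsum_mul_left, (Pterm_summable t u).of_norm.tsum_add s2.of_norm]
  set Q := ∑' n, (vL n : Complex) * ((g (u + log n) : Complex) * (n:Complex) ^ (-(1/2 + (-t:Real) * I)))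
  have hQ : ‖Q‖ ≤ exp 2 * S := by
    refine (norm_tsum_le_tsum_norm s2).trans ((s2.tsum_le_tsum hb2 (hS.mul_left _)).trans ?_)
    rw [tsum_mul_left]
    gcongr; linarith
  rw [hsplit, show X = - -X by ring, hX]
  have e : 1 / (2 * (π:Complex)) * (2 * π * (Ph t u 0 + Ph t u 1) + W + 2 * (2 * π * g u) * (log t / 2 : Real) +
      -(2 * π * (∑' n, Pterm t u n + Q))) - ((g u * log t : Real) - ∑' n, Pterm t u n)
      = (Ph t u 0 + Ph t u 1) + 1 / (2 * (π:Complex)) * W - Q := by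
    push_cast; field_simp; ring
  rw [e]
  have n1 := norm_sub_le ((Ph t u 0 + Ph t u 1) + 1 / (2 * (π:Complex)) * W) Q
  have n2 := norm_add_le (Ph t u 0 + Ph t u 1) (1 / (2 * (π:Complex)) * W)
  have n3 : ‖1 / (2 * (π:Complex)) * W‖ ≤ C1 := by
    have h1 := hg t u ht
    have h2 : ‖1 / (2 * (π:Complex))‖ ≤ 1 := by
      rw [show 1 / (2 * (π:Complex)) = ((1 / (2 * π) : Real) : Complex) by push_cast; rfl, Complex.norm_real, Real.norm_of_nonneg (by positivity)]
      rw [div_le_one (by positivity)]; linarith [Real.pi_gt_three]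
    rw [norm_mul]
    nlinarith [norm_nonneg W]
  linarith [polar_bd ht hu hut]
noncomputable def NT (T : Real) : Nat := ⌊T^2⌋₊ + 1
noncomputable def Pf (T t u : Real) : Complex := ∑ n ∈ Finset.range (NT T), Pterm t u n
lemma g_le_exp4 (v : Real) : g v ≤ exp (8 - 4 * v) := by
  unfold g
  have h1 : 1 ≤ sqrt (2 * π) := by
    rw [Real.one_le_sqrt]; linarith [Real.pi_gt_three]
  refine (div_le_self (Real.exp_nonneg _) h1).trans (Real.exp_le_exp.2 ?_)
  nlinarith [sq_nonneg (v - 4)]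
lemma g_le_one (v : Real) : g v ≤ 1 := by
  unfold g
  have h1 : 1 ≤ sqrt (2 * π) := by
    rw [Real.one_le_sqrt]; linarith [Real.pi_gt_three]
  refine (div_le_self (Real.exp_nonneg _) h1).trans (Real.exp_le_one_iff.2 ?_)
  nlinarith [sq_nonneg v]
lemma tail_bd {T t u : Real} (hT : 1 ≤ T) (hu : u ≤ log T) :
    ‖(∑' n, Pterm t u n) - Pf T t u‖ ≤ exp 8 * ∑' n : Nat, vL n * (n:Real) ^ (-(2:Real)) := by
  have hs := Pterm_summable t u
  have hS := summable_vL (σ := 2) (by norm_num)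
  have e := hs.of_norm.sum_add_tsum_nat_add (NT T)
  rw [Pf, ← e, add_sub_cancel_left]
  have hs' := (summable_nat_add_iff (NT T)).2 hs
  have hS' := (summable_nat_add_iff (NT T)).2 hS
  refine (norm_tsum_le_tsum_norm hs').trans ?_
  have hb : ∀ n, ‖Pterm t u (n + NT T)‖ ≤ exp 8 * (vL (n + NT T) * ((n + NT T : Nat):Real) ^ (-(2:Real))) := by
    intro n
    set m := n + NT T with hm
    have hm0 : 0 < m := by rw [hm, NT]; omega
    have hmT : T^2 ≤ m := by
      have h1 := Nat.lt_floor_add_one (T^2)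
      have h2 : ((⌊T^2⌋₊ + 1 : Nat) : Real) ≤ m := by exact_mod_cast (by rw [hm, NT]; omega)
      push_cast at h2; linarith
    have hl : 2 * log T ≤ log m := by
      have := Real.log_le_log (by positivity) hmT
      rwa [Real.log_pow] at this
    rw [Pterm, norm_mul, norm_mul, half_cpow_norm hm0, Complex.norm_real, Complex.norm_real, Real.norm_of_nonneg (vL_nonneg m),
      Real.norm_of_nonneg (g_pos _).le, ← g_neg]
    have h3 := g_le_exp4 (-(u - log m))
    have h4 : exp (8 - 4 * -(u - log m)) ≤ exp 8 * (m:Real) ^ (-(2:Real)) := by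
      rw [Real.rpow_def_of_pos (by exact_mod_cast hm0), ← Real.exp_add]
      apply Real.exp_le_exp.2; linarith
    calc _ ≤ vL m * ((exp 8 * (m:Real) ^ (-(2:Real))) * 1) := by
          have := vL_nonneg m
          have := rpow_half_le_one hm0
          have := h3.trans h4
          gcongr
      _ = _ := by ring
  refine (hs'.tsum_le_tsum hb (hS'.mul_left _)).trans ?_
  rw [tsum_mul_left]
  refine mul_le_mul_of_nonneg_left ?_ (Real.exp_nonneg _)
  rw [← hS.sum_add_tsum_nat_add (NT T)]
  linarith [Finset.sum_nonneg (s := Finset.range (NT T)) (f := fun n : Nat => vL n * (n:Real) ^ (-(2:Real))) fun n _ => mul_nonneg (vL_nonneg n) (by positivity)]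
theorem EF2 : ∃ C > 0, ∀ T t u : Real, 4 ≤ T → t ∈ Ioc T (2*T) → 0 ≤ u → u ≤ log T → ∃ A : Complex,
    Tendsto (fun n : Nat => ∑ a ∈ Zn n, (mu a : Complex) * Ph t u a) atTop (𝓝 A) ∧
    ‖A - ((g u * log T : Real) - Pf T t u)‖ ≤ C := by
  obtain ⟨C, hC, h⟩ := EF
  have hS0 : 0 ≤ ∑' n : Nat, vL n * (n:Real) ^ (-(2:Real)) := tsum_nonneg fun n => mul_nonneg (vL_nonneg n) (by positivity)
  refine ⟨C + exp 8 * (∑' n : Nat, vL n * (n:Real) ^ (-(2:Real))) + 1, by positivity, fun T t u hT ht hu huT => ?_⟩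
  have hlT := Real.log_le_sub_one_of_pos (show 0 < T by linarith)
  obtain ⟨A, hA, hb⟩ := h t u (by linarith [ht.1]) hu (by linarith [ht.1])
  refine ⟨A, hA, ?_⟩
  have e : A - ((g u * log T : Real) - Pf T t u) = (A - ((g u * log t : Real) - ∑' n, Pterm t u n))
     - ((∑' n, Pterm t u n) - Pf T t u) + ((g u * (log t - log T) : Real) : Complex) := by push_cast; ring
  rw [e]
  refine (norm_add_le _ _).trans (add_le_add ((norm_sub_le _ _).trans (add_le_add hb (tail_bd (by linarith) huT))) ?_)
  rw [Complex.norm_real, Real.norm_eq_abs, abs_mul, abs_of_pos (g_pos u)]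
  have l1 := Real.log_le_log (by linarith) ht.1.le
  have l2 := Real.log_le_log (by linarith [ht.1]) ht.2
  rw [Real.log_mul (by norm_num) (by linarith)] at l2
  have l3 := Real.log_two_lt_d9
  rw [abs_of_nonneg (by linarith)]
  nlinarith [g_le_one u, g_pos u]
lemma gauss_le (x : Real) : exp (-x^2/4) ≤ 4 / (1 + x^2) := by
  have h := Real.add_one_le_exp (x^2/4)
  rw [show -x^2/4 = -(x^2/4) by ring, Real.exp_neg, inv_eq_one_div, div_le_div_iff₀ (Real.exp_pos _) (by positivity)]
  nlinarith [sq_nonneg x]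
lemma Ph_norm (t u : Real) (ρ : Complex) : ‖Ph t u ρ‖ = exp (u * (ρ.re - 1/2) + (ρ.re - 1/2)^2/2) * exp (-(1/2) * (ρ.im - t)^2) := by
  rw [← Gz_norm, Ph]
  congr 2
  apply Complex.ext <;> simp
def BoxAt (b T : Real) : Prop := ∀ ρ ∈ zeroBand T, |ρ.re - 1/2| < b / (2 * log T)
/-- all zeros with height in `(T/2, 4T]` are within `1/log T` of the line. -/
lemma box_wide {b : Real} (hb0 : 0 < b) (hb1 : b ≤ 1) (hbox : ∀ᶠ T in atTop, BoxAt b T) :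
    ∀ᶠ T in atTop, ∀ ρ : Complex, xi ρ = 0 → T/2 < ρ.im → ρ.im ≤ 4 * T → |ρ.re - 1/2| ≤ 1 / log T := by
  have h1 : Tendsto (fun T : Real => T/2) atTop atTop := tendsto_id.atTop_div_const (by norm_num)
  have h2 : Tendsto (fun T : Real => 2*T) atTop atTop := tendsto_id.const_mul_atTop (by norm_num)
  filter_upwards [hbox, h1.eventually hbox, h2.eventually hbox, eventually_ge_atTop 4] with T b0 b1 b2 hT ρ hρ hl hr
  have hz := (xi_zero_iff _).1 hρ
  have l0 : 0 < log T := Real.log_pos (by linarith)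
  have l1 : log T / 2 ≤ log (T/2) := by
    rw [div_le_iff₀ (by norm_num), mul_comm, ← Real.log_rpow (by linarith)]
    apply Real.log_le_log (by linarith)
    rw [Real.rpow_two]; nlinarith
  have l2 : log T ≤ log (2*T) := Real.log_le_log (by linarith) (by linarith)
  have key : ∀ S : Real, BoxAt b S → S < ρ.im → ρ.im ≤ 2 * S → log T / 2 ≤ log S → |ρ.re - 1/2| ≤ 1 / log T := by
    intro S hS h1 h2 h3
    refine (hS ρ ⟨hz, h1, h2⟩).le.trans ?_
    rw [div_le_div_iff₀ (by linarith) l0]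
    nlinarith
  rcases le_or_gt ρ.im T with h | h
  · exact key (T/2) b1 hl (by linarith) l1
  rcases le_or_gt ρ.im (2*T) with h' | h'
  · exact key T b0 h h' (by linarith)
  · exact key (2*T) b2 h' (by linarith) (by linarith)
lemma edge {b : Real} (hb0 : 0 < b) (hb1 : b ≤ 1) (hbox : ∀ᶠ T in atTop, BoxAt b T) :
    ∃ C > 0, ∀ᶠ T in atTop, ∀ u : Real, 0 ≤ u → u ≤ log T → ∀ (t : Real) (Z : Finset Complex), (∀ ρ ∈ Z, xi ρ = 0) →
      (∀ ρ ∈ Z, (ρ.im ∈ Ioc T (2*T) ↔ t ∉ Ioc T (2*T))) →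
      ∑ ρ ∈ Z, (mu ρ : Real) * ‖Ph t u ρ‖ ≤ C * log T * (exp (-(1/2) * (t - T)^2) + exp (-(1/2) * (t - 2*T)^2)) := by
  obtain ⟨C, hC, hcnt⟩ := cnt
  refine ⟨32 * exp 2 * C, by positivity, ?_⟩
  filter_upwards [box_wide hb0 hb1 hbox, eventually_ge_atTop 16] with T hw hT u hu huT t Z hZ hZt
  have L0 : 0 < log T := Real.log_pos (by linarith)
  have hLT := Real.log_le_sub_one_of_pos (show 0 < T by linarith)
  have main : ∀ ρ ∈ Z, ∀ e : Real, (e = T ∨ e = 2*T) → (ρ.im - e)^2 + (t - e)^2 ≤ (ρ.im - t)^2 →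
      ‖Ph t u ρ‖ ≤ exp 2 * (4 / (1 + (e - ρ.im)^2)) * exp (-(1/2) * (t - e)^2) := by
    intro ρ hρ e he h
    have hz := (xi_zero_iff _).1 (hZ ρ hρ)
    have hre : (ρ.re - 1/2)^2 ≤ 1/4 := by nlinarith [hz.2.1, hz.2.2]
    have hu2 : u * (ρ.re - 1/2) ≤ 1 + (ρ.im - e)^2/4 := by
      by_cases hc : T/2 < ρ.im ∧ ρ.im ≤ 4*T
      · have := hw ρ (hZ ρ hρ) hc.1 hc.2
        have h3 : u * (ρ.re - 1/2) ≤ log T * (1 / log T) :=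
          (mul_le_mul_of_nonneg_left ((le_abs_self _).trans this) hu).trans (by gcongr)
        rw [mul_one_div_cancel L0.ne'] at h3
        nlinarith [sq_nonneg (ρ.im - e)]
      · have h3 : (T/2)^2 ≤ (ρ.im - e)^2 := by
          rw [not_and_or, not_lt, not_le] at hc
          rcases hc with hc | hc <;> rcases he with rfl | rfl <;> nlinarith
        nlinarith [hz.2.1, hz.2.2]
    rw [Ph_norm]
    have hg := gauss_le (e - ρ.im)
    calc _ ≤ exp (2 + (ρ.im - e)^2/4) * exp (-(1/2) * ((ρ.im - e)^2 + (t - e)^2)) := by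
          apply mul_le_mul (Real.exp_le_exp.2 (by linarith)) (Real.exp_le_exp.2 (by linarith)) (Real.exp_nonneg _) (Real.exp_nonneg _)
      _ = exp 2 * exp (-(e - ρ.im)^2/4) * exp (-(1/2) * (t - e)^2) := by
          simp only [← Real.exp_add]; congr 1; ring
      _ ≤ _ := by gcongr
  have hpt : ∀ ρ ∈ Z, (mu ρ : Real) * ‖Ph t u ρ‖ ≤ 4 * exp 2 * ((mu ρ : Real) / (1 + (T - ρ.im)^2) * exp (-(1/2) * (t - T)^2)
      + (mu ρ : Real) / (1 + (2*T - ρ.im)^2) * exp (-(1/2) * (t - 2*T)^2)) := by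
    intro ρ hρ
    have hcases : (ρ.im - T)^2 + (t - T)^2 ≤ (ρ.im - t)^2 ∨ (ρ.im - 2*T)^2 + (t - 2*T)^2 ≤ (ρ.im - t)^2 := by
      have := hZt ρ hρ
      by_cases ht : t ∈ Ioc T (2*T)
      · have h1 : ¬ (ρ.im ∈ Ioc T (2*T)) := fun h => (this.1 h) ht
        rw [mem_Ioc, not_and_or, not_lt, not_le] at h1
        rcases h1 with h1 | h1
        · left; nlinarith [ht.1, ht.2]
        · right; nlinarith [ht.1, ht.2]
      · have h1 := this.2 ht
        rw [mem_Ioc, not_and_or, not_lt, not_le] at ht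
        rcases ht with ht | ht
        · left; nlinarith [h1.1, h1.2]
        · right; nlinarith [h1.1, h1.2]
    have m0 : (0:Real) ≤ mu ρ := Nat.cast_nonneg _
    have p1 : 0 ≤ (mu ρ : Real) / (1 + (T - ρ.im)^2) * exp (-(1/2) * (t - T)^2) := by positivity
    have p2 : 0 ≤ (mu ρ : Real) / (1 + (2*T - ρ.im)^2) * exp (-(1/2) * (t - 2*T)^2) := by positivity
    have e2 := Real.exp_pos 2
    rcases hcases with h | h
    · have := mul_le_mul_of_nonneg_left (main ρ hρ T (Or.inl rfl) h) m0
      calc _ ≤ _ := this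
        _ = 4 * exp 2 * ((mu ρ : Real) / (1 + (T - ρ.im)^2) * exp (-(1/2) * (t - T)^2)) := by ring
        _ ≤ _ := by gcongr; linarith
    · have := mul_le_mul_of_nonneg_left (main ρ hρ (2*T) (Or.inr rfl) h) m0
      calc _ ≤ _ := this
        _ = 4 * exp 2 * ((mu ρ : Real) / (1 + (2*T - ρ.im)^2) * exp (-(1/2) * (t - 2*T)^2)) := by ring
        _ ≤ _ := by gcongr; linarith
  refine (Finset.sum_le_sum hpt).trans ?_
  rw [← Finset.mul_sum, Finset.sum_add_distrib, ← Finset.sum_mul, ← Finset.sum_mul]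
  have hl : ∀ e : Real, T ≤ e → e ≤ 2*T → log (2 + |e|) ≤ 8 * log T := by
    intro e h1 h2
    rw [abs_of_pos (by linarith)]
    have := Real.log_le_log (by linarith) (show 2 + e ≤ T^8 by
      calc 2 + e ≤ T * T := by nlinarith
        _ = T^2 := by ring
        _ ≤ T^8 := pow_le_pow_right₀ (by linarith) (by norm_num))
    rw [Real.log_pow] at this; exact_mod_cast this
  have c1 := (hcnt T Z hZ).trans (mul_le_mul_of_nonneg_left (hl T le_rfl (by linarith)) hC.le)
  have c2 := (hcnt (2*T) Z hZ).trans (mul_le_mul_of_nonneg_left (hl (2*T) (by linarith) le_rfl) hC.le)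
  calc _ ≤ 4 * exp 2 * (C * (8 * log T) * exp (-(1/2) * (t - T)^2) + C * (8 * log T) * exp (-(1/2) * (t - 2*T)^2)) := by gcongr
    _ = _ := by ring
noncomputable def Bd (T : Real) : Finset Complex := (Zn (2 * |T| + 3)).filter fun ρ => T < ρ.im ∧ ρ.im ≤ 2 * T
lemma mem_Bd {T : Real} {ρ : Complex} : ρ ∈ Bd T ↔ xi ρ = 0 ∧ T < ρ.im ∧ ρ.im ≤ 2 * T := by
  rw [Bd, Finset.mem_filter, mem_Zn]
  constructor
  · exact fun h => ⟨h.1.1, h.2⟩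
  · refine fun h => ⟨⟨h.1, ?_⟩, h.2⟩
    have hz := (xi_zero_iff _).1 h.1
    have h1 := Complex.norm_le_abs_re_add_abs_im (ρ - 1/2)
    have h2 : |(ρ - 1/2).re| ≤ 1 := by
      rw [abs_le]; simp; constructor <;> linarith [hz.2.1, hz.2.2]
    have h3 : |(ρ - 1/2).im| ≤ 2 * |T| := by
      simp
      rw [abs_le]; constructor <;> nlinarith [abs_nonneg T, le_abs_self T, neg_abs_le T]
    linarith
lemma mem_Bd' {T : Real} {ρ : Complex} : ρ ∈ Bd T ↔ ρ ∈ zeroBand T := by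
  rw [mem_Bd, xi_zero_iff]; rfl
noncomputable def Ab (T t u : Real) : Complex := ∑ ρ ∈ Bd T, (mu ρ : Complex) * Ph t u ρ
noncomputable def Dm (T t u : Real) : Complex := (g u * log T : Real) - Pf T t u
lemma approx {b : Real} (hb0 : 0 < b) (hb1 : b ≤ 1) (hbox : ∀ᶠ T in atTop, BoxAt b T) :
    ∃ C > 0, ∀ᶠ T in atTop, ∀ u : Real, 0 ≤ u → u ≤ log T → ∀ t : Real,
      ‖Ab T t u - (Ioc T (2*T)).indicator (fun t => Dm T t u) t‖ ≤ C * (Ioc T (2*T)).indicator (fun _ => 1) t +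
        C * log T * (exp (-(1/2) * (t - T)^2) + exp (-(1/2) * (t - 2*T)^2)) := by
  obtain ⟨C1, hC1, h1⟩ := EF2
  obtain ⟨C2, hC2, h2⟩ := edge hb0 hb1 hbox
  refine ⟨C1 + C2, by positivity, ?_⟩
  filter_upwards [h2, eventually_ge_atTop 4] with T h2 hT u hu huT t
  have L0 : 0 < log T := Real.log_pos (by linarith)
  set E := exp (-(1/2) * (t - T)^2) + exp (-(1/2) * (t - 2*T)^2) with hE
  have E0 : 0 ≤ E := by positivity
  have hsum : ∀ Z : Finset Complex, ‖∑ ρ ∈ Z, (mu ρ : Complex) * Ph t u ρ‖ ≤ ∑ ρ ∈ Z, (mu ρ : Real) * ‖Ph t u ρ‖ := by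
    intro Z
    refine (norm_sum_le _ _).trans (le_of_eq (Finset.sum_congr rfl fun ρ _ => ?_))
    rw [norm_mul, Complex.norm_natCast]
  by_cases ht : t ∈ Ioc T (2*T)
  · rw [indicator_of_mem ht, indicator_of_mem ht]
    obtain ⟨A, hA, hb⟩ := h1 T t u hT ht hu huT
    have h3 : ‖Ab T t u - A‖ ≤ C2 * log T * E := by
      have hA' : Tendsto (fun n : Nat => ‖Ab T t u - ∑ a ∈ Zn n, (mu a : Complex) * Ph t u a‖) atTop (𝓝 ‖Ab T t u - A‖) :=
        (hA.const_sub _).norm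
      refine le_of_tendsto hA' ?_
      filter_upwards [eventually_ge_atTop ⌈2 * |T| + 3⌉₊] with n hn
      have hn' : 2 * |T| + 3 ≤ n := Nat.ceil_le.1 hn
      have hsub : Bd T ⊆ Zn n := by
        intro ρ hρ
        have := mem_Zn.1 (Finset.mem_filter.1 hρ).1
        exact mem_Zn.2 ⟨this.1, this.2.trans_le hn'⟩
      rw [Ab, ← Finset.sum_sdiff hsub, norm_sub_rev, add_sub_cancel_right]
      refine (hsum _).trans (h2 u hu huT t _ ?_ ?_)
      · exact fun ρ hρ => (mem_Zn.1 (Finset.mem_sdiff.1 hρ).1).1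
      · intro ρ hρ
        have h := Finset.mem_sdiff.1 hρ
        refine ⟨fun h' => absurd (mem_Bd.2 ⟨(mem_Zn.1 h.1).1, h'⟩) h.2, fun h' => absurd ht h'⟩
    have h4 := norm_add_le (Ab T t u - A) (A - Dm T t u)
    rw [sub_add_sub_cancel] at h4
    have h5 : ‖A - Dm T t u‖ ≤ C1 := hb
    nlinarith [mul_nonneg (mul_nonneg hC1.le L0.le) E0]
  · rw [indicator_of_notMem ht, indicator_of_notMem ht, sub_zero, mul_zero, zero_add]
    have := (hsum (Bd T)).trans (h2 u hu huT t _ (fun ρ hρ => (mem_Bd.1 hρ).1) fun ρ hρ => ⟨fun _ => ht, fun _ => (mem_Bd.1 hρ).2⟩)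
    rw [Ab]
    nlinarith [mul_nonneg (mul_nonneg hC1.le L0.le) E0]
lemma Bd_refl (T : Real) (f : Complex → Complex) : ∑ ρ ∈ Bd T, f (1 - (starRingEnd Complex) ρ) = ∑ ρ ∈ Bd T, f ρ := by
  have hm : ∀ ρ ∈ Bd T, 1 - (starRingEnd Complex) ρ ∈ Bd T := by
    intro ρ hρ
    have h := mem_Bd.1 hρ
    refine mem_Bd.2 ⟨by rw [xi_one_sub, xi_conj, h.1, map_zero], ?_⟩
    simpa using h.2
  refine Finset.sum_nbij' (fun ρ => 1 - (starRingEnd Complex) ρ) (fun ρ => 1 - (starRingEnd Complex) ρ) hm hm ?_ ?_ ?_ <;> simp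
noncomputable def GG (T u : Real) : Complex := ∑ ρ ∈ Bd T, ∑ ρ' ∈ Bd T, (mu ρ : Complex) * (mu ρ' : Complex) * Complex.exp (u * (ρ - ρ') + (ρ - ρ')^2/4)
noncomputable def FF (T u : Real) : Real := ∫ t : Real, ‖Ab T t u‖^2
lemma conj_Ab (T t u : Real) : (starRingEnd Complex) (Ab T t u) = ∑ ρ ∈ Bd T, (mu ρ : Complex) * Gz (-u) (ρ - 1/2 - t * I) := by
  rw [← Bd_refl, Ab, map_sum]
  refine Finset.sum_congr rfl fun ρ _ => ?_
  rw [map_mul, mu_one_sub, mu_conj, Ph, Gz, Gz, ← Complex.exp_conj]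
  simp only [map_natCast, map_add, map_mul, map_div₀, map_pow, map_sub, Complex.conj_ofReal, map_one, Complex.conj_I, Complex.conj_ofNat]
  congr 2
  push_cast; ring
lemma pair_quad (u t : Real) (ρ ρ' : Complex) : Ph t u ρ * Gz (-u) (ρ' - 1/2 - t * I) =
    Complex.exp (-1 * t^2 + (-I * (ρ + ρ' - 1)) * t + (u * (ρ - ρ') + (ρ - 1/2)^2/2 + (ρ' - 1/2)^2/2)) := by
  rw [Ph, Gz, Gz, ← Complex.exp_add]
  congr 1
  push_cast
  ring_nf
  rw [Complex.I_sq]; ring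
lemma Ab_sq (T t u : Real) : ((‖Ab T t u‖^2 : Real) : Complex) = ∑ ρ ∈ Bd T, ∑ ρ' ∈ Bd T, (mu ρ : Complex) * (mu ρ' : Complex) *
    Complex.exp (-1 * t^2 + (-I * (ρ + ρ' - 1)) * t + (u * (ρ - ρ') + (ρ - 1/2)^2/2 + (ρ' - 1/2)^2/2)) := by
  push_cast
  rw [← Complex.mul_conj', conj_Ab, Ab, Finset.sum_mul_sum]
  refine Finset.sum_congr rfl fun ρ _ => Finset.sum_congr rfl fun ρ' _ => ?_
  rw [← pair_quad]; ring
lemma Ab_sq_int (T u : Real) : Integrable (fun t : Real => ‖Ab T t u‖^2) := by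
  have : Integrable (fun t : Real => ((‖Ab T t u‖^2 : Real) : Complex)) := by
    simp_rw [Ab_sq]
    refine integrable_finsetSum _ fun ρ _ => integrable_finsetSum _ fun ρ' _ => ?_
    exact (integrable_cexp_quadratic' (by norm_num) _ _).const_mul _
  exact this.re
lemma FF_eq (T u : Real) : (FF T u : Complex) = sqrt π * GG T u := by
  rw [FF, ← integral_complex_ofReal]
  simp_rw [Ab_sq]
  rw [integral_finsetSum _ fun ρ _ => integrable_finsetSum _ fun ρ' _ => (integrable_cexp_quadratic' (by norm_num) _ _).const_mul _,
    GG, Finset.mul_sum]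
  refine Finset.sum_congr rfl fun ρ _ => ?_
  rw [integral_finsetSum _ fun ρ' _ => (integrable_cexp_quadratic' (by norm_num) _ _).const_mul _, Finset.mul_sum]
  refine Finset.sum_congr rfl fun ρ' _ => ?_
  rw [integral_const_mul, integral_cexp_quadratic (by norm_num)]
  have e : ((π : Complex) / - -1) ^ (1/2 : Complex) = (sqrt π : Real) := by
    rw [neg_neg, div_one, Real.sqrt_eq_rpow, Complex.ofReal_cpow (by positivity)]; push_cast; rfl
  rw [e, show (u * (ρ - ρ') + (ρ - 1/2)^2/2 + (ρ' - 1/2)^2/2 - (-I * (ρ + ρ' - 1))^2/(4 * -1) : Complex) =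
    u * (ρ - ρ') + (ρ - ρ')^2/4 by
      rw [mul_pow, neg_sq, Complex.I_sq]; ring]
  ring
lemma GG_even (T u : Real) : GG T (-u) = GG T u := by
  rw [GG, Finset.sum_comm, GG]
  refine Finset.sum_congr rfl fun ρ _ => Finset.sum_congr rfl fun ρ' _ => ?_
  rw [mul_comm (mu ρ' : Complex)]
  congr 2; push_cast; ring
lemma FF_even (T u : Real) : FF T (-u) = FF T u := by
  have h1 := FF_eq T u
  have h2 := FF_eq T (-u)
  rw [GG_even, ← h1] at h2
  exact_mod_cast h2
lemma FF_cont (T : Real) : Continuous (FF T) := by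
  have : Continuous fun u => (FF T u : Complex) := by
    simp_rw [FF_eq, GG]
    fun_prop
  have h := Complex.continuous_re.comp this
  simpa [Function.comp_def] using h
noncomputable def kk (b α : Real) : Real := (1 - α) / cosh (b * α)
lemma jF_cont : Continuous jF := by unfold jF; fun_prop
lemma qcont (b : Real) : Continuous fun α => jF α / cosh (b * α) :=
  jF_cont.div (by fun_prop) fun α => (Real.cosh_pos _).ne'
lemma even_int (f : Real → Real) (hf : Continuous f) (he : ∀ x, f (-x) = f x) : ∫ x in (-1:Real)..1, f x = 2 * ∫ x in (0:Real)..1, f x := by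
  rw [← intervalIntegral.integral_add_adjacent_intervals (hf.intervalIntegrable _ 0) (hf.intervalIntegrable 0 _)]
  have := intervalIntegral.integral_comp_neg (a := 0) (b := 1) f
  simp only [he, neg_zero] at this
  rw [← this]; ring
lemma Sw_eq (b T : Real) : ∑ ρ ∈ Bd T, ∑ ρ' ∈ Bd T, (mu ρ : Real) * (mu ρ' : Real) *
      (Kb b (-I * (ρ - ρ') * log T) * Complex.exp ((ρ - ρ')^2/4)).re
    = 1 / (π * sqrt π) * ∫ α in (0:Real)..1, kk b α * FF T (α * log T) := by
  set L := log T
  have h1 : ∀ ρ ρ' : Complex, (mu ρ : Complex) * (mu ρ' : Complex) * (Kb b (-I * (ρ - ρ') * L) * Complex.exp ((ρ - ρ')^2/4)) =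
      1 / (2 * π) * ∫ α in (-1:Real)..1, ((jF α / cosh (b * α) : Real) : Complex) *
        ((mu ρ : Complex) * (mu ρ' : Complex) * Complex.exp ((α * L : Real) * (ρ - ρ') + (ρ - ρ')^2/4)) := by
    intro ρ ρ'
    rw [Kb, show (mu ρ : Complex) * (mu ρ' : Complex) * (1 / (2 * π) * (∫ α in (-1 : Real)..1,
      ((jF α / cosh (b * α) : Real) : Complex) * Complex.exp (I * (-I * (ρ - ρ') * L) * α)) * Complex.exp ((ρ - ρ')^2/4))
      = 1 / (2 * π) * ((∫ α in (-1 : Real)..1,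
      ((jF α / cosh (b * α) : Real) : Complex) * Complex.exp (I * (-I * (ρ - ρ') * L) * α)) * ((mu ρ : Complex) * (mu ρ' : Complex) * Complex.exp ((ρ - ρ')^2/4))) by ring,
      ← intervalIntegral.integral_mul_const]
    congr 2; ext α
    rw [show I * (-I * (ρ - ρ') * L) * α = (α * L : Real) * (ρ - ρ') by
      push_cast; linear_combination (-(ρ - ρ') * L * α) * Complex.I_mul_I, Complex.exp_add]
    ring
  have hcq := Complex.continuous_ofReal.comp (qcont b)
  have hci : ∀ ρ ρ' : Complex, IntervalIntegrable (fun α : Real => ((jF α / cosh (b * α) : Real) : Complex) *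
        ((mu ρ : Complex) * (mu ρ' : Complex) * Complex.exp ((α * L : Real) * (ρ - ρ') + (ρ - ρ')^2/4))) volume (-1) 1 := fun ρ ρ' =>
    Continuous.intervalIntegrable (hcq.mul (by fun_prop)) _ _
  have h2 : ∑ ρ ∈ Bd T, ∑ ρ' ∈ Bd T, (mu ρ : Complex) * (mu ρ' : Complex) * (Kb b (-I * (ρ - ρ') * L) * Complex.exp ((ρ - ρ')^2/4))
      = ((1 / (2 * π) * ∫ α in (-1:Real)..1, (jF α / cosh (b * α)) * (FF T (α * L) / sqrt π) : Real) : Complex) := by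
    simp_rw [h1, ← Finset.mul_sum]
    rw [Complex.ofReal_mul]
    congr 1
    · push_cast; rfl
    rw [← intervalIntegral.integral_ofReal]
    rw [Finset.sum_congr rfl fun ρ _ => (intervalIntegral.integral_finsetSum (s := Bd T) fun ρ' _ => hci ρ ρ').symm]
    rw [← intervalIntegral.integral_finsetSum]
    · congr 1; ext α
      push_cast
      rw [FF_eq, GG, mul_div_cancel_left₀ _ (by exact_mod_cast (Real.sqrt_pos.2 Real.pi_pos).ne')]
      simp_rw [Finset.mul_sum]
      push_cast; rfl
    · intro ρ _
      exact (IntervalIntegrable.sum (Bd T) fun ρ' _ => hci ρ ρ').congr (fun x _ => by simp)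
  have h3 := congrArg Complex.re h2
  rw [Complex.ofReal_re, Complex.re_sum] at h3
  have h4 : ∀ ρ ρ' : Complex, ((mu ρ : Complex) * (mu ρ' : Complex) * (Kb b (-I * (ρ - ρ') * L) * Complex.exp ((ρ - ρ')^2/4))).re =
     (mu ρ : Real) * (mu ρ' : Real) * (Kb b (-I * (ρ - ρ') * L) * Complex.exp ((ρ - ρ')^2/4)).re := by
    intro ρ ρ'
    rw [← Nat.cast_mul, ← Nat.cast_mul, ← Complex.ofReal_natCast, Complex.re_ofReal_mul]
  simp_rw [Complex.re_sum, h4] at h3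
  rw [h3, even_int (fun α => jF α / cosh (b*α) * (FF T (α*L)/sqrt π)) ((qcont b).mul (((FF_cont T).comp (by fun_prop)).div_const _)) (fun x => by
    simp only [jF, abs_neg, mul_neg, Real.cosh_neg, neg_mul, FF_even])]
  have e : ∫ α in (0:Real)..1, (jF α / cosh (b * α)) * (FF T (α * L) / sqrt π) =
      (∫ α in (0:Real)..1, kk b α * FF T (α * L)) / sqrt π := by
    rw [← intervalIntegral.integral_div]
    refine intervalIntegral.integral_congr fun α hα => ?_
    rw [uIcc_of_le zero_le_one] at hα
    simp only [jF, kk]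
    rw [abs_of_nonneg hα.1, max_eq_left (by linarith [hα.2])]
    ring
  rw [e]
  generalize (∫ α in (0:Real)..1, kk b α * FF T (α * L)) = J
  have := Real.pi_pos
  field_simp
noncomputable def Jc (b : Real) (c : Complex) : Complex := ∫ α in (0:Real)..1, (kk b α : Complex) * Complex.exp (c * α)
lemma kk_smooth (b : Real) : ContDiff Real (⊤ : ℕ∞) (kk b) := by
  unfold kk
  exact ContDiff.div (by fun_prop) (by fun_prop) fun α => (Real.cosh_pos _).ne'
lemma kk_cont (b : Real) : Continuous (kk b) := (kk_smooth b).continuous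
lemma exp_mul_bd (c : Complex) (hc : |c.re| ≤ 1) (α : Real) (h0 : 0 ≤ α) (h1 : α ≤ 1) : ‖Complex.exp (c * α)‖ ≤ exp 1 := by
  rw [Complex.norm_exp, Complex.re_mul_ofReal]
  apply Real.exp_le_exp.2
  calc c.re * α ≤ |c.re| * α := by gcongr; exact le_abs_self _
    _ ≤ 1 * 1 := by gcongr
    _ = 1 := by ring
lemma Jc_bd (b : Real) : ∃ C > 0, ∀ c : Complex, |c.re| ≤ 1 → ‖c^2 * Jc b c + c * kk b 0‖ ≤ C := by
  have s1 : ContDiff Real (⊤ : ℕ∞) (deriv (kk b)) := by simpa using (kk_smooth b).iterate_deriv 1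
  have s2 : ContDiff Real (⊤ : ℕ∞) (deriv (deriv (kk b))) := by simpa using (kk_smooth b).iterate_deriv 2
  obtain ⟨M, hM⟩ := (isCompact_Icc (a := (0:Real)) (b := 1)).exists_bound_of_continuousOn s2.continuous.continuousOn
  have hM0 : 0 ≤ M := (norm_nonneg _).trans (hM 0 (by simp))
  refine ⟨exp 1 * |deriv (kk b) 1| + |deriv (kk b) 0| + M * exp 1 + 1, by positivity, fun c hc => ?_⟩
  have hd : ∀ x ∈ uIcc (0:Real) 1, HasDerivAt (fun α : Real => (c * kk b α - (deriv (kk b) α : Real)) * Complex.exp (c * α))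
      (c^2 * ((kk b x : Complex) * Complex.exp (c * x)) - ((deriv (deriv (kk b)) x : Real) : Complex) * Complex.exp (c * x)) x := by
    intro x _
    have a1 := ((kk_smooth b).differentiable (by simp) x).hasDerivAt.ofReal_comp
    have a2 := (s1.differentiable (by simp) x).hasDerivAt.ofReal_comp
    have a3 : HasDerivAt (fun α : Real => Complex.exp (c * α)) (Complex.exp (c * x) * (c * 1)) x :=
      ((hasDerivAt_id x).ofReal_comp.const_mul c).cexp
    exact (((a1.const_mul c).sub a2).mul a3).congr_deriv (by simp only [Pi.sub_apply]; ring)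
  have hc1 : Continuous fun x : Real => (kk b x : Complex) * Complex.exp (c * x) :=
    (Complex.continuous_ofReal.comp (kk_cont b)).mul (by fun_prop)
  have hc2 : Continuous fun x : Real => ((deriv (deriv (kk b)) x : Real) : Complex) * Complex.exp (c * x) :=
    (Complex.continuous_ofReal.comp s2.continuous).mul (by fun_prop)
  have h := intervalIntegral.integral_eq_sub_of_hasDerivAt hd (((hc1.const_mul _).sub hc2).intervalIntegrable _ _)
  rw [intervalIntegral.integral_sub ((hc1.const_mul _).intervalIntegrable _ _) (hc2.intervalIntegrable _ _),
    intervalIntegral.integral_const_mul] at h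
  have k1 : kk b 1 = 0 := by simp [kk]
  have e : c^2 * Jc b c + c * kk b 0 = - (Complex.exp (c * (1:Real)) * (deriv (kk b) 1 : Real)) + (deriv (kk b) 0 : Real) +
      ∫ x in (0:Real)..1, ((deriv (deriv (kk b)) x : Real) : Complex) * Complex.exp (c * x) := by
    rw [Jc]
    simp only [k1, Complex.ofReal_zero, mul_zero, Complex.exp_zero] at h
    linear_combination h
  rw [e]
  have b3 : ‖∫ x in (0:Real)..1, ((deriv (deriv (kk b)) x : Real) : Complex) * Complex.exp (c * x)‖ ≤ M * exp 1 := by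
    have := intervalIntegral.norm_integral_le_of_norm_le_const (a := 0) (b := 1) (C := M * exp 1)
      (f := fun x : Real => ((deriv (deriv (kk b)) x : Real) : Complex) * Complex.exp (c * x)) fun x hx => by
        rw [uIoc_of_le zero_le_one] at hx
        rw [norm_mul, Complex.norm_real]
        exact mul_le_mul (hM x ⟨hx.1.le, hx.2⟩) (exp_mul_bd c hc x hx.1.le hx.2) (norm_nonneg _) hM0
    simpa using this
  have b1 : ‖-(Complex.exp (c * (1:Real)) * (deriv (kk b) 1 : Real))‖ ≤ exp 1 * |deriv (kk b) 1| := by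
    rw [norm_neg, norm_mul, Complex.norm_real, Real.norm_eq_abs]
    exact mul_le_mul_of_nonneg_right (exp_mul_bd c hc 1 zero_le_one le_rfl) (abs_nonneg _)
  have b2 : ‖((deriv (kk b) 0 : Real) : Complex)‖ = |deriv (kk b) 0| := by rw [Complex.norm_real, Real.norm_eq_abs]
  linarith [norm_add₃_le (a := -(Complex.exp (c * (1:Real)) * (deriv (kk b) 1 : Real))) (b := ((deriv (kk b) 0 : Real) : Complex)) (c := ∫ x in (0:Real)..1, ((deriv (deriv (kk b)) x : Real) : Complex) * Complex.exp (c * x))]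
lemma Kb_eq (b : Real) (z : Complex) : Kb b z = 1 / (2 * π) * (Jc b (I * z) + Jc b (-(I * z))) := by
  have hc : ∀ c : Complex, Continuous fun α : Real => ((jF α / cosh (b * α) : Real) : Complex) * Complex.exp (c * α) :=
    fun c => (Complex.continuous_ofReal.comp (qcont b)).mul (by fun_prop)
  have h : ∀ c, ∫ α in (0:Real)..1, ((jF α / cosh (b * α) : Real) : Complex) * Complex.exp (c * α) = Jc b c := by
    intro c
    refine intervalIntegral.integral_congr fun α hα => ?_
    rw [uIcc_of_le zero_le_one] at hα
    simp only [jF, kk]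
    rw [abs_of_nonneg hα.1, max_eq_left (by linarith [hα.2])]
  rw [Kb, ← intervalIntegral.integral_add_adjacent_intervals ((hc _).intervalIntegrable (-1) 0) ((hc _).intervalIntegrable 0 1), h]
  have := intervalIntegral.integral_comp_neg (a := 0) (b := 1) fun α : Real => ((jF α / cosh (b * α) : Real) : Complex) * Complex.exp (I * z * α)
  rw [neg_zero] at this
  rw [← this, add_comm, ← h (-(I * z))]
  simp only [jF, abs_neg, mul_neg, Real.cosh_neg, Complex.ofReal_neg, neg_mul]
lemma Kb_bd (b : Real) : ∃ C > 0, ∀ z : Complex, |z.im| ≤ 1 → ‖Kb b z‖ * ‖z‖^2 ≤ C := by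
  obtain ⟨C, hC, h⟩ := Jc_bd b
  refine ⟨2 * C, by positivity, fun z hz => ?_⟩
  have h1 := h (I * z) (by simpa using hz)
  have h2 := h (-(I * z)) (by simpa using hz)
  have e : Kb b z * z^2 = -(1 / (2 * π)) * (((I * z)^2 * Jc b (I * z) + (I * z) * kk b 0) +
    ((-(I * z))^2 * Jc b (-(I * z)) + (-(I * z)) * kk b 0)) := by
    rw [Kb_eq]
    linear_combination (-(1 / (2 * π : Complex)) * z^2 * (-Jc b (I * z) - Jc b (-(I * z)))) * Complex.I_sq
  rw [← norm_pow, ← norm_mul, e, norm_mul]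
  have : ‖-(1 / (2 * π) : Complex)‖ ≤ 1 := by
    rw [norm_neg, norm_div, norm_one, norm_mul, Complex.norm_real, Complex.norm_ofNat, Real.norm_eq_abs, abs_of_pos Real.pi_pos,
      div_le_one (by positivity)]
    linarith [Real.pi_gt_three]
  calc _ ≤ 1 * (C + C) := mul_le_mul this ((norm_add_le _ _).trans (add_le_add h1 h2)) (norm_nonneg _) zero_le_one
    _ = 2 * C := by ring
lemma w_bd (d : Complex) (hd : |d.re| ≤ 1) : ‖1 - Complex.exp (d^2/4)‖ * (1 + d.im^2) ≤ 8 * ‖d‖^2 := by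
  have hn : ‖d‖^2 = d.re^2 + d.im^2 := by rw [Complex.sq_norm, Complex.normSq_apply]; ring
  have hr : d.re^2 ≤ 1 := by rw [← sq_abs]; nlinarith [abs_nonneg d.re]
  rcases le_total ‖d‖ 1 with h | h
  · have h4 : ‖d^2/4‖ = ‖d‖^2/4 := by rw [norm_div, norm_pow, Complex.norm_ofNat]
    have h2 : ‖d‖^2 ≤ 1 := by nlinarith [norm_nonneg d]
    have h5 : ‖1 - Complex.exp (d^2/4)‖ ≤ 2 * (‖d‖^2/4) := by
      rw [norm_sub_rev, ← h4]
      exact Complex.norm_exp_sub_one_le (by rw [h4]; linarith)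
    nlinarith [sq_nonneg d.re, sq_nonneg d.im, norm_nonneg (1 - Complex.exp (d^2/4))]
  · have h5 : ‖1 - Complex.exp (d^2/4)‖ ≤ 4 := by
      refine (norm_sub_le _ _).trans ?_
      rw [norm_one, Complex.norm_exp]
      have : (d^2/4).re ≤ 1 := by
        have e4 : (d^2/4).re = (d.re^2 - d.im^2)/4 := by
          rw [show d^2/4 = d*d/((4:Real):Complex) by push_cast; ring, Complex.div_ofReal_re, Complex.mul_re]; ring
        rw [e4]
        nlinarith [sq_nonneg d.im]
      linarith [Real.exp_le_exp.2 this, Real.exp_one_lt_d9]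
    have h2 : 1 ≤ ‖d‖^2 := by nlinarith [norm_nonneg d]
    nlinarith [sq_nonneg d.re, sq_nonneg d.im, norm_nonneg (1 - Complex.exp (d^2/4))]
lemma band_cnt : ∃ C > 0, ∀ᶠ T in atTop, ∑ ρ ∈ Bd T, (mu ρ : Real) ≤ C * T * log T := by
  obtain ⟨C, hC, h⟩ := cnt
  refine ⟨2 * C * 2 * 3, by positivity, ?_⟩
  filter_upwards [eventually_ge_atTop 2] with T hT
  have hl : log (2 + 2*T) ≤ 3 * log T := by
    rw [← Real.log_rpow (by linarith)]
    apply Real.log_le_log (by linarith)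
    norm_num
    nlinarith [mul_self_nonneg (T-2), mul_nonneg (show (0:Real) ≤ T by linarith) (sq_nonneg (T-2))]
  have hl0 : 0 ≤ log T := Real.log_nonneg (by linarith)
  have key : ∀ ρ ∈ Bd T, (mu ρ : Real) ≤ ∑ j ∈ Finset.range (⌊T⌋₊ + 1), 2 * ((mu ρ : Real) / (1 + ((T + j) - ρ.im)^2)) := by
    intro ρ hρ
    obtain ⟨-, h1, h2⟩ := mem_Bd.1 hρ
    have f0 : 0 ≤ ρ.im - T := by linarith
    have f1 := Nat.floor_le f0
    have f2 := Nat.lt_floor_add_one (ρ.im - T)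
    have hj : ⌊ρ.im - T⌋₊ ∈ Finset.range (⌊T⌋₊ + 1) := by
      rw [Finset.mem_range, Nat.lt_succ_iff]
      exact Nat.floor_mono (by linarith)
    refine le_trans ?_ (Finset.single_le_sum (f := fun j : Nat => 2 * ((mu ρ : Real) / (1 + ((T + j) - ρ.im)^2))) (fun j _ => by positivity) hj)
    rw [← mul_div_assoc, le_div_iff₀ (by positivity)]
    have : ((T + ⌊ρ.im - T⌋₊) - ρ.im)^2 ≤ 1 := by nlinarith
    nlinarith [(Nat.cast_nonneg (mu ρ) : (0:Real) ≤ _)]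
  refine (Finset.sum_le_sum key).trans ?_
  rw [Finset.sum_comm]
  have : ∀ j ∈ Finset.range (⌊T⌋₊ + 1), ∑ ρ ∈ Bd T, 2 * ((mu ρ : Real) / (1 + ((T + j) - ρ.im)^2)) ≤ 2 * (C * (3 * log T)) := by
    intro j hj
    rw [← Finset.mul_sum]
    refine mul_le_mul_of_nonneg_left ((h (T + j) (Bd T) fun ρ hρ => (mem_Bd.1 hρ).1).trans ?_) zero_le_two
    refine mul_le_mul_of_nonneg_left (le_trans ?_ hl) hC.le
    have : (j:Real) ≤ T := (Nat.le_floor_iff (by linarith)).1 (by simpa [Nat.lt_succ_iff] using hj)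
    rw [abs_of_nonneg (by positivity)]
    exact Real.log_le_log (by positivity) (by linarith)
  refine (Finset.sum_le_sum this).trans ?_
  rw [Finset.sum_const, Finset.card_range, nsmul_eq_mul]
  have f1 : (⌊T⌋₊ : Real) ≤ T := Nat.floor_le (by linarith)
  push_cast
  calc ((⌊T⌋₊:Real) + 1) * (2 * (C * (3 * log T))) ≤ (2 * T) * (2 * (C * (3 * log T))) :=
        mul_le_mul_of_nonneg_right (by linarith) (by positivity)
    _ = _ := by ring
lemma S1 {b : Real} (hb1 : b ≤ 1) (hbox : ∀ᶠ T in atTop, BoxAt b T) :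
    ∃ C > 0, ∀ᶠ T in atTop, |(∑ ρ ∈ Bd T, ∑ ρ' ∈ Bd T, (mu ρ : Real) * (mu ρ' : Real) *
      (Kb b (-I * (ρ - ρ') * log T)).re) - ∑ ρ ∈ Bd T, ∑ ρ' ∈ Bd T, (mu ρ : Real) * (mu ρ' : Real) *
      (Kb b (-I * (ρ - ρ') * log T) * Complex.exp ((ρ - ρ')^2/4)).re| ≤ C * T := by
  obtain ⟨C, hC, h⟩ := cnt
  obtain ⟨C1, hC1, h1⟩ := band_cnt
  obtain ⟨C2, hC2, h2⟩ := Kb_bd b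
  refine ⟨8 * C2 * (C * 3) * C1, by positivity, ?_⟩
  filter_upwards [eventually_ge_atTop 3, h1, hbox] with T hT h1 hbox
  have hL : 1 ≤ log T := by
    rw [Real.le_log_iff_exp_le (by linarith)]
    linarith [Real.exp_one_lt_d9]
  set L := log T
  have hl : log (2 + 2*T) ≤ 3 * L := by
    rw [← Real.log_rpow (by linarith)]
    apply Real.log_le_log (by linarith)
    norm_num
    nlinarith [mul_self_nonneg (T-2), mul_nonneg (show (0:Real) ≤ T by linarith) (sq_nonneg (T-2))]
  rw [← Finset.sum_sub_distrib]
  simp_rw [← Finset.sum_sub_distrib]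
  have tb : ∀ ρ ∈ Bd T, ∀ ρ' ∈ Bd T, |(mu ρ : Real) * (mu ρ' : Real) * (Kb b (-I * (ρ - ρ') * L)).re -
      (mu ρ : Real) * (mu ρ' : Real) * (Kb b (-I * (ρ - ρ') * L) * Complex.exp ((ρ - ρ')^2/4)).re| ≤
      (mu ρ : Real) * (8 * C2 / L^2) * ((mu ρ' : Real) / (1 + (ρ.im - ρ'.im)^2)) := by
    intro ρ hρ ρ' hρ'
    have hd : |(ρ - ρ').re| * L ≤ b := by
      have a1 := hbox ρ (mem_Bd'.1 hρ)
      have a2 := hbox ρ' (mem_Bd'.1 hρ')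
      have : |(ρ - ρ').re| ≤ b / L := by
        rw [Complex.sub_re, show b / L = b/(2*L) + b/(2*L) by field_simp; ring]
        rw [show ρ.re - ρ'.re = (ρ.re - 1/2) - (ρ'.re - 1/2) by ring]
        exact (abs_sub _ _).trans (by linarith)
      rwa [← le_div_iff₀ (by linarith)]
    have hd1 : |(ρ - ρ').re| ≤ 1 := by nlinarith [abs_nonneg (ρ - ρ').re]
    have hz : |(-I * (ρ - ρ') * L).im| ≤ 1 := by
      rw [show (-I * (ρ - ρ') * L).im = -((ρ - ρ').re * L) by simp, abs_neg, abs_mul, abs_of_pos (by linarith : 0 < L)]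
      linarith
    have k1 := h2 _ hz
    have k2 := w_bd _ hd1
    have hzn : ‖-I * (ρ - ρ') * L‖ = ‖ρ - ρ'‖ * L := by
      rw [norm_mul, norm_mul, norm_neg, Complex.norm_I, Complex.norm_real, Real.norm_eq_abs, abs_of_pos (by linarith : 0 < L), one_mul]
    rw [hzn] at k1
    rw [Complex.sub_im] at k2
    set K := Kb b (-I * (ρ - ρ') * L)
    set W := Complex.exp ((ρ - ρ')^2/4)
    have e : (mu ρ : Real) * (mu ρ' : Real) * K.re - (mu ρ : Real) * (mu ρ' : Real) * (K * W).re = (mu ρ : Real) * (mu ρ' : Real) * (K * (1 - W)).re := by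
      rw [mul_sub, mul_one, Complex.sub_re]; ring
    rw [e, abs_mul, abs_of_nonneg (by positivity : (0:Real) ≤ mu ρ * mu ρ')]
    have k3 : |(K * (1 - W)).re| ≤ 8 * C2 / L^2 / (1 + (ρ.im - ρ'.im)^2) := by
      refine (Complex.abs_re_le_norm _).trans ?_
      rw [le_div_iff₀ (by positivity), le_div_iff₀ (by positivity), norm_mul]
      calc ‖K‖ * ‖1 - W‖ * (1 + (ρ.im - ρ'.im)^2) * L^2 = ‖K‖ * L^2 * (‖1 - W‖ * (1 + (ρ.im - ρ'.im)^2)) := by ring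
        _ ≤ ‖K‖ * L^2 * (8 * ‖ρ - ρ'‖^2) := mul_le_mul_of_nonneg_left k2 (by positivity)
        _ = 8 * (‖K‖ * (‖ρ - ρ'‖ * L)^2) := by ring
        _ ≤ 8 * C2 := by linarith
    calc _ ≤ (mu ρ : Real) * (mu ρ' : Real) * (8 * C2 / L^2 / (1 + (ρ.im - ρ'.im)^2)) := mul_le_mul_of_nonneg_left k3 (by positivity)
      _ = _ := by ring
  refine (Finset.abs_sum_le_sum_abs _ _).trans ((Finset.sum_le_sum fun ρ hρ => (Finset.abs_sum_le_sum_abs _ _).trans (Finset.sum_le_sum (tb ρ hρ))).trans ?_)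
  have : ∀ ρ ∈ Bd T, ∑ ρ' ∈ Bd T, (mu ρ : Real) * (8 * C2 / L^2) * ((mu ρ' : Real) / (1 + (ρ.im - ρ'.im)^2)) ≤ (mu ρ : Real) * (8 * C2 / L^2) * (C * (3 * L)) := by
    intro ρ hρ
    rw [← Finset.mul_sum]
    refine mul_le_mul_of_nonneg_left ((h ρ.im (Bd T) fun ρ hρ => (mem_Bd.1 hρ).1).trans ?_) (by positivity)
    refine mul_le_mul_of_nonneg_left (le_trans ?_ hl) hC.le
    obtain ⟨-, i1, i2⟩ := mem_Bd.1 hρ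
    rw [abs_of_nonneg (by linarith)]
    exact Real.log_le_log (by linarith) (by linarith)
  refine (Finset.sum_le_sum this).trans ?_
  simp_rw [← Finset.sum_mul]
  calc _ ≤ (C1 * T * L) * (8 * C2 / L^2) * (C * (3 * L)) := by gcongr
    _ = _ := by field_simp
lemma abel_le (c G φ : Nat → Real) (hS : ∀ n, ∑ i ∈ Finset.range n, c i ≤ G n) (hφ : Antitone φ) (hφ0 : ∀ n, 0 ≤ φ n) (n : Nat) :
    ∑ i ∈ Finset.range n, c i * φ i ≤ G 0 * φ 0 + ∑ i ∈ Finset.range n, (G (i+1) - G i) * φ i := by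
  have key : ∀ n, ∑ i ∈ Finset.range n, c i * φ i + (G n - ∑ i ∈ Finset.range n, c i) * φ n ≤
      G 0 * φ 0 + ∑ i ∈ Finset.range n, (G (i+1) - G i) * φ i := by
    intro n
    induction n with
    | zero => simp
    | succ n ih =>
      have h1 := hS (n+1)
      have h2 := hφ (Nat.le_succ n)
      rw [Finset.sum_range_succ] at h1 ⊢
      rw [Finset.sum_range_succ (fun i => (G (i+1) - G i) * φ i), Finset.sum_range_succ c]
      have h3 := mul_nonneg (sub_nonneg.2 h1) (sub_nonneg.2 h2)
      nlinarith
  have := mul_nonneg (sub_nonneg.2 (hS n)) (hφ0 n)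
  linarith [key n]
lemma psi_range (n : Nat) : ∑ i ∈ Finset.range (n+1), vL i = Chebyshev.psi n := by
  rw [Chebyshev.psi_eq_sum_Icc, Nat.floor_natCast]
  congr 1; ext i; simp [Nat.lt_succ_iff]
lemma psi_range_le (n : Nat) : ∑ i ∈ Finset.range n, vL i ≤ 6 * n := by
  rcases n with _ | n
  · simp
  rw [psi_range]
  have h := Chebyshev.psi_le_const_mul_self (x := n) (by positivity)
  have h4 : log 4 ≤ 2 := by
    rw [show (4:Real) = 2^2 by norm_num, Real.log_pow]; push_cast; linarith [Real.log_two_lt_d9]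
  push_cast
  nlinarith [(Nat.cast_nonneg n : (0:Real) ≤ n)]
lemma esum {x : Real} (hx : 1 ≤ x) (N : Nat) : ∑ n ∈ Finset.range N, vL n * (x^2 / (n + x)^2) ≤ 12 * x := by
  refine (abel_le vL (fun n => 6 * n) (fun n => x^2 / (n + x)^2) psi_range_le (fun m n h => ?_) (fun n => by positivity) N).trans ?_
  · have : (m:Real) ≤ n := by exact_mod_cast h
    simp only
    gcongr
  have : ∀ N : Nat, ∑ n ∈ Finset.range N, x^2 / (n + x)^2 ≤ 2 * x - x^2 / (N + x - 1/2) := by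
    intro N
    induction N with
    | zero =>
      have : x^2 / (x - 1/2) ≤ 2 * x := by rw [div_le_iff₀ (by linarith)]; nlinarith
      simp only [Finset.range_zero, Finset.sum_empty, Nat.cast_zero, zero_add]; linarith
    | succ N ih =>
      rw [Finset.sum_range_succ]
      have hN : (0:Real) ≤ N := Nat.cast_nonneg N
      have h1 : x^2 / (N + x)^2 ≤ x^2 / (N + x - 1/2) - x^2 / ((N + 1 : Nat) + x - 1/2) := by
        push_cast
        have p1 : 0 < N + x - 1/2 := by linarith
        have p2 : 0 < N + 1 + x - 1/2 := by linarith
        rw [div_sub_div _ _ p1.ne' p2.ne', div_le_div_iff₀ (by positivity) (by positivity)]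
        nlinarith [sq_nonneg x]
      linarith
  have h := this N
  have h2 : 0 ≤ x^2 / (N + x - 1/2) := div_nonneg (by positivity) (by linarith [(Nat.cast_nonneg N : (0:Real) ≤ N)])
  push_cast
  simp only [mul_zero, zero_mul, zero_add]
  rw [Finset.sum_congr rfl (fun (i : Nat) _ => show (6 * ((i:Real)+1) - 6 * i) * (x^2 / (i + x)^2) = 6 * (x^2 / (i + x)^2) by ring), ← Finset.mul_sum]
  linarith
lemma log_fact (n : Nat) : ∑ i ∈ Finset.Ioc 0 n, vL i * (n / i : Nat) = log (n.factorial) := by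
  rw [← ArithmeticFunction.sum_Ioc_mul_zeta_eq_sum, ArithmeticFunction.vonMangoldt_mul_zeta]
  induction n with
  | zero => simp
  | succ n ih =>
    rw [Finset.sum_Ioc_succ_top (Nat.zero_le n), ih, Nat.factorial_succ]
    push_cast
    rw [mul_comm, Real.log_mul (by positivity) (by positivity)]
    simp [ArithmeticFunction.log_apply]
lemma mertens (n : Nat) : |∑ i ∈ Finset.range n, vL i / i - log n| ≤ 8 := by
  rcases n with _ | n
  · simp
  rcases Nat.eq_zero_or_pos n with rfl | hn
  · simp
  have hn0 : (0:Real) < n := by exact_mod_cast hn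
  have e : ∑ i ∈ Finset.range (n+1), vL i / i = ∑ i ∈ Finset.Ioc 0 n, vL i / i := by
    rw [Finset.range_eq_Ico, Finset.sum_eq_sum_Ico_succ_bot (by omega)]
    simp only [Nat.cast_zero, div_zero, zero_add]
    rfl
  have hp : ∑ i ∈ Finset.Ioc 0 n, vL i ≤ 6 * n := by
    have h := psi_range_le (n+1)
    have h := Chebyshev.psi_le_const_mul_self (x := n) (by positivity)
    rw [Chebyshev.psi, Nat.floor_natCast] at h
    have h4 : log 4 ≤ 2 := by
      rw [show (4:Real) = 2^2 by norm_num, Real.log_pow]; push_cast; linarith [Real.log_two_lt_d9]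
    exact h.trans (by nlinarith)
  have lf := log_fact n
  have u1 : ∑ i ∈ Finset.Ioc 0 n, vL i * (n / i : Nat) ≤ n * ∑ i ∈ Finset.Ioc 0 n, vL i / i := by
    rw [Finset.mul_sum]
    refine Finset.sum_le_sum fun i _ => ?_
    rw [show (n:Real) * (vL i / i) = vL i * (n / i) by ring]
    exact mul_le_mul_of_nonneg_left Nat.cast_div_le (vL_nonneg i)
  have u2 : n * ∑ i ∈ Finset.Ioc 0 n, vL i / i - ∑ i ∈ Finset.Ioc 0 n, vL i ≤ ∑ i ∈ Finset.Ioc 0 n, vL i * (n / i : Nat) := by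
    rw [Finset.mul_sum, ← Finset.sum_sub_distrib]
    refine Finset.sum_le_sum fun i _ => ?_
    rw [show (n:Real) * (vL i / i) - vL i = vL i * (n / i - 1) by ring]
    refine mul_le_mul_of_nonneg_left ?_ (vL_nonneg i)
    have := Nat.lt_floor_add_one ((n:Real)/i)
    rw [Nat.floor_div_eq_div] at this
    linarith
  have s1 : n * log n - n ≤ log n.factorial := by
    have := Stirling.le_log_factorial_stirling hn.ne'
    have l1 : 0 ≤ log n := Real.log_nonneg (by exact_mod_cast hn)
    have l2 : 0 ≤ log (2 * π) := Real.log_nonneg (by linarith [Real.pi_gt_three])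
    linarith
  have s2 : log n.factorial ≤ n * log n := by
    rw [← Real.log_pow]
    exact Real.log_le_log (by positivity) (by exact_mod_cast Nat.factorial_le_pow n)
  have l0 : log n ≤ log (n+1) := Real.log_le_log hn0 (by linarith)
  have l1 : log (n+1) ≤ log n + 1 := by
    have : (n:Real) + 1 = n * (1 + 1/n) := by field_simp
    rw [this, Real.log_mul hn0.ne' (by positivity)]
    have h1 : (1:Real)/n ≤ 1 := by rw [div_le_one hn0]; exact_mod_cast hn
    linarith [Real.log_le_sub_one_of_pos (x := 1 + 1/(n:Real)) (by positivity)]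
  rw [e]
  set M := ∑ i ∈ Finset.Ioc 0 n, vL i / i
  push_cast
  have a1 : log n - 1 ≤ M := by nlinarith
  have a2 : M ≤ log n + 6 := by nlinarith
  rw [abs_le]; constructor <;> linarith
lemma nonprime : ∃ C > 0, ∀ N : Nat, ∑ n ∈ Finset.range N, vL n * (log n - vL n) / n ≤ C := by
  obtain ⟨C, hC⟩ := Chebyshev.psi_sub_theta_le_mul_sqrt
  have hs : Summable fun i : Nat => ((i:Real)+1)^(-(5/4:Real)) := by
    have := (Real.summable_nat_rpow (p := -(5/4:Real))).2 (by norm_num)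
    exact_mod_cast (summable_nat_add_iff 1).2 this
  refine ⟨8 * (|C| * ∑' i : Nat, ((i:Real)+1)^(-(5/4:Real))) + 1, by positivity, fun N => ?_⟩
  have hS : ∀ n, ∑ i ∈ Finset.range n, (if i.Prime then 0 else vL i) ≤ |C| * sqrt n := by
    intro n
    rcases n with _ | n
    · simp
    have h := hC n
    rw [Chebyshev.psi_sub_theta_eq_sum_not_prime, Nat.floor_natCast, Finset.sum_filter] at h
    have e : ∑ i ∈ Finset.range (n+1), (if i.Prime then 0 else vL i) = ∑ i ∈ Finset.Ioc 0 n, if ¬ i.Prime then vL i else 0 := by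
      rw [Finset.range_eq_Ico, Finset.sum_eq_sum_Ico_succ_bot (by omega)]
      simp only [ite_not, vL, ArithmeticFunction.map_zero, ite_self, zero_add]
      rfl
    rw [e]
    refine h.trans ?_
    push_cast
    exact mul_le_mul (le_abs_self _) (Real.sqrt_le_sqrt (by linarith)) (Real.sqrt_nonneg _) (abs_nonneg _)
  have h := abel_le (fun i => if i.Prime then 0 else vL i) (fun n => |C| * sqrt n) (fun i => ((i:Real)+1)^(-(3/4:Real))) hS
    (fun m n hmn => by
      have : (m:Real) ≤ n := by exact_mod_cast hmn
      exact Real.rpow_le_rpow_of_nonpos (by positivity) (by linarith) (by norm_num)) (fun n => by positivity) N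
  have h2 : ∑ i ∈ Finset.range N, (|C| * sqrt (i+1:Nat) - |C| * sqrt i) * ((i:Real)+1)^(-(3/4:Real)) ≤ |C| * ∑' i : Nat, ((i:Real)+1)^(-(5/4:Real)) := by
    have : ∀ i ∈ Finset.range N, (|C| * sqrt (i+1:Nat) - |C| * sqrt i) * ((i:Real)+1)^(-(3/4:Real)) ≤ |C| * ((i:Real)+1)^(-(5/4:Real)) := by
      intro i _
      have hi : (0:Real) < i + 1 := by positivity
      rw [← mul_sub, mul_assoc]
      refine mul_le_mul_of_nonneg_left ?_ (abs_nonneg _)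
      rw [show -(5/4:Real) = -(1/2) + -(3/4) by norm_num, Real.rpow_add hi]
      refine mul_le_mul_of_nonneg_right ?_ (by positivity)
      rw [Real.rpow_neg hi.le, ← Real.sqrt_eq_rpow]
      push_cast
      have a := Real.sqrt_nonneg (i:Real)
      have b := Real.sqrt_pos.2 hi
      have a2 := Real.sq_sqrt (Nat.cast_nonneg i : (0:Real) ≤ i)
      have b2 := Real.sq_sqrt hi.le
      have ab : sqrt i ≤ sqrt (i+1) := Real.sqrt_le_sqrt (by linarith)
      rw [← one_div, le_div_iff₀ b]
      nlinarith
    refine (Finset.sum_le_sum this).trans ?_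
    rw [← Finset.mul_sum]
    exact mul_le_mul_of_nonneg_left (hs.sum_le_tsum _ fun i _ => by positivity) (abs_nonneg _)
  have h3 : ∑ n ∈ Finset.range N, vL n * (log n - vL n) / n ≤ ∑ i ∈ Finset.range N, 8 * ((if i.Prime then 0 else vL i) * ((i:Real)+1)^(-(3/4:Real))) := by
    refine Finset.sum_le_sum fun i _ => ?_
    split_ifs with hp
    · simp [vL, ArithmeticFunction.vonMangoldt_apply_prime hp]
    rcases Nat.eq_zero_or_pos i with rfl | hi
    · simp [vL]
    have hi0 : (0:Real) < i := by exact_mod_cast hi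
    have hi1 : (1:Real) ≤ i := by exact_mod_cast hi
    have hv := vL_nonneg i
    have l1 : log i ≤ 4 * (i:Real)^(1/4:Real) := by
      have := Real.log_le_rpow_div hi0.le (ε := 1/4) (by norm_num)
      linarith
    have l2 : ((i:Real)+1)^(3/4:Real) ≤ 2 * (i:Real)^(3/4:Real) := by
      calc ((i:Real)+1)^(3/4:Real) ≤ (2 * i)^(3/4:Real) := Real.rpow_le_rpow (by positivity) (by linarith) (by norm_num)
        _ = 2^(3/4:Real) * (i:Real)^(3/4:Real) := Real.mul_rpow (by norm_num) hi0.le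
        _ ≤ 2 * (i:Real)^(3/4:Real) := by
          refine mul_le_mul_of_nonneg_right ?_ (by positivity)
          calc (2:Real)^(3/4:Real) ≤ 2^(1:Real) := Real.rpow_le_rpow_of_exponent_le (by norm_num) (by norm_num)
            _ = 2 := by simp
    have l3 : (i:Real)^(1/4:Real) * (i:Real)^(3/4:Real) = i := by
      rw [← Real.rpow_add hi0]; norm_num
    rw [Real.rpow_neg (by positivity), div_le_iff₀ hi0, ← mul_assoc, mul_comm 8, mul_assoc, mul_assoc]
    refine mul_le_mul_of_nonneg_left ?_ hv
    have q : 0 < ((i:Real)+1)^(3/4:Real) := by positivity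
    rw [← mul_assoc, ← div_eq_mul_inv, div_mul_eq_mul_div, le_div_iff₀ q]
    calc (log i - vL i) * ((i:Real)+1)^(3/4:Real) ≤ (4 * (i:Real)^(1/4:Real)) * (2 * (i:Real)^(3/4:Real)) :=
          mul_le_mul (by linarith) l2 q.le (by positivity)
      _ = 8 * ((i:Real)^(1/4:Real) * (i:Real)^(3/4:Real)) := by ring
      _ = 8 * i := by rw [l3]
  rw [← Finset.mul_sum] at h3
  simp only [Nat.cast_zero, Real.sqrt_zero, mul_zero, zero_mul, zero_add] at h
  linarith
noncomputable def qq (b α : Real) : Real := jF α / cosh (b * α)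
lemma jF_nonneg (α : Real) : 0 ≤ jF α := le_max_right _ _
lemma jF_le (α : Real) : jF α ≤ 1 := max_le (by linarith [abs_nonneg α]) zero_le_one
lemma qq_nonneg (b α : Real) : 0 ≤ qq b α := div_nonneg (jF_nonneg α) (Real.cosh_pos _).le
lemma qq_le (b α : Real) : qq b α ≤ 1 := by
  rw [qq, div_le_one (Real.cosh_pos _)]; exact (jF_le α).trans (Real.one_le_cosh _)
lemma qq_zero {b α : Real} (h : 1 ≤ |α|) : qq b α = 0 := by
  rw [qq, jF, max_eq_right (by linarith), zero_div]
lemma qq_kk {b α : Real} (h0 : 0 ≤ α) (h1 : α ≤ 1) : qq b α = kk b α := by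
  rw [qq, kk, jF, abs_of_nonneg h0, max_eq_left (by linarith)]
lemma sech_lip (x y : Real) : |(cosh x)⁻¹ - (cosh y)⁻¹| ≤ |x - y| := by
  have h := Convex.norm_image_sub_le_of_norm_hasDerivWithin_le (f := fun x => (cosh x)⁻¹) (s := univ) (C := 1)
    (fun z _ => ((Real.hasDerivAt_cosh z).inv (Real.cosh_pos z).ne').hasDerivWithinAt) (fun z _ => by
      rw [Real.norm_eq_abs, abs_div, abs_neg, abs_of_pos (pow_pos (Real.cosh_pos z) 2), div_le_one (pow_pos (Real.cosh_pos z) 2)]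
      have h1 := Real.one_le_cosh z
      have h2 := Real.cosh_sq z
      exact abs_le_of_sq_le_sq (by nlinarith [sq_nonneg (cosh z ^ 2)]) (by positivity)) convex_univ (mem_univ y) (mem_univ x)
  simpa using h
lemma jF_lip (x y : Real) : |jF x - jF y| ≤ |x - y| := by
  have h := abs_max_sub_max_le_abs (1 - |x|) (1 - |y|) 0
  refine h.trans ?_
  rw [show 1 - |x| - (1 - |y|) = |y| - |x| by ring, abs_sub_comm x y]
  exact abs_abs_sub_abs_le _ _
lemma qq_lip {b : Real} (hb0 : 0 < b) (hb1 : b ≤ 1) (x y : Real) : |qq b x - qq b y| ≤ 2 * |x - y| := by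
  have e : qq b x - qq b y = (jF x - jF y) * (cosh (b*x))⁻¹ + jF y * ((cosh (b*x))⁻¹ - (cosh (b*y))⁻¹) := by
    rw [qq, qq]; ring
  have h1 := jF_lip x y
  have h2 := sech_lip (b*x) (b*y)
  rw [← mul_sub, abs_mul, abs_of_pos hb0] at h2
  have h3 : (cosh (b*x))⁻¹ ≤ 1 := inv_le_one_of_one_le₀ (Real.one_le_cosh _)
  have h4 : 0 < (cosh (b*x))⁻¹ := inv_pos.2 (Real.cosh_pos _)
  rw [e]
  refine (abs_add_le _ _).trans ?_
  rw [abs_mul, abs_mul, abs_of_pos h4, abs_of_nonneg (jF_nonneg y)]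
  have := abs_nonneg (x - y)
  have a1 : |jF x - jF y| * (cosh (b*x))⁻¹ ≤ |x - y| * 1 := mul_le_mul h1 h3 h4.le this
  have a2 : jF y * |(cosh (b*x))⁻¹ - (cosh (b*y))⁻¹| ≤ 1 * |x - y| :=
    mul_le_mul (jF_le y) (h2.trans (by nlinarith)) (abs_nonneg _) zero_le_one
  linarith
lemma pp_lip {b : Real} (hb0 : 0 < b) (hb1 : b ≤ 1) {x y : Real} (hy0 : 0 ≤ y) (hy : y ≤ 3) :
    |x * qq b x - y * qq b y| ≤ 7 * |x - y| := by
  rw [show x * qq b x - y * qq b y = (x - y) * qq b x + y * (qq b x - qq b y) by ring]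
  refine (abs_add_le _ _).trans ?_
  rw [abs_mul, abs_mul, abs_of_nonneg (qq_nonneg b x), abs_of_nonneg hy0]
  have a1 : |x - y| * qq b x ≤ |x - y| * 1 := mul_le_mul_of_nonneg_left (qq_le b x) (abs_nonneg _)
  have a2 : y * |qq b x - qq b y| ≤ 3 * (2 * |x - y|) := mul_le_mul hy (qq_lip hb0 hb1 x y) (abs_nonneg _) (by norm_num)
  linarith
lemma by_parts (r f : Nat → Real) (C : Real) (hr : ∀ n, |∑ i ∈ Finset.range n, r i| ≤ C) (n : Nat) :
    |∑ i ∈ Finset.range n, r i * f i| ≤ C * (|f n| + ∑ i ∈ Finset.range n, |f (i+1) - f i|) := by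
  have e : ∀ n, ∑ i ∈ Finset.range n, r i * f i = (∑ i ∈ Finset.range n, r i) * f n -
      ∑ i ∈ Finset.range n, (∑ j ∈ Finset.range (i+1), r j) * (f (i+1) - f i) := by
    intro n
    induction n with
    | zero => simp
    | succ n ih =>
      rw [Finset.sum_range_succ, ih, Finset.sum_range_succ (fun i => (∑ j ∈ Finset.range (i+1), r j) * (f (i+1) - f i)), Finset.sum_range_succ r]
      ring
  rw [e, mul_add, Finset.mul_sum]
  refine (abs_sub _ _).trans (add_le_add ?_ ((Finset.abs_sum_le_sum_abs _ _).trans (Finset.sum_le_sum fun i _ => ?_)))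
  · rw [abs_mul]; exact mul_le_mul_of_nonneg_right (hr n) (abs_nonneg _)
  · rw [abs_mul]; exact mul_le_mul_of_nonneg_right (hr _) (abs_nonneg _)
lemma log_step (i : Nat) : log i ≤ log (i+1:Nat) ∧ log (i+1:Nat) - log i ≤ 1 := by
  rcases Nat.eq_zero_or_pos i with rfl | hi
  · simp
  have hn0 : (0:Real) < i := by exact_mod_cast hi
  refine ⟨Real.log_le_log hn0 (by push_cast; linarith), ?_⟩
  rw [← Real.log_div (by positivity) hn0.ne']
  have h1 : ((i+1:Nat):Real) / i ≤ 2 := by rw [div_le_iff₀ hn0]; push_cast; linarith [show (1:Real) ≤ i by exact_mod_cast hi]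
  linarith [Real.log_le_sub_one_of_pos (x := ((i+1:Nat):Real) / i) (by positivity)]
lemma wsum {b : Real} (hb0 : 0 < b) (hb1 : b ≤ 1) : ∃ C > 0, ∀ (L : Real) (N : Nat), 1 ≤ L → L ≤ log N → log N ≤ 3 * L →
    |∑ n ∈ Finset.range N, vL n^2 / n * (qq b (log n / L) / L) - L * ∫ α in (0:Real)..1, α * kk b α| ≤ C := by
  obtain ⟨C0, hC0, hnp⟩ := nonprime
  refine ⟨C0 + 8 * (3 + 21) + 21, by positivity, fun L N hL h1 h3 => ?_⟩
  have hL0 : 0 < L := by linarith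
  have hlog0 : ∀ n : Nat, 0 ≤ log n := fun n => Real.log_natCast_nonneg n
  set f : Nat → Real := fun n => (log n / L) * qq b (log n / L) with hf
  have hmono : ∀ i ∈ Finset.range N, log i / L ≤ 3 := by
    intro i hi
    rw [div_le_iff₀ hL0]
    rcases Nat.eq_zero_or_pos i with rfl | hp
    · simp; linarith
    exact (Real.log_le_log (by exact_mod_cast hp) (by exact_mod_cast (Finset.mem_range.1 hi).le)).trans h3
  have tel : ∑ i ∈ Finset.range N, (log (i+1:Nat) - log i) = log N := by
    rw [Finset.sum_range_sub (fun i : Nat => log i)]; simp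
  have A : |∑ n ∈ Finset.range N, vL n^2 / n * (qq b (log n / L) / L) - ∑ n ∈ Finset.range N, vL n / n * f n| ≤ C0 := by
    rw [← Finset.sum_sub_distrib]
    refine le_trans ((Finset.abs_sum_le_sum_abs _ _).trans (Finset.sum_le_sum fun i _ => ?_)) (hnp N)
    have hl : vL i ≤ log i := ArithmeticFunction.vonMangoldt_le_log
    rw [show vL i^2 / i * (qq b (log i / L) / L) - vL i / i * f i = -((vL i * (log i - vL i) / i) * (qq b (log i / L) / L)) by
      simp only [hf]; ring]
    have p : 0 ≤ vL i * (log i - vL i) / i := div_nonneg (mul_nonneg (vL_nonneg i) (by linarith)) (by positivity)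
    have q1 : qq b (log i / L) / L ≤ 1 := by rw [div_le_one hL0]; exact (qq_le _ _).trans hL
    rw [abs_neg, abs_of_nonneg (mul_nonneg p (div_nonneg (qq_nonneg _ _) hL0.le))]
    exact mul_le_of_le_one_right p q1
  have step : ∀ i ∈ Finset.range N, |f (i+1) - f i| ≤ 7 / L * (log (i+1:Nat) - log i) := by
    intro i hi
    refine (pp_lip hb0 hb1 (div_nonneg (hlog0 i) hL0.le) (hmono i hi)).trans (le_of_eq ?_)
    rw [← sub_div, abs_div, abs_of_pos hL0, abs_of_nonneg (sub_nonneg.2 (log_step i).1)]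
    ring
  have B : |∑ n ∈ Finset.range N, (vL n / n - (log (n+1:Nat) - log n)) * f n| ≤ 8 * (3 + 21) := by
    refine (by_parts _ f 8 (fun n => ?_) N).trans (mul_le_mul_of_nonneg_left (add_le_add ?_ ?_) (by norm_num))
    · rw [Finset.sum_sub_distrib, Finset.sum_range_sub (fun i : Nat => log i)]
      simpa using mertens n
    · simp only [hf]
      rw [abs_of_nonneg (mul_nonneg (div_nonneg (hlog0 N) hL0.le) (qq_nonneg _ _))]
      have : log N / L ≤ 3 := by rwa [div_le_iff₀ hL0]
      calc _ ≤ 3 * 1 := mul_le_mul this (qq_le _ _) (qq_nonneg _ _) (by norm_num)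
        _ = 3 := by norm_num
    · refine (Finset.sum_le_sum step).trans ?_
      rw [← Finset.mul_sum, tel, div_mul_eq_mul_div, div_le_iff₀ hL0]
      linarith
  have hpc : Continuous fun y : Real => y / L * qq b (y / L) := by
    have : Continuous (qq b) := qcont b
    fun_prop
  have D : |∑ n ∈ Finset.range N, (log (n+1:Nat) - log n) * f n - ∫ y in (0:Real)..log N, y / L * qq b (y / L)| ≤ 21 := by
    have s := intervalIntegral.sum_integral_adjacent_intervals (f := fun y : Real => y / L * qq b (y / L)) (μ := volume) (a := fun i : Nat => log i) (n := N)
      fun k _ => hpc.intervalIntegrable _ _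
    simp only [Nat.cast_zero, Real.log_zero] at s
    rw [← s, ← Finset.sum_sub_distrib]
    have : ∀ i ∈ Finset.range N, |(log (i+1:Nat) - log i) * f i - ∫ y in log i..log (i+1:Nat), y / L * qq b (y / L)| ≤
        7 / L * (log (i+1:Nat) - log i) := by
      intro i hi
      obtain ⟨l1, l2⟩ := log_step i
      rw [show (log (i+1:Nat) - log i) * f i = ∫ y in log i..log (i+1:Nat), f i by simp,
        ← intervalIntegral.integral_sub (by simp) (hpc.intervalIntegrable _ _)]
      have := intervalIntegral.norm_integral_le_of_norm_le_const (a := log i) (b := log (i+1:Nat)) (C := 7 / L)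
        (f := fun y => f i - y / L * qq b (y / L)) fun y hy => by
          rw [uIoc_of_le l1] at hy
          rw [norm_sub_rev, Real.norm_eq_abs]
          refine (pp_lip hb0 hb1 (div_nonneg (hlog0 i) hL0.le) (hmono i hi)).trans ?_
          rw [← sub_div, abs_div, abs_of_pos hL0, abs_of_nonneg (by linarith [hy.1]), mul_div_assoc', div_le_div_iff_of_pos_right hL0]
          linarith [hy.2]
      rwa [abs_of_nonneg (sub_nonneg.2 l1)] at this
    refine (Finset.abs_sum_le_sum_abs _ _).trans ((Finset.sum_le_sum this).trans ?_)
    rw [← Finset.mul_sum, tel, div_mul_eq_mul_div, div_le_iff₀ hL0]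
    linarith
  have E : ∫ y in (0:Real)..log N, y / L * qq b (y / L) = L * ∫ α in (0:Real)..1, α * kk b α := by
    rw [intervalIntegral.integral_comp_div (fun α => α * qq b α) hL0.ne', smul_eq_mul, zero_div]
    have hc : Continuous fun α => α * qq b α := continuous_id.mul (qcont b)
    rw [← intervalIntegral.integral_add_adjacent_intervals (hc.intervalIntegrable 0 1) (hc.intervalIntegrable 1 _)]
    have h1' : 1 ≤ log N / L := by rwa [one_le_div hL0]
    have z : ∫ α in (1:Real)..(log N / L), α * qq b α = 0 := by
      rw [intervalIntegral.integral_congr (g := fun _ => 0) (fun α hα => ?_)]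
      · simp
      · rw [uIcc_of_le h1'] at hα
        simp only
        rw [qq_zero (le_trans hα.1 (le_abs_self _)), mul_zero]
    rw [z, add_zero]
    congr 1
    refine intervalIntegral.integral_congr fun α hα => ?_
    rw [uIcc_of_le zero_le_one] at hα
    rw [qq_kk hα.1 hα.2]
  rw [E] at D
  have e2 : ∑ n ∈ Finset.range N, (vL n / n - (log (n+1:Nat) - log n)) * f n = ∑ n ∈ Finset.range N, vL n / n * f n -
    ∑ n ∈ Finset.range N, (log (n+1:Nat) - log n) * f n := by
    rw [← Finset.sum_sub_distrib]; exact Finset.sum_congr rfl fun i _ => by ring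
  rw [e2] at B
  rw [abs_le] at *
  constructor <;> linarith [A.1, A.2, B.1, B.2, D.1, D.2]
noncomputable def HH (b L y : Real) : Real := ∫ α in (0:Real)..1, kk b α * g (α * L - y)^2
lemma g_sq (v : Real) : g v^2 = exp (-v^2) / (2 * π) := by
  rw [g, div_pow, Real.sq_sqrt (by positivity), ← Real.exp_nat_mul]; congr 2; push_cast; ring
lemma g_cont : Continuous g := by unfold g; fun_prop
lemma g_sq_le (v : Real) : g v^2 ≤ exp (-(1/2) * v^2) := by
  rw [g_sq]
  refine (div_le_self (Real.exp_pos _).le (by linarith [Real.pi_gt_three])).trans (Real.exp_le_exp.2 (by nlinarith [sq_nonneg v]))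
lemma g2_int : Integrable fun v => g v^2 :=
  gauss_int.mono' (g_cont.pow 2).aestronglyMeasurable (.of_forall fun v => by
    rw [Real.norm_eq_abs, abs_of_nonneg (sq_nonneg _)]; exact g_sq_le v)
lemma g2_int1 : Integrable fun v => |v| * g v^2 :=
  gauss_int1.mono' (continuous_abs.mul (g_cont.pow 2)).aestronglyMeasurable (.of_forall fun v => by
    rw [Real.norm_eq_abs, abs_of_nonneg (by positivity)]
    exact mul_le_mul_of_nonneg_left (g_sq_le v) (abs_nonneg v))
lemma g2_inte : Integrable fun v => exp (-v) * g v^2 :=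
  (gauss_int.const_mul (exp (1/2))).mono' ((by fun_prop : Continuous fun v : Real => exp (-v)).mul (g_cont.pow 2)).aestronglyMeasurable (.of_forall fun v => by
    rw [Real.norm_eq_abs, abs_of_nonneg (by positivity), g_sq, ← mul_div_assoc, ← Real.exp_add, ← Real.exp_add]
    refine (div_le_self (Real.exp_pos _).le (by linarith [Real.pi_gt_three])).trans (Real.exp_le_exp.2 (by nlinarith [sq_nonneg (1+v)])))
lemma g2_val : ∫ v, g v^2 = 1 / (2 * sqrt π) := by
  simp_rw [g_sq]
  have h := integral_gaussian 1
  simp only [neg_mul, one_mul, div_one] at h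
  rw [integral_div, h]
  have h2 := Real.sq_sqrt Real.pi_pos.le
  have := Real.sqrt_pos.2 Real.pi_pos
  rw [div_eq_div_iff (by positivity) (by positivity)]
  nlinarith
lemma affine {φ : Real → Real} (h : Integrable φ) {L : Real} (hL : 0 < L) (y : Real) :
    Integrable (fun α => φ (α * L - y)) ∧ ∫ α, φ (α * L - y) = (∫ v, φ v) / L := by
  have h1 := h.comp_sub_right y
  refine ⟨h1.comp_mul_right' hL.ne', ?_⟩
  rw [Measure.integral_comp_mul_right (fun x => φ (x - y)) L, integral_sub_right_eq_self φ y, abs_of_pos (inv_pos.2 hL), smul_eq_mul]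
  ring
lemma F_est {b : Real} (hb0 : 0 < b) (hb1 : b ≤ 1) : ∃ C > 0, ∀ L y : Real, 1 ≤ L →
    Integrable (fun α => qq b α * g (α * L - y)^2) ∧
    |(∫ α, qq b α * g (α * L - y)^2) - 1 / (2 * sqrt π) * (qq b (y / L) / L)| ≤ C / L^2 := by
  refine ⟨2 * (∫ v, |v| * g v^2) + 1, by
    have : 0 ≤ ∫ v, |v| * g v^2 := integral_nonneg fun v => by positivity
    positivity, fun L y hL => ?_⟩
  have hL0 : 0 < L := by linarith
  obtain ⟨i0, e0⟩ := affine g2_int hL0 y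
  obtain ⟨i1, e1⟩ := affine g2_int1 hL0 y
  have hi : Integrable (fun α => qq b α * g (α * L - y)^2) := i0.mono'
    ((qcont b).mul ((g_cont.comp (by fun_prop)).pow 2)).aestronglyMeasurable (.of_forall fun v => by
    rw [Real.norm_eq_abs, abs_of_nonneg (mul_nonneg (qq_nonneg _ _) (sq_nonneg _))]
    exact mul_le_of_le_one_left (sq_nonneg _) (qq_le _ _))
  refine ⟨hi, ?_⟩
  have e : (∫ α, qq b α * g (α * L - y)^2) - 1 / (2 * sqrt π) * (qq b (y / L) / L) =
      ∫ α, (qq b α - qq b (y / L)) * g (α * L - y)^2 := by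
    simp_rw [sub_mul]
    rw [integral_sub hi (i0.const_mul _), integral_const_mul, e0, g2_val]
    ring
  rw [e]
  have bd : ∀ α, ‖(qq b α - qq b (y / L)) * g (α * L - y)^2‖ ≤ 2 / L * (|α * L - y| * g (α * L - y)^2) := by
    intro α
    rw [norm_mul, Real.norm_eq_abs, Real.norm_eq_abs, abs_of_nonneg (sq_nonneg (g _)), ← mul_assoc]
    refine mul_le_mul_of_nonneg_right ((qq_lip hb0 hb1 _ _).trans (le_of_eq ?_)) (sq_nonneg _)
    rw [show α - y / L = (α * L - y) / L by field_simp, abs_div, abs_of_pos hL0]; ring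
  refine (norm_integral_le_of_norm_le (i1.const_mul _) (.of_forall bd)).trans ?_
  rw [integral_const_mul, e1, show 2 / L * ((∫ v, |v| * g v^2) / L) = 2 * (∫ v, |v| * g v^2) / L^2 by field_simp]
  gcongr; linarith
lemma qq_full {b : Real} {φ : Real → Real} (hi : Continuous φ) :
    ∫ α, qq b α * φ α = (∫ α in (-1:Real)..0, qq b α * φ α) + ∫ α in (0:Real)..1, kk b α * φ α := by
  have hc : Continuous fun α => qq b α * φ α := (qcont b).mul hi
  have e : ∫ α in (0:Real)..1, kk b α * φ α = ∫ α in (0:Real)..1, qq b α * φ α := by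
    refine intervalIntegral.integral_congr fun α hα => ?_
    rw [uIcc_of_le zero_le_one] at hα
    rw [qq_kk hα.1 hα.2]
  rw [e, intervalIntegral.integral_add_adjacent_intervals (hc.intervalIntegrable _ _) (hc.intervalIntegrable _ _),
    intervalIntegral.integral_of_le (by norm_num)]
  symm
  refine setIntegral_eq_integral_of_forall_compl_eq_zero fun α hα => ?_
  rw [mem_Ioc, not_and_or, not_lt, not_le] at hα
  rw [qq_zero (by rcases hα with h | h; exacts [le_trans (by linarith) (neg_le_abs _), le_trans h.le (le_abs_self _)]), zero_mul]
lemma H_est {b : Real} (hb0 : 0 < b) (hb1 : b ≤ 1) : ∃ C > 0, ∀ L y : Real, 1 ≤ L →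
    |HH b L y - 1 / (2 * sqrt π) * (qq b (y / L) / L)| ≤ C / L^2 + C * exp (-y) / L := by
  obtain ⟨C, hC, h⟩ := F_est hb0 hb1
  have hM : 0 ≤ ∫ v, exp (-v) * g v^2 := integral_nonneg fun v => by positivity
  refine ⟨C + ∫ v, exp (-v) * g v^2, by positivity, fun L y hL => ?_⟩
  have hL0 : 0 < L := by linarith
  obtain ⟨hi, hF⟩ := h L y hL
  have hgc : Continuous fun α => g (α * L - y)^2 := (g_cont.comp (by fun_prop)).pow 2
  rw [qq_full hgc] at hF
  rw [HH]
  obtain ⟨i2, e2⟩ := affine g2_inte hL0 y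
  have bd : |∫ α in (-1:Real)..0, qq b α * g (α * L - y)^2| ≤ (∫ v, exp (-v) * g v^2) * exp (-y) / L := by
    rw [intervalIntegral.integral_of_le (by norm_num)]
    rw [abs_of_nonneg (integral_nonneg fun α => mul_nonneg (qq_nonneg _ _) (sq_nonneg _))]
    calc _ ≤ ∫ α in Ioc (-1:Real) 0, exp (-y) * (exp (-(α * L - y)) * g (α * L - y)^2) := by
          refine setIntegral_mono_on hi.integrableOn (i2.const_mul _).integrableOn measurableSet_Ioc fun α hα => ?_
          rw [← mul_assoc, ← Real.exp_add]
          refine mul_le_mul_of_nonneg_right ((qq_le _ _).trans (Real.one_le_exp ?_)) (sq_nonneg _)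
          nlinarith [hα.2]
      _ ≤ ∫ α, exp (-y) * (exp (-(α * L - y)) * g (α * L - y)^2) :=
          setIntegral_le_integral (i2.const_mul _) (.of_forall fun α => by positivity)
      _ = _ := by rw [integral_const_mul, e2]; ring
  have a1 : C / L^2 ≤ (C + ∫ v, exp (-v) * g v^2) / L^2 := by gcongr; linarith
  have a2 : (∫ v, exp (-v) * g v^2) * exp (-y) / L ≤ (C + ∫ v, exp (-v) * g v^2) * exp (-y) / L := by gcongr; linarith
  rw [abs_le] at *
  constructor <;> linarith [hF.1, hF.2, bd.1, bd.2]
lemma H_zero {b : Real} (hb0 : 0 < b) (hb1 : b ≤ 1) : ∃ C > 0, ∀ L : Real, 1 ≤ L →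
    |HH b L 0 - 1 / (4 * sqrt π * L)| ≤ C / L^2 := by
  obtain ⟨C, hC, h⟩ := F_est hb0 hb1
  refine ⟨C, hC, fun L hL => ?_⟩
  obtain ⟨hi, hF⟩ := h L 0 hL
  have hgc : Continuous fun α => g (α * L - 0)^2 := (g_cont.comp (by fun_prop)).pow 2
  rw [qq_full hgc] at hF
  have e : ∫ α in (-1:Real)..0, qq b α * g (α * L - 0)^2 = ∫ α in (0:Real)..1, kk b α * g (α * L - 0)^2 := by
    have := intervalIntegral.integral_comp_neg (a := 0) (b := 1) fun α : Real => qq b α * g (α * L - 0)^2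
    rw [neg_zero] at this
    rw [← this]
    refine intervalIntegral.integral_congr fun α hα => ?_
    rw [uIcc_of_le zero_le_one] at hα
    rw [← qq_kk hα.1 hα.2, show -α * L - 0 = -(α * L - 0) by ring, g_neg]
    simp only [qq, jF, abs_neg, mul_neg, Real.cosh_neg]
  rw [e, zero_div] at hF
  have q0 : qq b 0 = 1 := by simp [qq, jF]
  rw [q0] at hF
  rw [HH]
  have hs := Real.sqrt_pos.2 Real.pi_pos
  have e3 : 1 / (2 * sqrt π) * (1 / L) = 2 * (1 / (4 * sqrt π * L)) := by field_simp; norm_num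
  rw [e3] at hF
  rw [abs_le] at *
  have : 0 ≤ C / L^2 := by positivity
  constructor <;> linarith [hF.1, hF.2]
lemma diag {b : Real} (hb0 : 0 < b) (hb1 : b ≤ 1) : ∃ C > 0, ∀ (L : Real) (N : Nat), 1 ≤ L → L ≤ log N → log N ≤ 3 * L →
    |∑ n ∈ Finset.range N, vL n^2 / n * HH b L (log n) - L / (2 * sqrt π) * ∫ α in (0:Real)..1, α * kk b α| ≤ C := by
  obtain ⟨C1, hC1, h1⟩ := wsum hb0 hb1
  obtain ⟨C2, hC2, h2⟩ := H_est hb0 hb1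
  have hs : Summable fun n : Nat => (n:Real)^(-(3/2:Real)) := Real.summable_nat_rpow.2 (by norm_num)
  refine ⟨C1 + C2 * 33 + C2 * (16 * ∑' n : Nat, (n:Real)^(-(3/2:Real))), by positivity, fun L N hL hl1 hl3 => ?_⟩
  have hL0 : 0 < L := by linarith
  have hw := h1 L N hL hl1 hl3
  have hd : |∑ n ∈ Finset.range N, vL n^2 / n * HH b L (log n) - 1 / (2 * sqrt π) * ∑ n ∈ Finset.range N, vL n^2 / n * (qq b (log n / L) / L)| ≤
      C2 / L^2 * ∑ n ∈ Finset.range N, vL n^2 / n + C2 * ∑ n ∈ Finset.range N, vL n^2 / n^2 := by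
    rw [Finset.mul_sum, Finset.mul_sum, Finset.mul_sum, ← Finset.sum_sub_distrib, ← Finset.sum_add_distrib]
    refine (Finset.abs_sum_le_sum_abs _ _).trans (Finset.sum_le_sum fun n _ => ?_)
    rcases Nat.eq_zero_or_pos n with rfl | hn
    · simp
    have hn0 : (0:Real) < n := by exact_mod_cast hn
    rw [show vL n^2 / n * HH b L (log n) - 1 / (2 * sqrt π) * (vL n^2 / n * (qq b (log n / L) / L)) =
      vL n^2 / n * (HH b L (log n) - 1 / (2 * sqrt π) * (qq b (log n / L) / L)) by ring, abs_mul, abs_of_nonneg (by positivity)]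
    have h := h2 L (log n) hL
    rw [Real.exp_neg, Real.exp_log hn0] at h
    have h' : C2 * (n:Real)⁻¹ / L ≤ C2 * (n:Real)⁻¹ := div_le_self (by positivity) hL
    calc _ ≤ vL n^2 / n * (C2 / L^2 + C2 * (n:Real)⁻¹) := mul_le_mul_of_nonneg_left (by linarith) (by positivity)
      _ = _ := by field_simp
  have s1 : ∑ n ∈ Finset.range N, vL n^2 / n ≤ 33 * L^2 := by
    calc _ ≤ ∑ n ∈ Finset.range N, (3 * L) * (vL n / n) := by
          refine Finset.sum_le_sum fun n hn => ?_
          rcases Nat.eq_zero_or_pos n with rfl | hp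
          · simp
          have : vL n ≤ 3 * L := ArithmeticFunction.vonMangoldt_le_log.trans ((Real.log_le_log (by exact_mod_cast hp) (by exact_mod_cast (Finset.mem_range.1 hn).le)).trans hl3)
          rw [sq, mul_div_assoc]
          exact mul_le_mul_of_nonneg_right this (div_nonneg (vL_nonneg n) (by positivity))
      _ ≤ (3 * L) * (3 * L + 8) := by
          rw [← Finset.mul_sum]
          have := (abs_le.1 (mertens N)).2
          exact mul_le_mul_of_nonneg_left (by linarith) (by linarith)
      _ ≤ 33 * L^2 := by nlinarith
  have s2 : ∑ n ∈ Finset.range N, vL n^2 / n^2 ≤ 16 * ∑' n : Nat, (n:Real)^(-(3/2:Real)) := by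
    calc _ ≤ ∑ n ∈ Finset.range N, 16 * (n:Real)^(-(3/2:Real)) := by
          refine Finset.sum_le_sum fun n hn => ?_
          rcases Nat.eq_zero_or_pos n with rfl | hp
          · simp
          have hn0 : (0:Real) < n := by exact_mod_cast hp
          have l1 : vL n ≤ 4 * (n:Real)^(1/4:Real) := by
            have := Real.log_le_rpow_div hn0.le (ε := 1/4) (by norm_num)
            linarith [show vL n ≤ log n from ArithmeticFunction.vonMangoldt_le_log]
          rw [div_le_iff₀ (by positivity), mul_assoc, ← Real.rpow_natCast (n:Real) 2, ← Real.rpow_add hn0]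
          calc vL n^2 ≤ (4 * (n:Real)^(1/4:Real))^2 := pow_le_pow_left₀ (vL_nonneg n) l1 2
            _ = 16 * (n:Real)^(-(3/2:Real) + (2:Nat)) := by
              rw [mul_pow, ← Real.rpow_mul_natCast hn0.le]; norm_num
      _ ≤ _ := by
          rw [← Finset.mul_sum]
          exact mul_le_mul_of_nonneg_left (hs.sum_le_tsum _ fun i _ => by positivity) (by norm_num)
  have t1 : C2 / L^2 * ∑ n ∈ Finset.range N, vL n^2 / n ≤ C2 * 33 := by
    calc _ ≤ C2 / L^2 * (33 * L^2) := mul_le_mul_of_nonneg_left s1 (by positivity)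
      _ = C2 * 33 := by field_simp
  have t2 := mul_le_mul_of_nonneg_left s2 hC2.le
  have hp1 : 1 / (2 * sqrt π) ≤ 1 := by
    rw [div_le_one (by positivity)]
    have : 1 ≤ sqrt π := Real.one_le_sqrt.2 (by linarith [Real.pi_gt_three])
    linarith
  have hw2 : |1 / (2 * sqrt π) * (∑ n ∈ Finset.range N, vL n^2 / n * (qq b (log n / L) / L)) - L / (2 * sqrt π) * ∫ α in (0:Real)..1, α * kk b α| ≤ C1 := by
    rw [show L / (2 * sqrt π) * (∫ α in (0:Real)..1, α * kk b α) = 1 / (2 * sqrt π) * (L * ∫ α in (0:Real)..1, α * kk b α) by ring,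
      ← mul_sub, abs_mul, abs_of_pos (by positivity)]
    exact (mul_le_of_le_one_left (abs_nonneg _) hp1).trans hw
  rw [abs_le] at *
  constructor <;> linarith [hd.1, hd.2, hw2.1, hw2.2]
noncomputable def ww (L : Real) (n : Nat) : Real := if n = 1 then -L else vL n
noncomputable def cc (L u : Real) (n : Nat) : Real := ww L n * g (u - log n) * exp (-(log n / 2))
lemma ww_zero (L : Real) : ww L 0 = 0 := by simp [ww]
lemma cpow_split {n : Nat} (hn : 0 < n) (t : Real) : (n:Complex) ^ (-(1/2 + t * I)) =
    (exp (-(log n / 2)) : Complex) * (Real.cos (t * log n) - Real.sin (t * log n) * I) := by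
  rw [Complex.cpow_def_of_ne_zero (by exact_mod_cast hn.ne'), ← Complex.natCast_log,
    show ((log n : Real) : Complex) * (-(1/2 + t * I)) = ((-(log n / 2) : Real) : Complex) + ((-(t * log n) : Real) : Complex) * I by
      push_cast; ring, Complex.exp_add, Complex.exp_mul_I, ← Complex.ofReal_cos, ← Complex.ofReal_sin, Real.cos_neg, Real.sin_neg,
    Complex.ofReal_exp]
  push_cast; ring
lemma sum_ww (L : Real) (N : Nat) (hN : 2 ≤ N) (f : Nat → Complex) : ∑ n ∈ Finset.range N, (ww L n : Complex) * f n =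
    (∑ n ∈ Finset.range N, (vL n : Complex) * f n) - L * f 1 := by
  have h1 : 1 ∈ Finset.range N := by simp; omega
  rw [← Finset.add_sum_erase _ _ h1, ← Finset.add_sum_erase _ (fun n => (vL n : Complex) * f n) h1]
  have : ∑ x ∈ (Finset.range N).erase 1, (ww L x : Complex) * f x = ∑ x ∈ (Finset.range N).erase 1, (vL x : Complex) * f x :=
    Finset.sum_congr rfl fun x hx => by rw [ww, if_neg (Finset.ne_of_mem_erase hx)]
  rw [this]; simp [ww, vL]; ring
lemma sum_ww2 (L : Real) (N : Nat) (hN : 2 ≤ N) (f : Nat → Real) : ∑ n ∈ Finset.range N, ww L n ^ 2 * f n =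
    (∑ n ∈ Finset.range N, vL n ^ 2 * f n) + L ^ 2 * f 1 := by
  have h1 : 1 ∈ Finset.range N := by simp; omega
  rw [← Finset.add_sum_erase _ _ h1, ← Finset.add_sum_erase _ (fun n => vL n ^ 2 * f n) h1]
  have : ∑ x ∈ (Finset.range N).erase 1, ww L x ^ 2 * f x = ∑ x ∈ (Finset.range N).erase 1, vL x ^ 2 * f x :=
    Finset.sum_congr rfl fun x hx => by rw [ww, if_neg (Finset.ne_of_mem_erase hx)]
  rw [this]; simp [ww, vL]; ring
lemma Dm_eq (T t u : Real) (hN : 2 ≤ NT T) : Dm T t u = -∑ n ∈ Finset.range (NT T), (cc (log T) u n : Complex) *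
    (Real.cos (t * log n) - Real.sin (t * log n) * I) := by
  have h := sum_ww (log T) (NT T) hN (fun n => (g (u - log n) : Complex) * (n:Complex) ^ (-(1/2 + t * I)))
  have h2 : ∑ n ∈ Finset.range (NT T), (cc (log T) u n : Complex) *
      (Real.cos (t * log n) - Real.sin (t * log n) * I) =
      ∑ n ∈ Finset.range (NT T), (ww (log T) n : Complex) * ((g (u - log n) : Complex) * (n:Complex) ^ (-(1/2 + t * I))) := by
    refine Finset.sum_congr rfl fun n _ => ?_
    rcases Nat.eq_zero_or_pos n with rfl | hn
    · simp [cc, ww_zero]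
    · rw [cpow_split hn, cc]; push_cast; ring
  rw [h2, h, Dm, Pf]
  simp [Pterm]; ring
lemma Dm_sq (T t u : Real) (hN : 2 ≤ NT T) : ‖Dm T t u‖^2 = ∑ m ∈ Finset.range (NT T), ∑ n ∈ Finset.range (NT T),
    cc (log T) u m * cc (log T) u n * Real.cos (t * (log m - log n)) := by
  rw [Dm_eq T t u hN, norm_neg, ← Complex.normSq_eq_norm_sq, Complex.normSq_apply]
  have h1 : (∑ n ∈ Finset.range (NT T), (cc (log T) u n : Complex) *
      (Real.cos (t * log n) - Real.sin (t * log n) * I)).re = ∑ n ∈ Finset.range (NT T), cc (log T) u n * Real.cos (t * log n) := by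
    rw [Complex.re_sum]; refine Finset.sum_congr rfl fun n _ => ?_
    rw [Complex.re_ofReal_mul, Complex.sub_re, Complex.re_ofReal_mul, Complex.ofReal_re, Complex.I_re, mul_zero, sub_zero]
  have h2 : (∑ n ∈ Finset.range (NT T), (cc (log T) u n : Complex) *
      (Real.cos (t * log n) - Real.sin (t * log n) * I)).im = ∑ n ∈ Finset.range (NT T), cc (log T) u n * -Real.sin (t * log n) := by
    rw [Complex.im_sum]; refine Finset.sum_congr rfl fun n _ => ?_
    rw [Complex.im_ofReal_mul, Complex.sub_im, Complex.im_ofReal_mul, Complex.ofReal_im, Complex.I_im, mul_one, zero_sub]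
  rw [h1, h2, Finset.sum_mul_sum, Finset.sum_mul_sum, ← Finset.sum_add_distrib]
  refine Finset.sum_congr rfl fun m _ => ?_
  rw [← Finset.sum_add_distrib]
  refine Finset.sum_congr rfl fun n _ => ?_
  rw [mul_sub, Real.cos_sub]; ring
lemma cos_int (T d : Real) (hd : d ≠ 0) : |∫ t in T..2*T, Real.cos (t * d)| ≤ 2 / |d| := by
  rw [intervalIntegral.integral_comp_mul_right _ hd, integral_cos, smul_eq_mul, abs_mul, abs_inv, div_eq_inv_mul]
  refine mul_le_mul_of_nonneg_left ?_ (by positivity)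
  exact (abs_sub _ _).trans (by linarith [Real.abs_sin_le_one (2*T*d), Real.abs_sin_le_one (T*d)])
noncomputable def ee (L u : Real) (n : Nat) : Real := |ww L n| * (g (u - log n) * exp (|u - log n| / 2))
lemma ee_nonneg (L u : Real) (n : Nat) : 0 ≤ ee L u n := by
  have := g_pos (u - log n); unfold ee; positivity
lemma off_lt (L u T : Real) {m n : Nat} (hm : 0 < m) (h : m < n) :
    |cc L u m * cc L u n * ∫ t in T..2*T, Real.cos (t * (log m - log n))| ≤ ee L u m * ee L u n * (2 / |(m:Real) - n|) := by
  have hm' : (0:Real) < m := by exact_mod_cast hm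
  have h' : (m:Real) < n := by exact_mod_cast h
  have hn' : (0:Real) < n := hm'.trans h'
  have hd : 1 - (m:Real) / n ≤ log n - log m := by
    have := Real.one_sub_inv_le_log_of_pos (show (0:Real) < n / m by positivity)
    rwa [inv_div, Real.log_div hn'.ne' hm'.ne'] at this
  have hp : 0 < 1 - (m:Real) / n := by rw [sub_pos, div_lt_one hn']; exact h'
  have hi := cos_int T (log m - log n) (by linarith)
  have h2 : 2 / |log m - log n| ≤ n * (2 / |(m:Real) - n|) := by
    rw [abs_sub_comm, abs_of_pos (by linarith), abs_sub_comm, abs_of_pos (by linarith)]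
    calc _ ≤ 2 / (1 - (m:Real)/n) := div_le_div_of_nonneg_left (by norm_num) hp hd
      _ = _ := by have : (n:Real) - m ≠ 0 := by linarith
                  field_simp
  rw [abs_mul]
  refine (mul_le_mul_of_nonneg_left (hi.trans h2) (abs_nonneg _)).trans ?_
  rw [← mul_assoc]
  refine mul_le_mul_of_nonneg_right ?_ (by positivity)
  have e1 := Real.exp_log hn'
  have gm := g_pos (u - log m); have gn := g_pos (u - log n)
  have h3 : exp (-(log m / 2)) * exp (-(log n / 2)) * n ≤ exp (|u - log m| / 2) * exp (|u - log n| / 2) := by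
    rw [← e1, Real.log_exp, ← Real.exp_add, ← Real.exp_add, ← Real.exp_add]
    refine Real.exp_le_exp.2 ?_
    linarith [le_abs_self (u - log m), neg_abs_le (u - log n)]
  have h4 : |cc L u m * cc L u n| * n = (|ww L m| * g (u - log m)) * (|ww L n| * g (u - log n)) *
      (exp (-(log m / 2)) * exp (-(log n / 2)) * n) := by
    simp only [cc, abs_mul, abs_of_pos gm, abs_of_pos gn, Real.abs_exp]; ring
  rw [h4]
  refine (mul_le_mul_of_nonneg_left h3 (by positivity)).trans (le_of_eq ?_)
  unfold ee; ring
lemma off_ne (L u T : Real) {m n : Nat} (h : m ≠ n) :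
    |cc L u m * cc L u n * ∫ t in T..2*T, Real.cos (t * (log m - log n))| ≤ ee L u m * ee L u n * (2 / |(m:Real) - n|) := by
  have hr : 0 ≤ ee L u m * ee L u n * (2 / |(m:Real) - n|) := by
    have := ee_nonneg L u m; have := ee_nonneg L u n; positivity
  rcases Nat.eq_zero_or_pos m with rfl | hm
  · simpa [cc, ww_zero] using hr
  rcases Nat.eq_zero_or_pos n with rfl | hn
  · simpa [cc, ww_zero] using hr
  rcases lt_or_gt_of_ne h with h | h
  · exact off_lt L u T hm h
  · have := off_lt L u T hn h
    have e : ∀ t : Real, Real.cos (t * (log m - log n)) = Real.cos (t * (log n - log m)) := fun t => by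
      rw [← Real.cos_neg]; congr 1; ring
    simp only [e]
    rw [mul_comm (cc L u m), mul_comm (ee L u m), abs_sub_comm]; exact this
lemma harm (N m : Nat) (hm : m < N) : ∑ n ∈ Finset.range N, 1 / |(m:Real) - n| ≤ 2 * (1 + log N) := by
  have hH : ∀ k ≤ N, ∑ j ∈ Finset.range k, 1 / ((j:Real) + 1) ≤ 1 + log N := fun k hk => by
    calc _ ≤ ∑ j ∈ Finset.range N, 1 / ((j:Real) + 1) :=
          Finset.sum_le_sum_of_subset_of_nonneg (Finset.range_mono hk) fun _ _ _ => by positivity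
      _ ≤ _ := by
        have := harmonic_le_one_add_log N
        simpa [harmonic] using this
  rw [← Finset.sum_range_add_sum_Ico _ (show m + 1 ≤ N from hm), Finset.sum_range_succ, ← Finset.sum_range_reflect, Finset.sum_Ico_eq_sum_range]
  have a1 : ∑ j ∈ Finset.range m, 1 / |(m:Real) - (m - 1 - j : Nat)| = ∑ j ∈ Finset.range m, 1 / ((j:Real) + 1) := by
    refine Finset.sum_congr rfl fun j hj => ?_
    rw [Finset.mem_range] at hj
    rw [Nat.sub_sub, Nat.cast_sub (by omega), abs_of_pos (by push_cast; linarith)]; push_cast; ring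
  have a2 : ∑ j ∈ Finset.range (N - (m+1)), 1 / |(m:Real) - (m + 1 + j : Nat)| = ∑ j ∈ Finset.range (N - (m+1)), 1 / ((j:Real) + 1) := by
    refine Finset.sum_congr rfl fun j hj => ?_
    rw [abs_sub_comm, abs_of_pos (by push_cast; linarith)]; push_cast; ring
  rw [a1, a2]
  have := hH m hm.le; have := hH (N - (m+1)) (by omega)
  rw [sub_self, abs_zero, div_zero]; linarith
lemma phi_bd (u : Real) {n : Nat} (hn : 0 < n) : g (u - log n) * exp (|u - log n| / 2) ≤
    4 * exp 4 * (exp u^2 / (n + exp u)^2) := by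
  have hn' : (0:Real) < n := by exact_mod_cast hn
  set v := u - log n with hv
  have e1 : (n:Real) = exp u * exp (-v) := by rw [← Real.exp_add, hv]; rw [show u + -(u - log n) = log n by ring, Real.exp_log hn']
  rw [e1, show exp u^2 / (exp u * exp (-v) + exp u)^2 = 1 / (exp (-v) + 1)^2 by
    have := Real.exp_pos u; field_simp, mul_one_div, le_div_iff₀ (by positivity)]
  have h1 : exp (-v) + 1 ≤ 2 * exp |v| := by
    have := Real.exp_le_exp.2 (neg_le_abs v); have := Real.one_le_exp (abs_nonneg v); linarith
  have h2 : (exp (-v) + 1)^2 ≤ 4 * exp (2 * |v|) := by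
    calc _ ≤ (2 * exp |v|)^2 := pow_le_pow_left₀ (by positivity) h1 2
      _ = _ := by rw [mul_pow, ← Real.exp_nat_mul]; norm_num
  have h3 : g v ≤ exp (-v^2/2) := by
    unfold g; refine div_le_self (Real.exp_pos _).le ?_
    rw [Real.one_le_sqrt]; linarith [Real.pi_gt_three]
  calc _ ≤ exp (-v^2/2) * exp (|v|/2) * (4 * exp (2*|v|)) :=
        mul_le_mul (mul_le_mul_of_nonneg_right h3 (Real.exp_pos _).le) h2 (by positivity) (by positivity)
    _ = 4 * exp (-v^2/2 + |v|/2 + 2*|v|) := by rw [Real.exp_add, Real.exp_add]; ring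
    _ ≤ _ := by
      refine mul_le_mul_of_nonneg_left (Real.exp_le_exp.2 ?_) (by norm_num)
      nlinarith [sq_abs v, sq_nonneg (|v| - 5/2)]
lemma ee_sq_sum {L u : Real} {N : Nat} (hL : 0 ≤ L) (hu : 0 ≤ u) (hN : 2 ≤ N) (hl : log N ≤ 3 * L) :
    ∑ n ∈ Finset.range N, ee L u n ^ 2 ≤ (4 * exp 4)^2 * (36 * L * exp u + L^2) := by
  set C := 4 * exp 4
  have hC : 0 < C := by positivity
  have hr : ∀ n : Nat, exp u^2 / (n + exp u)^2 ≤ 1 := fun n => by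
    rw [div_le_one (by positivity)]
    exact pow_le_pow_left₀ (by positivity) (by linarith [Nat.cast_nonneg (α := Real) n]) 2
  have h0 : ∀ n ∈ Finset.range N, ee L u n ^ 2 ≤ ww L n ^ 2 * (C^2 * (exp u^2 / (n + exp u)^2)) := fun n _ => by
    rcases Nat.eq_zero_or_pos n with rfl | hn
    · simp [ee, ww_zero]
    rw [ee, mul_pow, sq_abs]
    refine mul_le_mul_of_nonneg_left ?_ (sq_nonneg _)
    have gp := g_pos (u - log n)
    refine (pow_le_pow_left₀ (by positivity) (phi_bd u hn) 2).trans ?_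
    rw [mul_pow]
    refine mul_le_mul_of_nonneg_left ?_ (by positivity)
    rw [sq]; exact mul_le_of_le_one_left (by positivity) (hr n)
  refine (Finset.sum_le_sum h0).trans ?_
  rw [sum_ww2 L N hN]
  have h1 : ∑ n ∈ Finset.range N, vL n ^ 2 * (C^2 * (exp u^2 / (n + exp u)^2)) ≤
      ∑ n ∈ Finset.range N, (3 * L * C^2) * (vL n * (exp u^2 / (n + exp u)^2)) := by
    refine Finset.sum_le_sum fun n hn => ?_
    rcases Nat.eq_zero_or_pos n with rfl | hn0
    · simp
    have hv : vL n ≤ 3 * L := ArithmeticFunction.vonMangoldt_le_log.trans ((Real.log_le_log (by exact_mod_cast hn0)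
      (by exact_mod_cast (Finset.mem_range.1 hn).le)).trans hl)
    have := mul_le_mul_of_nonneg_right hv (show 0 ≤ vL n * (C^2 * (exp u^2 / (n + exp u)^2)) by
      have := vL_nonneg n; positivity)
    linarith
  rw [← Finset.mul_sum] at h1
  have h2 := mul_le_mul_of_nonneg_left (esum (Real.one_le_exp hu) N) (show 0 ≤ 3 * L * C^2 by positivity)
  have h3 : L^2 * (C^2 * (exp u^2 / ((1:Nat) + exp u)^2)) ≤ L^2 * C^2 :=
    mul_le_mul_of_nonneg_left (mul_le_of_le_one_right (by positivity) (hr 1)) (sq_nonneg _)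
  linarith
lemma Dm_int (T u : Real) (hN : 2 ≤ NT T) : (∫ t in T..2*T, ‖Dm T t u‖^2) = ∑ m ∈ Finset.range (NT T), ∑ n ∈ Finset.range (NT T),
    cc (log T) u m * cc (log T) u n * ∫ t in T..2*T, Real.cos (t * (log m - log n)) := by
  simp only [Dm_sq T _ u hN]
  rw [intervalIntegral.integral_finsetSum fun m _ => Continuous.intervalIntegrable (by fun_prop) _ _]
  refine Finset.sum_congr rfl fun m _ => ?_
  rw [intervalIntegral.integral_finsetSum fun m _ => Continuous.intervalIntegrable (by fun_prop) _ _]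
  refine Finset.sum_congr rfl fun n _ => ?_
  rw [intervalIntegral.integral_const_mul]
lemma Dm_cont (T : Real) (hN : 2 ≤ NT T) : Continuous fun u => ∫ t in T..2*T, ‖Dm T t u‖^2 := by
  simp only [Dm_int T _ hN, cc]
  have := g_cont
  fun_prop
lemma offdiag : ∃ C > 0, ∀ T u : Real, 1 ≤ log T → 0 < T → 2 ≤ NT T → log (NT T) ≤ 3 * log T → 0 ≤ u →
    |(∫ t in T..2*T, ‖Dm T t u‖^2) - T * ∑ n ∈ Finset.range (NT T), cc (log T) u n ^ 2| ≤ C * (log T^2 * exp u + log T^3) := by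
  refine ⟨16 * ((4 * exp 4)^2 * 36), by positivity, fun T u hL hT hN hl hu => ?_⟩
  set L := log T
  set N := NT T
  have e2 : T * ∑ n ∈ Finset.range N, cc L u n ^ 2 = ∑ m ∈ Finset.range N, ∑ n ∈ Finset.range N,
      if m = n then T * cc L u m ^ 2 else 0 := by
    rw [Finset.mul_sum]; refine Finset.sum_congr rfl fun m hm => ?_
    rw [Finset.sum_ite_eq, if_pos hm]
  rw [Dm_int T u hN, e2, ← Finset.sum_sub_distrib]
  have h3 : ∀ m ∈ Finset.range N, |(∑ n ∈ Finset.range N,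
      cc L u m * cc L u n * ∫ t in T..2*T, Real.cos (t * (log m - log n))) - ∑ n ∈ Finset.range N,
      if m = n then T * cc L u m ^ 2 else 0| ≤ ∑ n ∈ Finset.range N, (ee L u m ^ 2 * (1 / |(m:Real) - n|) + ee L u n ^ 2 * (1 / |(n:Real) - m|)) := fun m _ => by
    rw [← Finset.sum_sub_distrib]
    refine (Finset.abs_sum_le_sum_abs _ _).trans (Finset.sum_le_sum fun n _ => ?_)
    by_cases h : m = n
    · subst h; rw [if_pos rfl, sub_self (log m)]
      simp; ring
    · rw [if_neg h, sub_zero]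
      refine (off_ne L u T h).trans ?_
      rw [abs_sub_comm (n:Real), ← add_mul]
      have := mul_le_mul_of_nonneg_right (two_mul_le_add_sq (ee L u m) (ee L u n)) (show 0 ≤ 1 / |(m:Real) - n| by positivity)
      refine le_trans (le_of_eq ?_) this
      ring
  have h4 : ∑ m ∈ Finset.range N, ∑ n ∈ Finset.range N, ee L u m ^ 2 * (1 / |(m:Real) - n|) ≤ (8 * L) * ∑ m ∈ Finset.range N, ee L u m ^ 2 := by
    rw [Finset.mul_sum]; refine Finset.sum_le_sum fun m hm => ?_
    rw [← Finset.mul_sum, mul_comm]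
    exact mul_le_mul_of_nonneg_right ((harm N m (Finset.mem_range.1 hm)).trans (by linarith)) (sq_nonneg _)
  have h5 : ∑ m ∈ Finset.range N, ∑ n ∈ Finset.range N, ee L u n ^ 2 * (1 / |(n:Real) - m|) ≤ (8 * L) * ∑ m ∈ Finset.range N, ee L u m ^ 2 := by
    rw [Finset.sum_comm]; exact h4
  refine (Finset.abs_sum_le_sum_abs _ _).trans ((Finset.sum_le_sum h3).trans ?_)
  simp only [Finset.sum_add_distrib]
  have h6 := mul_le_mul_of_nonneg_left (ee_sq_sum (by linarith : 0 ≤ L) hu hN hl) (show 0 ≤ 16 * L by linarith)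
  have h7 : (4 * exp 4)^2 * L^3 ≤ (4 * exp 4)^2 * (36 * L^3) :=
    mul_le_mul_of_nonneg_left (by nlinarith [pow_nonneg (by linarith : 0 ≤ L) 3]) (by positivity)
  nlinarith [h7]
noncomputable def MM (T u : Real) : Real := ∫ t in T..2*T, ‖Dm T t u‖^2
lemma ev_basic : ∀ᶠ T : Real in atTop, 1 ≤ T ∧ 1 ≤ log T ∧ 2 ≤ NT T ∧ log T ≤ log (NT T) ∧ log (NT T) ≤ 3 * log T ∧
    log T^3 ≤ T := by
  have h3 := (Real.isLittleO_pow_log_id_atTop (n := 3)).bound (show (0:Real) < 1 by norm_num)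
  filter_upwards [eventually_ge_atTop 2, Real.tendsto_log_atTop.eventually_ge_atTop 1, h3] with T h2 hL h3
  have hp : 0 < T := by linarith
  have hN : (NT T : Real) = (⌊T^2⌋₊ : Real) + 1 := by simp [NT]
  have hf := Nat.lt_floor_add_one (T^2)
  have hf' := Nat.floor_le (sq_nonneg T)
  refine ⟨by linarith, hL, ?_, Real.log_le_log hp (by nlinarith), ?_, ?_⟩
  · have : (2:Real) ≤ NT T := by nlinarith
    exact_mod_cast this
  · rw [show 3 * log T = log (T^3) by rw [Real.log_pow]; norm_num]
    exact Real.log_le_log (by rw [hN]; positivity) (by nlinarith [mul_pos hp hp])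
  · rw [Real.norm_of_nonneg (pow_nonneg (by linarith) _), one_mul, id, Real.norm_of_nonneg hp.le] at h3; exact h3
lemma kk_nn {b α : Real} (h : α ≤ 1) : 0 ≤ kk b α := div_nonneg (by linarith) (Real.cosh_pos _).le
lemma kk_le {b α : Real} (h : α ≤ 1) : kk b α ≤ 1 - α := div_le_self (by linarith) (Real.one_le_cosh _)
lemma exp_mean {L : Real} (hL : 1 ≤ L) : ∫ α in (0:Real)..1, (1 - α) * exp (α * L) ≤ exp L / L^2 := by
  have hL0 : L ≠ 0 := by linarith
  have : ∀ x ∈ uIcc (0:Real) 1, HasDerivAt (fun α => ((1 - α) / L + 1 / L^2) * exp (α * L)) ((1 - x) * exp (x * L)) x := fun x _ => by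
    have h1 : HasDerivAt (fun α : Real => (1 - α) / L + 1 / L^2) (-1 / L) x := (((hasDerivAt_id x).const_sub 1).div_const L).add_const _
    have h2 : HasDerivAt (fun α : Real => exp (α * L)) (exp (x * L) * (1 * L)) x := ((hasDerivAt_id x).mul_const L).exp
    refine (h1.mul h2).congr_deriv ?_
    field_simp; ring
  rw [intervalIntegral.integral_eq_sub_of_hasDerivAt this (Continuous.intervalIntegrable (by fun_prop) _ _)]
  simp only [sub_self, zero_div, zero_add, one_mul, zero_mul, Real.exp_zero, mul_one, sub_zero]
  have : 0 < 1 / L + 1 / L^2 := by positivity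
  rw [div_mul_eq_mul_div, one_mul]; linarith
lemma S5 {b : Real} (hb0 : 0 < b) (hb1 : b ≤ 1) : ∃ C > 0, ∀ᶠ T : Real in atTop,
    |(∫ α in (0:Real)..1, kk b α * MM T (α * log T)) -
      T * (log T / (2 * sqrt π) * (1/2 + ∫ α in (0:Real)..1, α * kk b α))| ≤ C * T := by
  obtain ⟨C1, hC1, h1⟩ := offdiag
  obtain ⟨C2, hC2, h2⟩ := H_zero hb0 hb1
  obtain ⟨C3, hC3, h3⟩ := diag hb0 hb1
  refine ⟨2 * C1 + C2 + C3, by positivity, ?_⟩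
  filter_upwards [ev_basic] with T ⟨hT, hL, hN, hl1, hl2, hl3⟩
  have hT0 : 0 < T := by linarith
  set L := log T with hLd
  have hcc : ∀ n, Continuous fun α : Real => cc L (α * L) n := fun n => by
    have := g_cont; unfold cc; fun_prop
  have hk := kk_cont b
  have hM : Continuous fun α : Real => MM T (α * L) := (Dm_cont T hN).comp (by fun_prop)
  have e1 : ∫ α in (0:Real)..1, kk b α * (T * ∑ n ∈ Finset.range (NT T), cc L (α * L) n ^ 2) =
      T * (∑ n ∈ Finset.range (NT T), vL n^2 / n * HH b L (log n) + L^2 * HH b L 0) := by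
    have hs := sum_ww2 L (NT T) hN (fun n => 1 / n * HH b L (log n))
    have hs2 : (∑ n ∈ Finset.range (NT T), vL n^2 / n * HH b L (log n) + L^2 * HH b L 0) =
        ∑ n ∈ Finset.range (NT T), ww L n ^ 2 * (1 / n * HH b L (log n)) := by
      rw [hs]; simp only [Nat.cast_one, Real.log_one, div_one, one_mul, add_left_inj]
      exact Finset.sum_congr rfl fun n _ => by ring
    rw [hs2, Finset.mul_sum]
    have : ∀ α, kk b α * (T * ∑ n ∈ Finset.range (NT T), cc L (α * L) n ^ 2) =
        ∑ n ∈ Finset.range (NT T), T * (kk b α * cc L (α * L) n ^ 2) := fun α => by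
      rw [Finset.mul_sum, Finset.mul_sum]; exact Finset.sum_congr rfl fun n _ => by ring
    simp only [this]
    rw [intervalIntegral.integral_finsetSum fun n _ => Continuous.intervalIntegrable (by have := hcc n; fun_prop) _ _]
    refine Finset.sum_congr rfl fun n _ => ?_
    rw [intervalIntegral.integral_const_mul]; congr 1
    rcases Nat.eq_zero_or_pos n with rfl | hn
    · simp [cc, ww_zero]
    rw [HH, ← mul_assoc, ← intervalIntegral.integral_const_mul]
    refine intervalIntegral.integral_congr fun α _ => ?_
    have : exp (-(log n / 2))^2 = 1 / n := by
      rw [← Real.exp_nat_mul, show ((2:Nat):Real) * -(log n / 2) = - log n by push_cast; ring, Real.exp_neg, Real.exp_log (by exact_mod_cast hn), one_div]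
    simp only [cc, mul_pow, this]; ring
  have e2 : |(∫ α in (0:Real)..1, kk b α * MM T (α * L)) - ∫ α in (0:Real)..1, kk b α * (T * ∑ n ∈ Finset.range (NT T), cc L (α * L) n ^ 2)| ≤ 2 * C1 * T := by
    have hcs : Continuous fun α : Real => ∑ n ∈ Finset.range (NT T), cc L (α * L) n ^ 2 := continuous_finsetSum _ fun n _ => (hcc n).pow 2
    rw [← intervalIntegral.integral_sub (Continuous.intervalIntegrable (by fun_prop) _ _) (Continuous.intervalIntegrable (by fun_prop) _ _),
      ← Real.norm_eq_abs]
    refine (intervalIntegral.norm_integral_le_of_norm_le (g := fun α => C1 * L^2 * ((1 - α) * exp (α * L)) + C1 * L^3) zero_le_one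
      (Eventually.of_forall fun α hα => ?_) (Continuous.intervalIntegrable (by fun_prop) _ _)).trans ?_
    · have ho := h1 T (α * L) hL hT0 hN hl2 (mul_nonneg hα.1.le (by linarith))
      rw [← mul_sub, Real.norm_eq_abs, abs_mul, abs_of_nonneg (kk_nn hα.2)]
      refine (mul_le_mul (kk_le hα.2) ho (abs_nonneg _) (by linarith [hα.2])).trans ?_
      have : (1 - α) * (C1 * L^3) ≤ C1 * L^3 := mul_le_of_le_one_left (by positivity) (by linarith [hα.1])
      linarith
    · rw [intervalIntegral.integral_add (Continuous.intervalIntegrable (by fun_prop) _ _) (Continuous.intervalIntegrable (by fun_prop) _ _),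
        intervalIntegral.integral_const_mul, intervalIntegral.integral_const]
      have h := mul_le_mul_of_nonneg_left (exp_mean hL) (show 0 ≤ C1 * L^2 by positivity)
      rw [hLd, Real.exp_log hT0, ← hLd, show C1 * L^2 * (T / L^2) = C1 * T by field_simp] at h
      have := mul_le_mul_of_nonneg_left hl3 hC1.le
      simp only [sub_zero, one_smul]; linarith
  rw [e1] at e2
  have a2 := h2 L hL
  have a3 := h3 L (NT T) hL hl1 hl2
  have a4 : |L^2 * HH b L 0 - L / (4 * sqrt π)| ≤ C2 := by
    have : L^2 * HH b L 0 - L / (4 * sqrt π) = L^2 * (HH b L 0 - 1 / (4 * sqrt π * L)) := by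
      have : sqrt π ≠ 0 := by positivity
      field_simp
    rw [this, abs_mul, abs_of_nonneg (sq_nonneg L)]
    exact (mul_le_mul_of_nonneg_left a2 (sq_nonneg L)).trans (le_of_eq (by field_simp))
  set J := ∫ α in (0:Real)..1, α * kk b α
  set S := ∑ n ∈ Finset.range (NT T), vL n^2 / n * HH b L (log n)
  have a5 : |T * (S + L^2 * HH b L 0) - T * (L / (2 * sqrt π) * (1/2 + J))| ≤ (C2 + C3) * T := by
    rw [← mul_sub, abs_mul, abs_of_pos hT0, mul_comm]
    refine mul_le_mul_of_nonneg_right ?_ hT0.le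
    rw [show S + L^2 * HH b L 0 - L / (2 * sqrt π) * (1/2 + J) = (L^2 * HH b L 0 - L / (4 * sqrt π)) + (S - L / (2 * sqrt π) * J) by
      ring]
    exact (abs_add_le _ _).trans (add_le_add a4 a3)
  have := abs_sub_le (∫ α in (0:Real)..1, kk b α * MM T (α * L)) (T * (S + L^2 * HH b L 0)) (T * (L / (2 * sqrt π) * (1/2 + J)))
  linarith
lemma sq_cmp (a d : Complex) {η e : Real} (hη : 0 < η) (h : ‖a - d‖ ≤ e) : |‖a‖^2 - ‖d‖^2| ≤ η * ‖d‖^2 + (1 + 1/η) * e^2 := by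
  have h1 : |‖a‖ - ‖d‖| ≤ e := (abs_norm_sub_norm_le a d).trans h
  have he : 0 ≤ e := (norm_nonneg _).trans h
  have h3 : ‖a‖ ≤ ‖d‖ + e := by have := (abs_le.1 h1).2; linarith
  rw [sq_sub_sq, abs_mul, abs_of_nonneg (by positivity : 0 ≤ ‖a‖ + ‖d‖)]
  have h2 : (‖a‖ + ‖d‖) * |‖a‖ - ‖d‖| ≤ (2 * ‖d‖ + e) * e := mul_le_mul (by linarith) h1 (abs_nonneg _) (by positivity)
  have h4 : 2 * ‖d‖ * e ≤ η * ‖d‖^2 + 1/η * e^2 := by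
    have : 0 ≤ (η * ‖d‖ - e)^2 / η := by positivity
    have e : (η * ‖d‖ - e)^2 / η = η * ‖d‖^2 + 1/η * e^2 - 2 * ‖d‖ * e := by field_simp; ring
    linarith
  nlinarith
lemma comb {b : Real} (hb0 : 0 < b) (hb1 : b ≤ 1) (hbox : ∀ᶠ T in atTop, BoxAt b T) : ∃ C > 0, ∀ᶠ T : Real in atTop, ∀ u, 0 ≤ u → u ≤ log T →
    |FF T u - MM T u| ≤ 1 / sqrt (log T) * MM T u + C * (sqrt (log T) * T) := by
  obtain ⟨C, hC, h⟩ := approx hb0 hb1 hbox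
  set G := ∫ y : Real, exp (-(1/2) * y^2) with hG
  have hG0 : 0 ≤ G := integral_nonneg fun _ => (Real.exp_pos _).le
  refine ⟨2 * (3 * C^2 * (1 + 2 * G)), by positivity, ?_⟩
  filter_upwards [ev_basic, h] with T ⟨hT, hL, hN, _, _, hl3⟩ h u hu0 hu1
  set L := log T with hLd
  have hs1 : 1 ≤ sqrt L := Real.one_le_sqrt.2 hL
  set η := 1 / sqrt L with hη
  have hη0 : 0 < η := by positivity
  have hTT : T ≤ 2 * T := by linarith
  have hdc : Continuous fun t => ‖Dm T t u‖^2 := by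
    simp only [Dm_sq T _ u hN]; fun_prop
  set d : Real → Complex := fun t => (Ioc T (2*T)).indicator (fun t => Dm T t u) t
  have hd2 : ∀ t, ‖d t‖^2 = (Ioc T (2*T)).indicator (fun t => ‖Dm T t u‖^2) t := fun t => by
    by_cases ht : t ∈ Ioc T (2*T) <;> simp [d, ht]
  have hdi : Integrable fun t => ‖d t‖^2 := by
    simp only [hd2]
    rw [integrable_indicator_iff measurableSet_Ioc]
    exact (hdc.intervalIntegrable T (2*T)).1
  have hdv : ∫ t, ‖d t‖^2 = MM T u := by
    simp only [hd2]
    rw [integral_indicator measurableSet_Ioc, MM, intervalIntegral.integral_of_le hTT]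
  set R : Real → Real := fun t => 3 * C^2 * ((Ioc T (2*T)).indicator (fun _ => (1:Real)) t + (L^2 * exp (-(1/2)*(t-T)^2) + L^2 * exp (-(1/2)*(t-2*T)^2)))
  have i1 : Integrable fun t => (Ioc T (2*T)).indicator (fun _ => (1:Real)) t := by
    rw [integrable_indicator_iff measurableSet_Ioc]; exact (continuous_const.intervalIntegrable T (2*T)).1
  have i2 := fun c => (gauss_int.comp_sub_right c).const_mul (L^2)
  have i3 : Integrable fun t => L^2 * exp (-(1/2)*(t-T)^2) + L^2 * exp (-(1/2)*(t-2*T)^2) := (i2 T).add (i2 (2*T))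
  have hRi : Integrable R := (i1.add i3).const_mul _
  have hRv : ∫ t, R t ≤ 3 * C^2 * (1 + 2 * G) * T := by
    simp only [R]
    rw [integral_const_mul, integral_add i1 i3, integral_add (i2 T) (i2 (2*T)), integral_const_mul, integral_const_mul,
      integral_sub_right_eq_self (fun y : Real => exp (-(1/2) * y^2)), integral_sub_right_eq_self (fun y : Real => exp (-(1/2) * y^2)), ← hG,
      integral_indicator measurableSet_Ioc, ← intervalIntegral.integral_of_le hTT, intervalIntegral.integral_const, mul_assoc (3 * C^2)]
    refine mul_le_mul_of_nonneg_left ?_ (by positivity)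
    have : L^2 ≤ T := le_trans (by nlinarith [sq_nonneg L]) hl3
    have := mul_le_mul_of_nonneg_right this hG0
    simp only [smul_eq_mul]; linarith
  have key : ∀ t, |‖Ab T t u‖^2 - ‖d t‖^2| ≤ η * ‖d t‖^2 + (1 + 1/η) * R t := fun t => by
    refine (sq_cmp _ _ hη0 (h u hu0 hu1 t)).trans (add_le_add le_rfl (mul_le_mul_of_nonneg_left ?_ (by positivity)))
    simp only [R]
    set p := (Ioc T (2*T)).indicator (fun _ => (1:Real)) t with hp
    have hpp : p^2 = p := by by_cases ht : t ∈ Ioc T (2*T) <;> simp [hp, ht]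
    have hx : ∀ y : Real, exp (-(1/2) * y^2)^2 ≤ exp (-(1/2) * y^2) := fun y => by
      rw [sq]; exact mul_le_of_le_one_left (Real.exp_pos _).le (Real.exp_le_one_iff.2 (by nlinarith [sq_nonneg y]))
    have q1 := hx (t - T); have q2 := hx (t - 2*T)
    set x := exp (-(1/2) * (t-T)^2)
    set y := exp (-(1/2) * (t-2*T)^2)
    have w1 := mul_le_mul_of_nonneg_left q1 (sq_nonneg L)
    have w2 := mul_le_mul_of_nonneg_left q2 (sq_nonneg L)
    have e : C * p + C * L * (x + y) = C * (p + L * x + L * y) := by ring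
    rw [e, mul_pow, mul_assoc, mul_left_comm]
    refine mul_le_mul_of_nonneg_left ?_ (sq_nonneg C)
    nlinarith [sq_nonneg (p - L*x), sq_nonneg (p - L*y), sq_nonneg (L*x - L*y)]
  have hA := Ab_sq_int T u
  rw [FF, ← hdv, ← integral_sub hA hdi, ← Real.norm_eq_abs]
  refine (norm_integral_le_of_norm_le ((hdi.const_mul η).add (hRi.const_mul (1 + 1/η))) (Eventually.of_forall key)).trans ?_
  simp only [Pi.add_apply]
  rw [integral_add (hdi.const_mul η) (hRi.const_mul (1 + 1/η)), integral_const_mul, integral_const_mul]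
  refine add_le_add le_rfl ?_
  have h1 : 1 + 1/η ≤ 2 * sqrt L := by rw [hη, one_div_one_div]; linarith
  refine (mul_le_mul h1 hRv (integral_nonneg fun t => ?_) (by positivity)).trans (le_of_eq (by ring))
  have : 0 ≤ (Ioc T (2*T)).indicator (fun _ => (1:Real)) t := indicator_nonneg (fun _ _ => zero_le_one) t
  simp only [R]; positivity
lemma XX {b : Real} (hb0 : 0 < b) (hb1 : b ≤ 1) (hbox : ∀ᶠ T in atTop, BoxAt b T) : ∃ C > 0, ∀ᶠ T : Real in atTop,
    |(∫ α in (0:Real)..1, kk b α * FF T (α * log T)) -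
      T * (log T / (2 * sqrt π) * (1/2 + ∫ α in (0:Real)..1, α * kk b α))| ≤ C * (sqrt (log T) * T) := by
  obtain ⟨C5, hC5, h5⟩ := S5 hb0 hb1
  obtain ⟨C6, hC6, h6⟩ := comb hb0 hb1 hbox
  refine ⟨2 + 2 * C5 + C6, by positivity, ?_⟩
  filter_upwards [ev_basic, h5, h6] with T ⟨hT, hL, hN, _, _, _⟩ h5 h6
  set L := log T with hLd
  have hs1 : 1 ≤ sqrt L := Real.one_le_sqrt.2 hL
  have hsq : sqrt L * sqrt L = L := Real.mul_self_sqrt (by linarith)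
  have hk := kk_cont b
  have hM : Continuous fun α : Real => MM T (α * L) := (Dm_cont T hN).comp (by fun_prop)
  have hF : Continuous fun α : Real => FF T (α * L) := (FF_cont T).comp (by fun_prop)
  set X := ∫ α in (0:Real)..1, kk b α * FF T (α * L)
  set Y := ∫ α in (0:Real)..1, kk b α * MM T (α * L) with hY
  have hJ : |∫ α in (0:Real)..1, α * kk b α| ≤ 1 := by
    have := intervalIntegral.norm_integral_le_of_norm_le_const (a := 0) (b := 1) (f := fun α => α * kk b α) (C := 1) fun α hα => by
      rw [uIoc_of_le zero_le_one] at hα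
      rw [Real.norm_eq_abs, abs_mul, abs_of_pos hα.1, abs_of_nonneg (kk_nn hα.2)]
      have := kk_le (b := b) hα.2
      nlinarith [hα.1, hα.2, kk_nn (b := b) hα.2]
    simpa using this
  set J := ∫ α in (0:Real)..1, α * kk b α
  have hXY : |X - Y| ≤ 1 / sqrt L * Y + C6 * (sqrt L * T) := by
    rw [← intervalIntegral.integral_sub (Continuous.intervalIntegrable (by fun_prop) _ _) (Continuous.intervalIntegrable (by fun_prop) _ _), ← Real.norm_eq_abs]
    refine (intervalIntegral.norm_integral_le_of_norm_le (g := fun α => 1 / sqrt L * (kk b α * MM T (α * L)) + C6 * (sqrt L * T)) zero_le_one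
      (Eventually.of_forall fun α hα => ?_) (Continuous.intervalIntegrable (by fun_prop) _ _)).trans ?_
    · have h := h6 (α * L) (mul_nonneg hα.1.le (by linarith)) (mul_le_of_le_one_left (by linarith) hα.2)
      rw [← mul_sub, Real.norm_eq_abs, abs_mul, abs_of_nonneg (kk_nn hα.2)]
      refine (mul_le_mul_of_nonneg_left h (kk_nn hα.2)).trans ?_
      have : kk b α * (C6 * (sqrt L * T)) ≤ C6 * (sqrt L * T) :=
        mul_le_of_le_one_left (by positivity) ((kk_le hα.2).trans (by linarith [hα.1]))
      linarith
    · rw [intervalIntegral.integral_add (Continuous.intervalIntegrable (by fun_prop) _ _) (Continuous.intervalIntegrable (by fun_prop) _ _),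
        intervalIntegral.integral_const_mul, intervalIntegral.integral_const, ← hY]
      simp
  set X0 := T * (L / (2 * sqrt π) * (1/2 + J)) with hX0
  have hp1 : 1 ≤ sqrt π := by rw [Real.one_le_sqrt]; linarith [Real.pi_gt_three]
  have hX0' : X0 ≤ T * (2 * L) := by
    refine mul_le_mul_of_nonneg_left ?_ (by linarith)
    have : L / (2 * sqrt π) ≤ L := div_le_self (by linarith) (by linarith)
    have h0 : 0 ≤ L / (2 * sqrt π) := by positivity
    nlinarith [(abs_le.1 hJ).2]
  have hY2 : 1 / sqrt L * Y ≤ 2 * (sqrt L * T) + C5 * (sqrt L * T) := by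
    have : Y ≤ T * (2 * L) + C5 * T := by have := (abs_le.1 h5).2; linarith
    refine (mul_le_mul_of_nonneg_left this (by positivity)).trans ?_
    rw [← hsq]
    have e : 1 / sqrt L * (T * (2 * (sqrt L * sqrt L)) + C5 * T) = 2 * (sqrt L * T) + C5 * (1 / sqrt L * T) := by field_simp
    rw [hsq, ← hsq] at *
    rw [e]
    have : 1 / sqrt L ≤ sqrt L := by rw [div_le_iff₀ (by positivity)]; nlinarith
    have := mul_le_mul_of_nonneg_right this (by linarith : 0 ≤ T)
    nlinarith
  have h7 : C5 * T ≤ C5 * (sqrt L * T) := mul_le_mul_of_nonneg_left (by nlinarith) hC5.le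
  have := abs_sub_le X Y X0
  linarith
lemma main2 {b : Real} (hb0 : 0 < b) (hb1 : b ≤ 1) (hbox : ∀ᶠ T in atTop, BoxAt b T) : 
    ∃ C > 0, ∀ᶠ T in atTop, ∃ E : Real, |E| ≤ C / sqrt (log T) ∧
      (∑ᶠ ρ ∈ zeroBand T, ∑ᶠ ρ' ∈ zeroBand T,
        (zetaMult ρ : Real) * (zetaMult ρ' : Real) *
          (Kb b (-I * (ρ - ρ') * log T)).re)
      = (1 / (2 * π)) *
          (1 + 2 * (∫ α in (0:Real)..1, α * (1 - α) / cosh (b * α)) + E) *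
          (T / (2 * π)) * log T := by
  obtain ⟨C1, hC1, h1⟩ := XX hb0 hb1 hbox
  obtain ⟨C2, hC2, h2⟩ := S1 hb1 hbox
  refine ⟨4 * π^2 * (C1 + C2), by positivity, ?_⟩
  filter_upwards [ev_basic, h1, h2] with T ⟨hT, hL, _, _, _, _⟩ h1 h2
  have hT0 : 0 < T := by linarith
  have e1 : (∑ᶠ ρ ∈ zeroBand T, ∑ᶠ ρ' ∈ zeroBand T, (zetaMult ρ : Real) * (zetaMult ρ' : Real) *
      (Kb b (-I * (ρ - ρ') * log T)).re) = ∑ ρ ∈ Bd T, ∑ ρ' ∈ Bd T, (mu ρ : Real) * (mu ρ' : Real) *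
      (Kb b (-I * (ρ - ρ') * log T)).re := by
    have hz : zeroBand T = ↑(Bd T) := by ext ρ; rw [Finset.mem_coe, mem_Bd']
    have hm : ∀ ρ ∈ Bd T, zetaMult ρ = mu ρ := fun ρ h => zetaMult_eq (mem_Bd'.1 h).1
    rw [hz, finsum_mem_coe_finset]
    refine Finset.sum_congr rfl fun ρ hρ => ?_
    rw [finsum_mem_coe_finset]
    exact Finset.sum_congr rfl fun ρ' hρ' => by rw [hm ρ hρ, hm ρ' hρ']
  rw [e1]
  rw [Sw_eq] at h2
  have e2 : ∫ α in (0:Real)..1, α * (1 - α) / cosh (b * α) = ∫ α in (0:Real)..1, α * kk b α :=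
    intervalIntegral.integral_congr fun α _ => by simp only [kk]; ring
  rw [e2]
  set S := ∑ ρ ∈ Bd T, ∑ ρ' ∈ Bd T, (mu ρ : Real) * (mu ρ' : Real) * (Kb b (-I * (ρ - ρ') * log T)).re
  set J := ∫ α in (0:Real)..1, α * kk b α
  set X := ∫ α in (0:Real)..1, kk b α * FF T (α * log T)
  set L := log T
  have hs1 : 1 ≤ sqrt L := Real.one_le_sqrt.2 hL
  have hsq : sqrt L * sqrt L = L := Real.mul_self_sqrt (by linarith)
  have hpp : sqrt π * sqrt π = π := Real.mul_self_sqrt Real.pi_pos.le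
  have hL0 : 0 < L := by linarith
  have hpi := Real.pi_pos
  have hsp : 0 < sqrt π := by positivity
  have e3 : 1 / (π * sqrt π) * (T * (L / (2 * sqrt π) * (1/2 + J))) = T * L / (4 * π^2) * (1 + 2 * J) := by
    rw [show 1 / (π * sqrt π) * (T * (L / (2 * sqrt π) * (1/2 + J))) = T * L * (1/2 + J) / (2 * π * (sqrt π * sqrt π)) by
      field_simp, hpp]
    field_simp; ring
  have hS : |S - T * L / (4 * π^2) * (1 + 2 * J)| ≤ (C1 + C2) * (sqrt L * T) := by
    have a := abs_sub_le S (1 / (π * sqrt π) * X) (T * L / (4 * π^2) * (1 + 2 * J))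
    have c : |1 / (π * sqrt π) * X - T * L / (4 * π^2) * (1 + 2 * J)| ≤ C1 * (sqrt L * T) := by
      rw [← e3, ← mul_sub, abs_mul]
      refine (mul_le_of_le_one_left (abs_nonneg _) ?_).trans h1
      rw [abs_of_pos (by positivity), div_le_one (by positivity)]
      have : 1 ≤ sqrt π := by rw [Real.one_le_sqrt]; linarith [Real.pi_gt_three]
      nlinarith [Real.pi_gt_three]
    have : C2 * T ≤ C2 * (sqrt L * T) := mul_le_mul_of_nonneg_left (by nlinarith) hC2.le
    linarith
  refine ⟨(S - T * L / (4 * π^2) * (1 + 2 * J)) * (4 * π^2 / (T * L)), ?_, ?_⟩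
  · rw [abs_mul, abs_of_pos (show 0 < 4 * π^2 / (T * L) by positivity)]
    refine (mul_le_mul_of_nonneg_right hS (by positivity)).trans (le_of_eq ?_)
    rw [show T * L = T * (sqrt L * sqrt L) by rw [hsq]]
    field_simp
  · field_simp; ring
lemma beta_exp {s : Complex} (h0 : 0 < s.re) (h1 : s.re < 1) : Integrable (fun w : Real => Complex.exp (s * w) / (1 + Complex.exp w)) ∧
    ∫ w : Real, Complex.exp (s * w) / (1 + Complex.exp w) = π / Complex.sin (π * s) := by
  have hd : ∀ x ∈ (univ : Set Real), HasDerivWithinAt Real.sigmoid (Real.sigmoid x * (1 - Real.sigmoid x)) univ x :=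
    fun x _ => (Real.hasDerivAt_sigmoid x).hasDerivWithinAt
  set h : Real → Complex := fun x => (x:Complex) ^ (s - 1) * (1 - (x:Complex)) ^ ((1 - s) - 1)
  have him : Real.sigmoid '' univ = Ioo 0 1 := by rw [image_univ, Real.range_sigmoid]
  have he : ∀ w : Real, |Real.sigmoid w * (1 - Real.sigmoid w)| • h (Real.sigmoid w) = Complex.exp (s * w) / (1 + Complex.exp w) := fun w => by
    have p1 := Real.sigmoid_pos w
    have p2 : 0 < 1 - Real.sigmoid w := by linarith [Real.sigmoid_lt_one w]
    have hew := Real.exp_pos w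
    have c0 : (1 + Complex.exp w) ≠ 0 := by
      rw [← Complex.ofReal_exp, ← Complex.ofReal_one, ← Complex.ofReal_add]; exact_mod_cast (by positivity : 1 + exp w ≠ 0)
    have q2 : 1 - Real.sigmoid w = (1 + exp w)⁻¹ := by rw [← Real.sigmoid_neg, Real.sigmoid_def, neg_neg]
    have q1 : Real.sigmoid w = exp w * (1 + exp w)⁻¹ := by
      rw [← q2, ← Real.sigmoid_neg, ← Real.sigmoid_mul_rexp_neg, mul_left_comm, ← Real.exp_add]; simp
    have l1 : Complex.log (Real.sigmoid w : Real) = w - log (1 + exp w) := by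
      rw [← Complex.ofReal_log p1.le, q1, Real.log_mul hew.ne' (by positivity), Real.log_inv, Real.log_exp]; push_cast; ring
    have l2 : Complex.log ((1 - Real.sigmoid w : Real) : Complex) = - log (1 + exp w) := by
      rw [← Complex.ofReal_log p2.le, q2, Real.log_inv]; push_cast; ring
    have e0 : Complex.exp (log (1 + exp w) : Real) = 1 + Complex.exp w := by
      rw [← Complex.ofReal_exp, Real.exp_log (by positivity)]; push_cast; ring
    rw [abs_of_pos (mul_pos p1 p2), Complex.real_smul]
    simp only [h]
    rw [show (1:Complex) - (Real.sigmoid w : Real) = ((1 - Real.sigmoid w : Real) : Complex) by push_cast; ring,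
      Complex.cpow_def_of_ne_zero (by exact_mod_cast p1.ne'), Complex.cpow_def_of_ne_zero (by exact_mod_cast p2.ne'), l1, l2, Complex.ofReal_mul]
    nth_rw 1 [← Complex.exp_log (x := ((Real.sigmoid w : Real) : Complex)) (by exact_mod_cast p1.ne')]
    rw [← Complex.exp_log (x := ((1 - Real.sigmoid w : Real) : Complex)) (by exact_mod_cast p2.ne'), l1, l2, eq_div_iff c0, ← e0,
      ← Complex.exp_add, ← Complex.exp_add, ← Complex.exp_add, ← Complex.exp_add]
    congr 1; ring
  have hb := Complex.betaIntegral_convergent (u := s) (v := 1 - s) h0 (by simpa using h1)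
  constructor
  · have := (integrableOn_image_iff_integrableOn_abs_deriv_smul MeasurableSet.univ hd Real.sigmoid_injective.injOn h).1 (by
      rw [him, ← integrableOn_Ioc_iff_integrableOn_Ioo]; exact hb.1)
    simpa only [he, integrableOn_univ] using this
  · have h2 := integral_image_eq_integral_abs_deriv_smul MeasurableSet.univ hd Real.sigmoid_injective.injOn h
    simp only [he, him, setIntegral_univ] at h2
    rw [← h2, ← integral_Ioc_eq_integral_Ioo, ← intervalIntegral.integral_of_le zero_le_one, ← Complex.Gamma_mul_Gamma_one_sub,
      Complex.Gamma_mul_Gamma_eq_betaIntegral h0 (by simpa using h1)]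
    simp [Complex.betaIntegral, h]
lemma cosh_ft {b : Real} (hb : 0 < b) {c : Complex} (hc : |c.re| < b) : Integrable (fun α : Real => Complex.exp (c * α) / cosh (b * α)) ∧
    ∫ α : Real, Complex.exp (c * α) / cosh (b * α) = 1 / b * (π / Complex.sin (π * ((c + b) / (2 * b)))) := by
  have hbC : (b:Complex) ≠ 0 := by exact_mod_cast hb.ne'
  have hr : ((c + b) / (2 * b)).re = (c.re + b) / (2 * b) := by
    rw [show (2 * (b:Complex)) = ((2 * b : Real) : Complex) by push_cast; ring, Complex.div_ofReal_re]; simp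
  obtain ⟨a1, a2⟩ := abs_lt.1 hc
  obtain ⟨i1, i2⟩ := beta_exp (s := (c + b) / (2 * b)) (by rw [hr]; apply div_pos <;> linarith) (by rw [hr, div_lt_one (by positivity)]; linarith)
  set h : Real → Complex := fun w => Complex.exp ((c + b) / (2 * b) * w) / (1 + Complex.exp w)
  have he : ∀ α : Real, Complex.exp (c * α) / cosh (b * α) = 2 * h (2 * b * α) := fun α => by
    have c0 : (1 + Complex.exp ((2 * b * α : Real) : Complex)) ≠ 0 := by
      rw [← Complex.ofReal_exp, ← Complex.ofReal_one, ← Complex.ofReal_add]; exact_mod_cast (by positivity : 1 + exp (2*b*α) ≠ 0)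
    have c1 : ((cosh (b * α) : Real) : Complex) ≠ 0 := by exact_mod_cast (Real.cosh_pos _).ne'
    simp only [h]
    rw [mul_div_assoc', div_eq_div_iff c1 c0, Complex.ofReal_cosh, Complex.cosh]
    rw [show (c + b) / (2 * b) * ((2 * b * α : Real) : Complex) = c * α + b * α by push_cast; field_simp, Complex.exp_add,
      show ((2 * b * α : Real) : Complex) = b * α + b * α by push_cast; ring, Complex.exp_add, Complex.ofReal_mul, Complex.exp_neg]
    have := Complex.exp_ne_zero ((b:Complex) * α)
    field_simp; ring
  simp only [he]
  refine ⟨(i1.comp_mul_left' (by positivity : 2 * b ≠ 0)).const_mul 2, ?_⟩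
  rw [integral_const_mul, Measure.integral_comp_mul_left h, i2, abs_of_pos (by positivity), Complex.real_smul]
  push_cast; field_simp
lemma sin_lb (z : Complex) (h : 0 < Real.sin z.re) : 0 < (1 / Complex.sin z).re ∧ ‖1 / Complex.sin z‖ ≤ 1 / Real.sin z.re * (1 + (z.im / 2)^2)⁻¹ := by
  have hre : (Complex.sin z).re = Real.sin z.re * cosh z.im := by
    rw [Complex.sin_eq, ← Complex.ofReal_sin, ← Complex.ofReal_cosh, ← Complex.ofReal_cos, ← Complex.ofReal_sinh, ← Complex.ofReal_mul, ← Complex.ofReal_mul,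
      Complex.add_re, Complex.re_ofReal_mul, Complex.ofReal_re, Complex.I_re, mul_zero, add_zero]
  have hc : 1 + (z.im/2)^2 ≤ cosh z.im := by
    rw [← Real.cosh_abs, Real.cosh_eq]
    have := Real.quadratic_le_exp_of_nonneg (abs_nonneg z.im)
    have := Real.add_one_le_exp (-|z.im|)
    rw [sq_abs] at *
    linarith
  have hp : 0 < (Complex.sin z).re := by rw [hre]; have := Real.cosh_pos z.im; positivity
  have hn : Complex.sin z ≠ 0 := fun e => by rw [e] at hp; simp at hp
  constructor
  · rw [one_div, Complex.inv_re]; have := Complex.normSq_pos.2 hn; positivity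
  · rw [norm_div, norm_one, ← one_div, div_mul_div_comm, one_mul]
    refine one_div_le_one_div_of_le (by positivity) ((mul_le_mul_of_nonneg_left hc h.le).trans ?_)
    rw [← hre]; exact Complex.re_le_norm _
lemma fej (θ : Real) : 0 ≤ ∫ α in (-1:Real)..1, jF α * Real.cos (θ * α) := by
  rw [even_int (fun α => jF α * Real.cos (θ * α)) (by have := jF_cont; fun_prop) (fun α => by simp [jF])]
  refine mul_nonneg (by norm_num) ?_
  have e : ∫ α in (0:Real)..1, jF α * Real.cos (θ * α) = ∫ α in (0:Real)..1, (1 - α) * Real.cos (θ * α) :=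
    intervalIntegral.integral_congr fun α hα => by
      rw [uIcc_of_le zero_le_one] at hα
      simp only [jF, abs_of_nonneg hα.1, max_eq_left (sub_nonneg.2 hα.2)]
  rw [e]
  by_cases h : θ = 0
  · simp only [h, zero_mul, Real.cos_zero, mul_one]
    exact intervalIntegral.integral_nonneg zero_le_one fun α hα => sub_nonneg.2 hα.2
  have : ∀ x ∈ uIcc (0:Real) 1, HasDerivAt (fun α => (1 - α) * (Real.sin (θ * α) / θ) - Real.cos (θ * α) / θ^2) ((1 - x) * Real.cos (θ * x)) x := fun x _ => by
    have h0 : HasDerivAt (fun α : Real => θ * α) (θ * 1) x := (hasDerivAt_id x).const_mul θ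
    refine ((((hasDerivAt_id x).const_sub 1).mul (h0.sin.div_const θ)).sub (h0.cos.div_const (θ^2))).congr_deriv ?_
    simp only [id]; field_simp; ring
  rw [intervalIntegral.integral_eq_sub_of_hasDerivAt this (Continuous.intervalIntegrable (by fun_prop) _ _)]
  simp only [sub_self, zero_mul, mul_one, mul_zero, Real.sin_zero, Real.cos_zero, zero_div]
  have : 0 ≤ (1 - Real.cos θ) / θ^2 := div_nonneg (by linarith [Real.cos_le_one θ]) (sq_nonneg _)
  rw [sub_div] at this; linarith
open scoped FourierTransform
lemma jF_supp (α : Real) (h : α ∉ Icc (-1:Real) 1) : jF α = 0 := by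
  rw [jF, max_eq_right]
  by_contra hh
  exact h (abs_le.1 (by linarith))
lemma jF_int (f : Real → Complex) : ∫ α : Real, (jF α : Complex) * f α = ∫ α in (-1:Real)..1, (jF α : Complex) * f α := by
  refine (intervalIntegral.integral_eq_integral_of_support_subset fun α hα => ?_).symm
  by_contra h
  refine hα ?_
  by_cases h1 : α ∈ Icc (-1:Real) 1
  · have : α = -1 := by
      by_contra h2
      exact h ⟨lt_of_le_of_ne h1.1 (Ne.symm h2), h1.2⟩
    simp [this, jF]
  · simp [jF_supp α h1]
lemma pos {b y : Real} (hb : 0 < b) (hy : |y| < b) (x : Real) :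
    0 < (∫ α in (-1:Real)..1, (jF α : Complex) * (Complex.exp ((y + x * I) * α) / cosh (b * α))).re := by
  set f : Real → Complex := fun α => Complex.exp ((y:Complex) * α) / cosh (b * α) with hf
  have hfc : Continuous f := by
    refine Continuous.div (by fun_prop) (by fun_prop) fun α => ?_
    exact_mod_cast (Real.cosh_pos _).ne'
  have hfi : Integrable f := (cosh_ft hb (c := y) (by simpa using hy)).1
  set z : Real → Complex := fun w => π * (((y + -2 * π * w * I) + b) / (2 * b)) with hz
  have hP : ∀ w, 𝓕 f w = (π / b : Real) * (1 / Complex.sin (z w)) := fun w => by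
    rw [Real.fourier_real_eq_integral_exp_smul]
    have h := (cosh_ft hb (c := y + -2 * π * w * I) (by simpa using hy)).2
    rw [show ((π / b : Real) : Complex) * (1 / Complex.sin (z w)) = 1 / b * (π / Complex.sin (z w)) by push_cast; ring, hz, ← h]
    refine integral_congr_ae (Eventually.of_forall fun α => ?_)
    simp only [hf, smul_eq_mul]
    rw [mul_div_assoc', ← Complex.exp_add]; congr 2; push_cast; ring
  have hzre : ∀ w, (z w).re = π * ((y + b) / (2 * b)) := fun w => by
    simp only [hz]
    rw [Complex.re_ofReal_mul, show (2 * (b:Complex)) = ((2 * b : Real) : Complex) by push_cast; ring, Complex.div_ofReal_re]; simp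
  have hzim : ∀ w, (z w).im / 2 = -(π ^ 2 / (2 * b)) * w := fun w => by
    simp only [hz]
    rw [Complex.im_ofReal_mul, show (2 * (b:Complex)) = ((2 * b : Real) : Complex) by push_cast; ring, Complex.div_ofReal_im]; simp; ring
  obtain ⟨y1, y2⟩ := abs_lt.1 hy
  have hpi := Real.pi_pos
  have hsin : 0 < Real.sin (π * ((y + b) / (2 * b))) := by
    refine Real.sin_pos_of_pos_of_lt_pi (mul_pos hpi (div_pos (by linarith) (by linarith))) (mul_lt_of_lt_one_right hpi ?_)
    rw [div_lt_one (by linarith)]; linarith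
  have hsl : ∀ w, _ := fun w => sin_lb (z w) (by rw [hzre]; exact hsin)
  have hPc : Continuous (𝓕 f) := VectorFourier.fourierIntegral_continuous Real.continuous_fourierChar continuous_inner hfi
  have hPi : Integrable (𝓕 f) := by
    have hk : -(π ^ 2 / (2 * b)) ≠ 0 := neg_ne_zero.2 (by positivity)
    refine Integrable.mono' (((integrable_inv_one_add_sq.comp_mul_left' hk).const_mul (1 / Real.sin (π * ((y + b) / (2 * b))))).const_mul (π / b))
      hPc.aestronglyMeasurable (Eventually.of_forall fun w => ?_)
    have h := (hsl w).2
    rw [hzre, hzim] at h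
    rw [hP, norm_mul, Complex.norm_real, Real.norm_of_nonneg (by positivity)]
    exact mul_le_mul_of_nonneg_left h (by positivity)
  have hPpos : ∀ w, 0 < (𝓕 f w).re := fun w => by
    rw [hP, Complex.re_ofReal_mul]; exact mul_pos (by positivity) (hsl w).1
  have hinv := hfc.fourierInv_fourier_eq hfi hPi
  set g : Real → Complex := fun α => (jF α : Complex) * Complex.exp (-(x * I) * α) with hg
  have hgc : Continuous g := by have := jF_cont; fun_prop
  have hgi : Integrable g := hgc.integrable_of_hasCompactSupport
    (HasCompactSupport.intro (K := Icc (-1) 1) isCompact_Icc fun α hα => by simp [hg, jF_supp α hα])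
  set Φ : Real → Real := fun w => ∫ α in (-1:Real)..1, jF α * Real.cos ((x + 2 * π * w) * α) with hΦ
  have hG : ∀ w, 𝓕 g w = (Φ w : Complex) := fun w => by
    rw [Real.fourier_real_eq_integral_exp_smul]
    have e : ∀ α : Real, Complex.exp (((-2 * π * α * w : Real) : Complex) * I) • g α =
        (jF α : Complex) * Complex.exp (((-(x + 2 * π * w) * α : Real) : Complex) * I) := fun α => by
      simp only [hg, smul_eq_mul]; rw [mul_left_comm, ← Complex.exp_add]; congr 2; push_cast; ring
    simp only [e]
    rw [jF_int]
    have hc : Continuous fun α : Real => (jF α : Complex) * Complex.exp (((-(x + 2 * π * w) * α : Real) : Complex) * I) := by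
      have := jF_cont; fun_prop
    have hc2 : Continuous fun α : Real => jF α * Real.sin (-(x + 2 * π * w) * α) := by
      have := jF_cont; fun_prop
    have hodd : ∫ α in (-1:Real)..1, jF α * Real.sin (-(x + 2 * π * w) * α) = 0 := by
      have h := intervalIntegral.integral_comp_neg (a := -1) (b := 1) fun α : Real => jF α * Real.sin (-(x + 2 * π * w) * α)
      simp only [neg_neg] at h
      have h2 : ∀ α : Real, jF (-α) * Real.sin (-(x + 2 * π * w) * -α) = -(jF α * Real.sin (-(x + 2 * π * w) * α)) := fun α => by
        rw [mul_neg (-(x + 2 * π * w)), Real.sin_neg]; simp only [jF, abs_neg]; ring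
      simp only [h2] at h
      rw [intervalIntegral.integral_neg] at h; linarith
    have hc1 : Continuous fun α : Real => jF α * Real.cos ((x + 2 * π * w) * α) := by
      have := jF_cont; fun_prop
    have e2 : ∀ α : Real, (jF α : Complex) * Complex.exp (((-(x + 2 * π * w) * α : Real) : Complex) * I) =
        ((jF α * Real.cos ((x + 2 * π * w) * α) : Real) : Complex) + ((jF α * Real.sin (-(x + 2 * π * w) * α) : Real) : Complex) * I := fun α => by
      rw [Complex.exp_mul_I, ← Complex.ofReal_cos, ← Complex.ofReal_sin, neg_mul, Real.cos_neg, Complex.ofReal_mul, Complex.ofReal_mul]; ring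
    simp only [e2]
    have i1 : IntervalIntegrable (fun α : Real => ((jF α * Real.cos ((x + 2 * π * w) * α) : Real) : Complex)) volume (-1) 1 :=
      (Complex.continuous_ofReal.comp hc1).intervalIntegrable _ _
    have i2 : IntervalIntegrable (fun α : Real => ((jF α * Real.sin (-(x + 2 * π * w) * α) : Real) : Complex) * I) volume (-1) 1 :=
      ((Complex.continuous_ofReal.comp hc2).mul continuous_const).intervalIntegrable _ _
    rw [intervalIntegral.integral_add i1 i2,
      intervalIntegral.integral_mul_const, intervalIntegral.integral_ofReal, intervalIntegral.integral_ofReal, hodd]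
    simp [hΦ]
  have hGc : Continuous (𝓕 g) := VectorFourier.fourierIntegral_continuous Real.continuous_fourierChar continuous_inner hgi
  have hΦc : Continuous Φ := by
    have : Φ = fun w => (𝓕 g w).re := by ext w; rw [hG, Complex.ofReal_re]
    rw [this]; exact Complex.continuous_re.comp hGc
  have hΦb : ∀ w, ‖(Φ w : Complex)‖ ≤ ∫ α, ‖g α‖ := fun w => by
    rw [← hG]; exact VectorFourier.norm_fourierIntegral_le_integral_norm _ _ _ _ _
  have key : ∫ α in (-1:Real)..1, (jF α : Complex) * (Complex.exp ((y + x * I) * α) / cosh (b * α)) = ∫ w, 𝓕 f w * (Φ w : Complex) := by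
    have h1 : ∫ ξ, 𝓕 (𝓕 f) ξ • g ξ = ∫ w, 𝓕 f w • 𝓕 g w := by
      simpa using! VectorFourier.integral_fourierIntegral_smul_eq_flip (L := innerₗ Real) Real.continuous_fourierChar continuous_inner hPi hgi
    have h2 : ∀ α, 𝓕 (𝓕 f) (-α) = f α := fun α => by rw [← Real.fourierInv_eq_fourier_neg, hinv]
    rw [← jF_int, ← integral_neg_eq_self] 
    have h3 : ∀ ξ : Real, 𝓕 (𝓕 f) ξ = f (-ξ) := fun ξ => by rw [← h2, neg_neg]
    simp only [h3, hG, smul_eq_mul] at h1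
    rw [← h1]
    refine integral_congr_ae (Eventually.of_forall fun α => ?_)
    simp only [hf, hg]
    rw [show ((jF (-α) : Real) : Complex) = jF α by simp [jF], add_mul, Complex.exp_add]
    rw [show (x:Complex) * I * ((-α : Real) : Complex) = -(x * I) * α by push_cast; ring]; ring
  have hii : Integrable fun w => 𝓕 f w * (Φ w : Complex) :=
    hPi.mul_bdd (c := ∫ α, ‖g α‖) (Complex.continuous_ofReal.comp hΦc).aestronglyMeasurable (Eventually.of_forall hΦb)
  rw [key, ← Complex.reCLM_apply, ← ContinuousLinearMap.integral_comp_comm _ hii]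
  simp only [Complex.reCLM_apply, Complex.re_mul_ofReal]
  have hn : ∀ w, 0 ≤ (𝓕 f w).re * Φ w := fun w => mul_nonneg (hPpos w).le (fej _)
  have hx0 : Φ (-(x / (2 * π))) ≠ 0 := by
    have : Φ (-(x / (2 * π))) = ∫ α in (-1:Real)..1, jF α := by
      simp only [hΦ]; rw [show x + 2 * π * -(x / (2 * π)) = 0 by field_simp; ring]; simp
    rw [this, even_int jF jF_cont (fun α => by simp [jF])]
    have e : ∫ α in (0:Real)..1, jF α = ∫ α in (0:Real)..1, (1 - α) := intervalIntegral.integral_congr fun α hα => by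
      rw [uIcc_of_le zero_le_one] at hα
      simp only [jF, abs_of_nonneg hα.1, max_eq_left (sub_nonneg.2 hα.2)]
    have e3 : ∫ α in (0:Real)..1, (1 - α) = 1 / 2 := by
      rw [intervalIntegral.integral_sub (by simp) (by simp)]; simp; norm_num
    rw [e, e3]; norm_num
  have hc3 : Continuous fun w => (𝓕 f w).re * Φ w := (Complex.continuous_re.comp hPc).mul hΦc
  have hi3 : Integrable fun w => (𝓕 f w).re * Φ w := by
    have := hii.re; simpa [Complex.re_mul_ofReal] using this
  exact integral_pos_of_integrable_nonneg_nonzero hc3 hi3 hn (mul_ne_zero (hPpos _).ne' hx0)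
lemma main1 {b : Real} (hb0 : 0 < b) (hbox : ∀ᶠ T in atTop, BoxAt b T) : ∀ᶠ T in atTop, ∀ ρ ∈ zeroBand T, ∀ ρ' ∈ zeroBand T,
    0 < (Kb b (-I * (ρ - ρ') * log T)).re := by
  filter_upwards [hbox, ev_basic] with T h ⟨_, hL, _⟩ ρ hρ ρ' hρ'
  have a := abs_lt.1 (h ρ hρ); have a' := abs_lt.1 (h ρ' hρ')
  set L := log T
  have hL0 : 0 < L := by linarith
  have hy : |(ρ.re - ρ'.re) * L| < b := by
    rw [abs_mul, abs_of_pos hL0, ← lt_div_iff₀ hL0, show b / L = b / (2 * L) + b / (2 * L) by field_simp; ring]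
    exact abs_lt.2 ⟨by linarith, by linarith⟩
  have hp := pos hb0 hy ((ρ.im - ρ'.im) * L)
  rw [Kb, show (1 / (2 * (π:Complex))) = ((1 / (2 * π) : Real) : Complex) by push_cast; ring, Complex.re_ofReal_mul]
  refine mul_pos (by positivity) ?_
  refine hp.trans_eq ?_
  refine congrArg Complex.re ?_
  refine intervalIntegral.integral_congr fun α _ => ?_
  have : I * (-I * (ρ - ρ') * L) = ((((ρ.re - ρ'.re) * L : Real) : Complex) + (((ρ.im - ρ'.im) * L : Real) : Complex) * I) := by
    rw [show I * (-I * (ρ - ρ') * L) = -(I * I) * ((ρ - ρ') * L) by ring, Complex.I_mul_I]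
    apply Complex.ext <;> simp
  simp only [this]
  push_cast; ring
end KP
end
/-- If all zeros with `T < γ ≤ 2T` lie in the box of width `b/log T` about the critical
line, then every term of `Σ_{ρ,ρ'} Re K_b(-i(ρ-ρ')log T)` is positive, and the sum equals
`(1/(2π))(1 + 2∫₀¹ α(1-α)/cosh(bα) dα + O(1/√log T)) (T/(2π)) log T`. -/
theorem Kb_pair_sum_of_box (b : ℝ) (hb0 : 0 < b) (hb1 : b ≤ 1)
    (hbox : ∀ᶠ T in atTop, ∀ ρ ∈ zeroBand T, |ρ.re - 1/2| < b / (2 * Real.log T)) :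
    (∀ᶠ T in atTop, ∀ ρ ∈ zeroBand T, ∀ ρ' ∈ zeroBand T,
      0 < (Kb b (-Complex.I * (ρ - ρ') * Real.log T)).re) ∧
    ∃ C > 0, ∀ᶠ T in atTop, ∃ E : ℝ, |E| ≤ C / Real.sqrt (Real.log T) ∧
      (∑ᶠ ρ ∈ zeroBand T, ∑ᶠ ρ' ∈ zeroBand T,
        (zetaMult ρ : ℝ) * (zetaMult ρ' : ℝ) *
          (Kb b (-Complex.I * (ρ - ρ') * Real.log T)).re)
      = (1 / (2 * Real.pi)) *
          (1 + 2 * (∫ α in (0:ℝ)..1, α * (1 - α) / Real.cosh (b * α)) + E) *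
          (T / (2 * Real.pi)) * Real.log T := by
  have hbox2 : ∀ᶠ T in atTop, KP.BoxAt b T := hbox
  exact ⟨KP.main1 hb0 hbox2, KP.main2 hb0 hb1 hbox2⟩
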